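/- Let f : ℝ² → ℝ² be an orientation-preserving homeomorphism and U ⊊ ℝ² an open f-invariant simply connected set. If there is an accessible fixed point of f in ∂U (a fixed point that is the limit of an end-cut of U), then the prime ends rotation number ρ(f,U) is zero; that is, every homeomorphism F of c_E(U,ℝ²) extending f|_U has a fixed point in b_E(U,ℝ²). -/

import Mathlib

open Set Topology Filter

noncomputable section

universe u

variable {X : Type u} [TopologicalSpace X]

/-- A homeomorphism is *orientation preserving* if it is isotopic to the identity. -/
def IsOrientationPreserving (f : X ≃ₜ X) : Prop :=
  ∃ H : unitInterval × X → X,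
    Continuous H ∧ (∀ x, H (0, x) = x) ∧ (∀ x, H (1, x) = f x) ∧
      ∀ t : unitInterval, IsHomeomorph fun x => H (t, x)

/-- `D` is a connected component of `A`. -/
def IsCompOf (A D : Set X) : Prop := ∃ x ∈ A, D = connectedComponentIn A x

/-- `A` has exactly two connected components, the distinct sets `D₁` and `D₂`. -/
def HasTwoComps (A D₁ D₂ : Set X) : Prop :=
  IsCompOf A D₁ ∧ IsCompOf A D₂ ∧ D₁ ≠ D₂ ∧
    ∀ x ∈ A, connectedComponentIn A x = D₁ ∨ connectedComponentIn A x = D₂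

/-- A *cross-cut* of the open set `U`: the image of an arc `g` on `(0,1)`, where `g` is
continuous and injective on `[0,1]`'s interior, runs inside `U`, has endpoints on `∂U`, and
separates `U` into exactly two components, each with a boundary point on `∂U` away from the
closed arc. -/
def IsCrossCut (U γ : Set X) : Prop :=
  ∃ g : ℝ → X,
    ContinuousOn g (Icc 0 1) ∧ InjOn g (Ioo 0 1) ∧ (∀ t ∈ Ioo (0:ℝ) 1, g t ∈ U) ∧
      g 0 ∈ frontier U ∧ g 1 ∈ frontier U ∧ γ = g '' Ioo 0 1 ∧
      ∃ D₁ D₂ : Set X, HasTwoComps (U \ γ) D₁ D₂ ∧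
        (frontier D₁ ∩ (frontier U \ g '' Icc 0 1)).Nonempty ∧
        (frontier D₂ ∩ (frontier U \ g '' Icc 0 1)).Nonempty

/-- A *cross-section* of `U`: a connected component of `U ∖ γ` for a cross-cut `γ`. -/
def IsCrossSection (U D : Set X) : Prop := ∃ γ : Set X, IsCrossCut U γ ∧ IsCompOf (U \ γ) D

/-- The image of a set under the `k`-th integer iterate of a homeomorphism. -/
def iterZ (f : X ≃ₜ X) (k : ℤ) (A : Set X) : Set X := ⇑(f.toEquiv ^ k) '' A

/-- A cross-section of `U` which is wandering for `f^n`. -/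
def IsWanderingSection (f : X ≃ₜ X) (U : Set X) (n : ℕ) (D : Set X) : Prop :=
  IsCrossSection U D ∧ ∀ k : ℤ, k ≠ 0 → iterZ f ((n : ℤ) * k) D ∩ D = ∅

/-- `f` is ∂-nonwandering in `U`. -/
def BdNonwandering (f : X ≃ₜ X) (U : Set X) : Prop :=
  ∀ n : ℕ, 1 ≤ n → ∃ K : Set X, IsCompact K ∧ K ⊆ U ∧
    ∀ D : Set X, IsWanderingSection f U n D →
      (∃ k : ℤ, 0 < k ∧ (iterZ f ((n : ℤ) * k) D ∩ K).Nonempty) ∧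
      (∃ k : ℤ, k < 0 ∧ (iterZ f ((n : ℤ) * k) D ∩ K).Nonempty)

/-- The boundary of `D` inside `U` (for `D` open in `U`). -/
def bdIn (U D : Set X) : Set X := (closure D \ D) ∩ U

/-- A chain of cross-sections of `U`. -/
def IsPEChain (U : Set X) (D : ℕ → Set X) : Prop :=
  (∀ i, IsCrossSection U (D i)) ∧ (∀ i j : ℕ, j ≤ i → D i ⊆ D j) ∧
    ∀ i j : ℕ, i ≠ j → closure (bdIn U (D i)) ∩ closure (bdIn U (D j)) = ∅

/-- The chain `D` divides the cross-section `E`. -/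
def ChainDividesSection (D : ℕ → Set X) (E : Set X) : Prop := ∃ N : ℕ, ∀ i, N ≤ i → D i ⊆ E

/-- The chain `D` divides the chain `D'`. -/
def ChainDivides (D D' : ℕ → Set X) : Prop := ∀ n : ℕ, ∃ m : ℕ, D m ⊆ D' n

/-- A prime chain: a chain dividing every chain that divides it. -/
def IsPrimeChain (U : Set X) (D : ℕ → Set X) : Prop :=
  IsPEChain U D ∧ ∀ D' : ℕ → Set X, IsPEChain U D' → ChainDivides D' D → ChainDivides D D'

/-- The type of prime chains of `U`. -/
def PrimeChain (U : Set X) : Type u := {D : ℕ → Set X // IsPrimeChain U D}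

/-- A prime end of `U`: an equivalence class of prime chains. -/
def PrimeEnd (U : Set X) : Type u :=
  Quot fun C C' : PrimeChain U => ChainDivides C.1 C'.1 ∧ ChainDivides C'.1 C.1

/-- The prime end `p` divides the cross-section `E`. -/
def PrimeEndDivides {U : Set X} (p : PrimeEnd U) (E : Set X) : Prop :=
  ∃ C : PrimeChain U, Quot.mk _ C = p ∧ ChainDividesSection C.1 E

/-- The prime ends compactification of `U` (as a set: `U ⊔ (prime ends)`). -/
def PrimeEndComp (U : Set X) : Type u := ↥U ⊕ PrimeEnd U

/-- A point of `U`, as an element of the prime ends compactification. -/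
def pePt (U : Set X) (x : ↥U) : PrimeEndComp U := Sum.inl x

/-- A prime end, as an element of the prime ends compactification. -/
def peEnd (U : Set X) (p : PrimeEnd U) : PrimeEndComp U := Sum.inr p

/-- The copy of a subset `V ⊆ U` inside the prime ends compactification. -/
def peOpen (U V : Set X) : Set (PrimeEndComp U) := {z | ∃ x : ↥U, z = pePt U x ∧ (x : X) ∈ V}

/-- The basic set `E ∪ i_E(E)` of the prime ends compactification, for a cross-section `E`. -/
def peSection (U E : Set X) : Set (PrimeEndComp U) :=
  peOpen U E ∪ {z | ∃ p : PrimeEnd U, z = peEnd U p ∧ PrimeEndDivides p E}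

/-- The topology of the prime ends compactification. -/
instance primeEndCompTopology (U : Set X) : TopologicalSpace (PrimeEndComp U) :=
  TopologicalSpace.generateFrom
    ({s | ∃ V : Set X, IsOpen V ∧ V ⊆ U ∧ s = peOpen U V} ∪
      {s | ∃ E : Set X, IsCrossSection U E ∧ s = peSection U E})

/-- The circle of prime ends, as a subset of the prime ends compactification. -/
def PrimeEndCircle (U : Set X) : Set (PrimeEndComp U) := Set.range (peEnd U)

/-- `F` is an extension of `f|_U` to the prime ends compactification of `U`. -/
def IsPEExtension (f : X ≃ₜ X) (U : Set X) (F : PrimeEndComp U ≃ₜ PrimeEndComp U) : Prop :=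
  ∀ (x : X) (hx : x ∈ U) (hfx : f x ∈ U), F (pePt U ⟨x, hx⟩) = pePt U ⟨f x, hfx⟩

/-- An end-cut of `U`: an injective arc in `U` defined on `[0,1)` converging in the ambient
space as `t → 1⁻`. -/
def IsEndCut (U : Set X) (γ : ℝ → X) : Prop :=
  ContinuousOn γ (Ico 0 1) ∧ InjOn γ (Ico 0 1) ∧ (∀ t ∈ Ico (0:ℝ) 1, γ t ∈ U) ∧
    ∃ z : X, Tendsto γ (𝓝[<] (1:ℝ)) (𝓝 z)

/-- `z` is an accessible point of `∂U`. -/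
def IsAccessiblePoint (U : Set X) (z : X) : Prop :=
  ∃ γ : ℝ → X, IsEndCut U γ ∧ Tendsto γ (𝓝[<] (1:ℝ)) (𝓝 z)

/-- `p` is an accessible prime end of `U`. -/
def IsAccessiblePrimeEnd (U : Set X) (p : PrimeEnd U) : Prop :=
  ∃ (γ : ℝ → X) (hγ : ∀ t ∈ Ico (0:ℝ) 1, γ t ∈ U), IsEndCut U γ ∧
    Tendsto (fun t : ↥(Ico (0:ℝ) 1) => pePt U ⟨γ ↑t, hγ ↑t t.2⟩)
      (comap Subtype.val (𝓝[<] (1:ℝ))) (𝓝 (peEnd U p))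

/-- A translation arc for `f` based at `x`: a simple arc from `x` to `f x` meeting its image
only as allowed. -/
def IsTranslationArc (f : X ≃ₜ X) (γ : Set X) (x : X) : Prop :=
  f x ≠ x ∧
    ∃ g : ℝ → X, ContinuousOn g (Icc 0 1) ∧ InjOn g (Icc 0 1) ∧
      g 0 = x ∧ g 1 = f x ∧ γ = g '' Icc 0 1 ∧
      ((⇑f '' γ) ∩ γ = {f x} ∨ ((⇑f '' γ) ∩ γ = {x, f x} ∧ f (f x) = x))

/-- An `N`-translation arc for `f` based at `x` (for `N = 1` this is just a translation arc). -/
def IsNTranslationArc (f : X ≃ₜ X) (N : ℕ) (γ : Set X) (x : X) : Prop :=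
  IsTranslationArc f γ x ∧
    (2 ≤ N →
      (∀ k : ℕ, 2 ≤ k → k ≤ N - 1 → (⇑f)^[k] '' γ ∩ γ = ∅) ∧
        ((⇑f)^[N] '' γ ∩ γ = ∅ ∨ ((⇑f)^[N] '' γ ∩ γ = {x} ∧ (⇑f)^[N + 1] x = x)))

/-- An ∞-translation arc: an `N`-translation arc for every `N ≥ 1`. -/
def IsInfTranslationArc (f : X ≃ₜ X) (γ : Set X) (x : X) : Prop :=
  ∀ N : ℕ, 1 ≤ N → IsNTranslationArc f N γ x

/-- A nonwandering homeomorphism. -/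
def IsNonwanderingMap (f : X → X) : Prop :=
  ∀ V : Set X, IsOpen V → V.Nonempty → ∃ n : ℕ, 1 ≤ n ∧ (f^[n] '' V ∩ V).Nonempty

/-- A loop contained in `A` which is not null-homotopic in `V`. -/
def IsEssentialLoopIn (V A : Set X) : Prop :=
  ∃ (z : ↥V) (δ : Path z z), (∀ t : unitInterval, (↑(δ t) : X) ∈ A) ∧
    ¬ δ.Homotopic (Path.refl z)

/-- An annular continuum: a continuum with an open annular neighborhood `V` such that `V ∖ K`
has exactly two components, each essential in `V`. -/
def IsAnnularContinuum (K : Set X) : Prop :=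
  IsCompact K ∧ IsConnected K ∧ K.Nontrivial ∧
    ∃ V : Set X, IsOpen V ∧ K ⊆ V ∧
      Nonempty (↥V ≃ₜ AddCircle (1 : ℝ) × ↥(Ioo (0 : ℝ) 1)) ∧
      ∃ D₁ D₂ : Set X, HasTwoComps (V \ K) D₁ D₂ ∧
        IsEssentialLoopIn V D₁ ∧ IsEssentialLoopIn V D₂

/-- A set contractible in the ambient surface: it has an open neighborhood homeomorphic to the
plane. -/
def ContractibleInSurface (K : Set X) : Prop :=
  ∃ W : Set X, IsOpen W ∧ K ⊆ W ∧ Nonempty (↥W ≃ₜ (ℝ × ℝ))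

/-- `α ∈ ℝ/ℤ` is rational. -/
def IsRationalAC (α : AddCircle (1 : ℝ)) : Prop := ∃ r : ℚ, α = ((r : ℝ) : AddCircle (1 : ℝ))

/-- The constant `q(α,g)`: the smallest positive integer `q` with `‖qα‖ = 0` if `α` is
rational, and `(2g+1)‖qα‖ < ‖α‖` if `α` is irrational. -/
def qConst (α : AddCircle (1 : ℝ)) (g : ℕ) : ℕ :=
  sInf {q : ℕ | 0 < q ∧
    ((IsRationalAC α ∧ ‖q • α‖ = 0) ∨
      (¬IsRationalAC α ∧ ((2 * g + 1 : ℕ) : ℝ) * ‖q • α‖ < ‖α‖))}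

section Transport

variable {Y : Type u} [TopologicalSpace Y]

theorem Homeomorph.image_connectedComponentIn_eq (e : X ≃ₜ Y) (A : Set X) {x : X} (hx : x ∈ A) :
    e '' connectedComponentIn A x = connectedComponentIn (e '' A) (e x) := by
  apply Subset.antisymm (e.continuous.continuousOn.image_connectedComponentIn_subset hx)
  have := e.symm.continuous.continuousOn.image_connectedComponentIn_subset
    (mem_image_of_mem e hx)
  simp only [e.symm_apply_apply, image_image, image_id'] at this
  intro y hy
  exact ⟨e.symm y, this (mem_image_of_mem _ hy), e.apply_symm_apply y⟩

theorem IsCompOf.image (e : X ≃ₜ Y) {A D : Set X} (h : IsCompOf A D) :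
    IsCompOf (e '' A) (e '' D) := by
  obtain ⟨x, hx, rfl⟩ := h
  exact ⟨e x, mem_image_of_mem e hx, e.image_connectedComponentIn_eq A hx⟩

theorem HasTwoComps.image (e : X ≃ₜ Y) {A D₁ D₂ : Set X} (h : HasTwoComps A D₁ D₂) :
    HasTwoComps (e '' A) (e '' D₁) (e '' D₂) := by
  obtain ⟨h1, h2, h3, h4⟩ := h
  refine ⟨h1.image e, h2.image e, fun h => h3 (e.injective.image_injective h), ?_⟩
  rintro _ ⟨x, hx, rfl⟩
  rw [← e.image_connectedComponentIn_eq A hx]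
  exact (h4 x hx).imp (congrArg _) (congrArg _)

theorem IsCrossCut.image (e : X ≃ₜ Y) {U γ : Set X} (h : IsCrossCut U γ) :
    IsCrossCut (e '' U) (e '' γ) := by
  obtain ⟨g, hg, hi, hm, h0, h1, rfl, D₁, D₂, hD, hn1, hn2⟩ := h
  have key : ∀ D : Set X, (frontier D ∩ (frontier U \ g '' Icc 0 1)).Nonempty →
      (frontier (e '' D) ∩ (frontier (e '' U) \ (e ∘ g) '' Icc 0 1)).Nonempty := by
    intro D hD
    rw [image_comp, ← e.image_frontier, ← e.image_frontier, ← image_sdiff e.injective,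
      ← image_inter e.injective]
    exact hD.image e
  refine ⟨e ∘ g, e.continuous.comp_continuousOn hg, e.injective.injOn.comp hi (mapsTo_univ _ _),
    fun t ht => mem_image_of_mem e (hm t ht), ?_, ?_, (image_comp _ _ _).symm,
    e '' D₁, e '' D₂, ?_, key _ hn1, key _ hn2⟩
  · rw [← e.image_frontier]; exact mem_image_of_mem e h0
  · rw [← e.image_frontier]; exact mem_image_of_mem e h1
  · rw [← image_sdiff e.injective]; exact hD.image e

theorem IsCrossSection.image (e : X ≃ₜ Y) {U D : Set X} (h : IsCrossSection U D) :
    IsCrossSection (e '' U) (e '' D) := by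
  obtain ⟨γ, h1, h2⟩ := h
  refine ⟨e '' γ, h1.image e, ?_⟩
  rw [← image_sdiff e.injective]
  exact h2.image e

theorem bdIn_image (e : X ≃ₜ Y) (U D : Set X) : bdIn (e '' U) (e '' D) = e '' bdIn U D := by
  rw [bdIn, bdIn, image_inter e.injective, image_sdiff e.injective, e.image_closure]

theorem IsPEChain.image (e : X ≃ₜ Y) {U : Set X} {D : ℕ → Set X} (h : IsPEChain U D) :
    IsPEChain (e '' U) fun n => e '' D n := by
  obtain ⟨h1, h2, h3⟩ := h
  refine ⟨fun i => (h1 i).image e, fun i j hij => image_mono (h2 i j hij), fun i j hij => ?_⟩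
  rw [bdIn_image, bdIn_image, ← e.image_closure, ← e.image_closure, ← image_inter e.injective,
    h3 i j hij, image_empty]

theorem ChainDivides.image (e : X ≃ₜ Y) {D D' : ℕ → Set X} (h : ChainDivides D D') :
    ChainDivides (fun n => e '' D n) fun n => e '' D' n := fun n =>
  (h n).imp fun _ hm => image_mono hm

theorem IsPrimeChain.image (e : X ≃ₜ Y) {U : Set X} {D : ℕ → Set X} (h : IsPrimeChain U D) :
    IsPrimeChain (e '' U) fun n => e '' D n := by
  refine ⟨h.1.image e, fun D' hD' hdiv => ?_⟩
  have h1 := hD'.image e.symm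
  have h2 := hdiv.image e.symm
  simp only [image_image, e.symm_apply_apply, image_id'] at h1 h2
  have h3 := (h.2 _ h1 h2).image e
  simpa only [image_image, e.apply_symm_apply, image_id'] using h3

end Transport

theorem ChainDivides.trans {Z : Type*} {D D' D'' : ℕ → Set Z} (h : ChainDivides D D')
    (h' : ChainDivides D' D'') : ChainDivides D D'' := fun n => by
  obtain ⟨m, hm⟩ := h' n
  obtain ⟨k, hk⟩ := h m
  exact ⟨k, hk.trans hm⟩

theorem ChainDivides.refl {Z : Type*} (D : ℕ → Set Z) : ChainDivides D D := fun n => ⟨n, Subset.rfl⟩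

theorem primeEnd_mk_eq_iff {U : Set X} {C C' : PrimeChain U} :
    (Quot.mk _ C : PrimeEnd U) = Quot.mk _ C' ↔
      ChainDivides C.1 C'.1 ∧ ChainDivides C'.1 C.1 := by
  refine ⟨fun h => ?_, fun h => Quot.sound h⟩
  have he : Equivalence fun C C' : PrimeChain U =>
      ChainDivides C.1 C'.1 ∧ ChainDivides C'.1 C.1 :=
    ⟨fun C => ⟨.refl _, .refl _⟩, fun h => ⟨h.2, h.1⟩,
      fun h h' => ⟨h.1.trans h'.1, h'.2.trans h.2⟩⟩
  exact (Equivalence.quot_mk_eq_iff he _ _).1 h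

theorem exists_peOpen_subset_of_isOpen {U : Set X} {s : Set (PrimeEndComp U)} (hs : IsOpen s)
    (C : PrimeChain U) (hC : peEnd U (Quot.mk _ C) ∈ s) : ∃ m, peOpen U (C.1 m) ⊆ s := by
  induction hs with
  | basic s hs =>
    rcases hs with ⟨V, -, -, rfl⟩ | ⟨E, -, rfl⟩
    · obtain ⟨x, hx, -⟩ := hC
      cases hx
    · rcases hC with ⟨x, hx, -⟩ | ⟨p, hp, C', hC', N, hN⟩
      · cases hx
      · have hp' : (Quot.mk _ C : PrimeEnd U) = p := Sum.inr_injective hp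
        obtain ⟨m, hm⟩ := (primeEnd_mk_eq_iff.1 (hp'.trans hC'.symm)).1 N
        refine ⟨m, fun z hz => Or.inl ?_⟩
        obtain ⟨x, hx, hxm⟩ := hz
        exact ⟨x, hx, hN N le_rfl (hm hxm)⟩
  | univ => exact ⟨0, subset_univ _⟩
  | inter s t _ _ hs ht =>
    obtain ⟨m, hm⟩ := hs hC.1
    obtain ⟨k, hk⟩ := ht hC.2
    refine ⟨max m k, ?_⟩
    rintro z ⟨x, hx, hxm⟩
    exact ⟨hm ⟨x, hx, C.2.1.2.1 _ _ (le_max_left _ _) hxm⟩,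
      hk ⟨x, hx, C.2.1.2.1 _ _ (le_max_right _ _) hxm⟩⟩
  | sUnion S _ ih =>
    obtain ⟨s, hs, hCs⟩ := hC
    obtain ⟨m, hm⟩ := ih s hs hCs
    exact ⟨m, hm.trans (subset_sUnion_of_mem hs)⟩

theorem IsPEChain.subset {U : Set X} {D : ℕ → Set X} (h : IsPEChain U D) (n : ℕ) : D n ⊆ U := by
  obtain ⟨γ, -, x, -, hD⟩ := h.1 n
  rw [hD]
  exact (connectedComponentIn_subset _ _).trans sdiff_subset

/-- A prime chain dividing its own preimage under `f` gives a fixed prime end. -/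
theorem exists_fixed_primeEnd_of_chainDivides (f : X ≃ₜ X) {U : Set X} (hf : ⇑f '' U = U)
    {C : ℕ → Set X} (hC : IsPrimeChain U C) (hdiv : ChainDivides (fun n => ⇑f '' C n) C)
    (F : PrimeEndComp U ≃ₜ PrimeEndComp U) (hF : IsPEExtension f U F) :
    ∃ p : PrimeEnd U, F (peEnd U p) = peEnd U p := by
  set p : PrimeEnd U := Quot.mk _ ⟨C, hC⟩ with hp
  refine ⟨p, ?_⟩
  rcases hq : F (peEnd U p) with x | q
  · exfalso
    have hx : (x : X) ∈ ⇑f '' U := hf.symm ▸ x.2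
    obtain ⟨y, hy, hyx⟩ := hx
    have h1 := hF y hy (hyx ▸ x.2)
    have h2 : F (pePt U ⟨y, hy⟩) = F (peEnd U p) := by
      rw [h1, hq]
      exact congrArg Sum.inl (Subtype.ext hyx)
    cases F.injective h2
  · obtain ⟨C', rfl⟩ := Quot.exists_rep q
    change F (peEnd U p) = peEnd U (Quot.mk _ C') at hq
    change peEnd U (Quot.mk _ C') = peEnd U p
    have hfC : IsPEChain U fun n => ⇑f '' C n := by
      have := hC.1.image f
      rwa [hf] at this
    have h1 : ChainDivides (fun n => ⇑f '' C n) C'.1 := by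
      intro n
      have ho : IsOpen (F ⁻¹' peSection U (C'.1 n)) := by
        apply IsOpen.preimage F.continuous
        exact TopologicalSpace.isOpen_generateFrom_of_mem (Or.inr ⟨_, C'.2.1.1 n, rfl⟩)
      obtain ⟨m, hm⟩ := exists_peOpen_subset_of_isOpen ho ⟨C, hC⟩ (by
        change F (peEnd U p) ∈ peSection U (C'.1 n)
        rw [hq]
        exact Or.inr ⟨_, rfl, C', rfl, n, fun i hi => C'.2.1.2.1 _ _ hi⟩)
      refine ⟨m, ?_⟩
      rintro _ ⟨x, hx, rfl⟩
      have hxU := hC.1.subset m hx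
      have hfx : f x ∈ U := hf ▸ mem_image_of_mem f hxU
      have h2 : F (pePt U ⟨x, hxU⟩) ∈ peSection U (C'.1 n) := hm ⟨_, rfl, hx⟩
      rw [hF x hxU hfx] at h2
      rcases h2 with ⟨y, hy, hyn⟩ | ⟨y, hy, -⟩
      · rw [← (congrArg Subtype.val (Sum.inl_injective hy) : f x = y)] at hyn
        exact hyn
      · cases hy
    have h2 := C'.2.2 _ hfC h1
    have h3 := hC.2 _ hfC hdiv
    exact congrArg _ (primeEnd_mk_eq_iff.2 ⟨h2.trans hdiv, h3.trans h1⟩)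

/-- A sequence of sets none of whose subsequences joins two disjoint compact sets. -/
def IsNullSeq (S : ℕ → Set X) : Prop :=
  ∀ A B : Set X, IsCompact A → IsCompact B → Disjoint A B →
    ∀ᶠ n in atTop, ¬((S n ∩ A).Nonempty ∧ (S n ∩ B).Nonempty)

theorem IsNullSeq.image {Y : Type*} [TopologicalSpace Y] (e : X ≃ₜ Y) {S : ℕ → Set X}
    (hS : IsNullSeq S) : IsNullSeq fun n => e '' S n := by
  intro A B hA hB hAB
  have h := hS (e ⁻¹' A) (e ⁻¹' B) (e.isCompact_preimage.2 hA) (e.isCompact_preimage.2 hB)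
    (hAB.preimage e)
  filter_upwards [h] with n hn hc
  refine hn ⟨?_, ?_⟩
  · obtain ⟨_, ⟨x, hx, rfl⟩, hxA⟩ := hc.1
    exact ⟨x, hx, hxA⟩
  · obtain ⟨_, ⟨x, hx, rfl⟩, hxB⟩ := hc.2
    exact ⟨x, hx, hxB⟩

theorem IsPreconnected.subset_of_disjoint_bdIn {U D T : Set X} (hD : IsOpen D)
    (hT : IsPreconnected T) (hTU : T ⊆ U) (hd : Disjoint T (bdIn U D)) (hm : (T ∩ D).Nonempty) :
    T ⊆ D := by
  refine hT.subset_left_of_subset_union hD isClosed_closure.isOpen_compl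
    (disjoint_compl_right.mono_left subset_closure) (fun x hx => ?_) hm
  by_contra hc
  rw [mem_union, not_or, mem_compl_iff, not_not] at hc
  exact disjoint_left.1 hd hx ⟨⟨hc.2, hc.1⟩, hTU hx⟩

theorem IsCompOf.isPreconnected {A D : Set X} (h : IsCompOf A D) : IsPreconnected D := by
  obtain ⟨x, -, rfl⟩ := h
  exact isPreconnected_connectedComponentIn

theorem IsCompOf.nonempty {A D : Set X} (h : IsCompOf A D) : D.Nonempty := by
  obtain ⟨x, hx, rfl⟩ := h
  exact ⟨x, mem_connectedComponentIn hx⟩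

theorem IsCompOf.subset {A D : Set X} (h : IsCompOf A D) : D ⊆ A := by
  obtain ⟨x, hx, rfl⟩ := h
  exact connectedComponentIn_subset _ _

theorem IsCompOf.eq_of_mem {A D : Set X} (h : IsCompOf A D) {x : X} (hx : x ∈ D) :
    D = connectedComponentIn A x := by
  obtain ⟨y, hy, rfl⟩ := h
  exact connectedComponentIn_eq hx

/-- The cross-cut, the two pieces and the compactness properties of a cross-section. -/
theorem IsCrossSection.exists_pieces [T2Space X] [LocallyConnectedSpace X] {U D : Set X}
    (hU : IsOpen U) (h : IsCrossSection U D) :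
    IsOpen D ∧ IsPreconnected D ∧ D.Nonempty ∧ D ⊆ U ∧ IsCompact (closure (bdIn U D)) ∧
      ∃ γ E : Set X, γ.Nonempty ∧ E.Nonempty ∧ IsPreconnected γ ∧ IsPreconnected E ∧
        γ ⊆ U ∧ E ⊆ U ∧ Disjoint D γ ∧ Disjoint D E ∧ U ⊆ D ∪ γ ∪ E := by
  obtain ⟨γ, ⟨g, hg, -, hgU, h0, h1, rfl, D₁, D₂, ⟨hD₁, hD₂, hne, hall⟩, -, -⟩, hD⟩ := h
  have hgc : IsCompact (g '' Icc 0 1) := isCompact_Icc.image_of_continuousOn hg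
  have hU' : U \ g '' Ioo 0 1 = U \ g '' Icc 0 1 := by
    apply Subset.antisymm
    · rintro x ⟨hxU, hx⟩
      refine ⟨hxU, ?_⟩
      rintro ⟨t, ht, rfl⟩
      rcases eq_or_lt_of_le ht.1 with rfl | h0'
      · rw [hU.frontier_eq] at h0
        exact h0.2 hxU
      · rcases eq_or_lt_of_le ht.2 with rfl | h1'
        · rw [hU.frontier_eq] at h1
          exact h1.2 hxU
        · exact hx ⟨t, ⟨h0', h1'⟩, rfl⟩
    · exact sdiff_subset_sdiff_right (image_mono Ioo_subset_Icc_self)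
  have hUo : IsOpen (U \ g '' Ioo 0 1) := by
    rw [hU']
    exact hU.sdiff hgc.isClosed
  have hopen : ∀ {E}, IsCompOf (U \ g '' Ioo 0 1) E → IsOpen E := by
    rintro E ⟨x, -, rfl⟩
    exact hUo.connectedComponentIn
  have hdisj : ∀ {E E'}, IsCompOf (U \ g '' Ioo 0 1) E → IsCompOf (U \ g '' Ioo 0 1) E' →
      E ≠ E' → Disjoint E E' := by
    intro E E' hE hE' hn
    refine disjoint_left.2 fun x hx hx' => hn ?_
    rw [hE.eq_of_mem hx, hE'.eq_of_mem hx']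
  obtain ⟨E, hE, hED, hcov⟩ : ∃ E, IsCompOf (U \ g '' Ioo 0 1) E ∧ D ≠ E ∧
      ∀ x ∈ U \ g '' Ioo 0 1, x ∈ D ∨ x ∈ E := by
    have key : ∀ x ∈ U \ g '' Ioo 0 1, x ∈ D₁ ∨ x ∈ D₂ := fun x hx => by
      rcases hall x hx with h | h
      · exact Or.inl (h ▸ mem_connectedComponentIn hx)
      · exact Or.inr (h ▸ mem_connectedComponentIn hx)
    obtain ⟨x, hx, hDx⟩ := hD
    rcases hall x hx with h | h
    · exact ⟨D₂, hD₂, by rwa [hDx, h], fun y hy => by rw [hDx, h]; exact key y hy⟩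
    · exact ⟨D₁, hD₁, by rw [hDx, h]; exact hne.symm,
        fun y hy => by rw [hDx, h]; exact (key y hy).symm⟩
  have hbd : bdIn U D ⊆ g '' Ioo 0 1 := by
    rintro x ⟨⟨hxc, hxD⟩, hxU⟩
    by_contra hx
    rcases hcov x ⟨hxU, hx⟩ with h | h
    · exact hxD h
    · have := ((hdisj hD hE hED).closure_left (hopen hE))
      exact disjoint_left.1 this hxc h
  have hsub : ∀ {E}, IsCompOf (U \ g '' Ioo 0 1) E → E ⊆ U := fun hE =>
    hE.subset.trans sdiff_subset
  refine ⟨hopen hD, hD.isPreconnected, hD.nonempty, hsub hD,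
    hgc.of_isClosed_subset isClosed_closure
      (closure_minimal (hbd.trans (image_mono Ioo_subset_Icc_self)) hgc.isClosed),
    g '' Ioo 0 1, E, (nonempty_Ioo.2 zero_lt_one).image g, hE.nonempty,
    isPreconnected_Ioo.image g (hg.mono Ioo_subset_Icc_self), hE.isPreconnected,
    image_subset_iff.2 hgU, hsub hE, disjoint_left.2 fun x hx => (hD.subset hx).2,
    hdisj hD hE hED, fun x hx => ?_⟩
  by_cases hxg : x ∈ g '' Ioo 0 1
  · exact Or.inl (Or.inr hxg)
  · rcases hcov x ⟨hx, hxg⟩ with h | h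
    · exact Or.inl (Or.inl h)
    · exact Or.inr h

/-- A chain whose cross-cuts form a null sequence is prime. -/
theorem IsPEChain.isPrimeChain_of_isNullSeq [T2Space X] [LocallyConnectedSpace X] {U : Set X}
    (hU : IsOpen U) {D : ℕ → Set X} (hD : IsPEChain U D)
    (hS : ∀ n, IsPreconnected (bdIn U (D n))) (hnull : IsNullSeq fun n => bdIn U (D n))
    (hesc : ∀ x ∈ U, ∃ n, x ∉ D n) : IsPrimeChain U D := by
  refine ⟨hD, fun D' hD' hdiv => ?_⟩
  by_contra hc
  simp only [ChainDivides, not_forall, not_exists] at hc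
  obtain ⟨k, hk⟩ := hc
  have hev : ∀ x ∈ U, ∀ᶠ n in atTop, x ∉ D n := fun x hx => by
    obtain ⟨n, hn⟩ := hesc x hx
    exact eventually_atTop.2 ⟨n, fun m hm h => hn (hD.2.1 _ _ hm h)⟩
  have hmeet : ∀ j, k ≤ j → ∀ᶠ n in atTop,
      (bdIn U (D n) ∩ closure (bdIn U (D' j))).Nonempty := by
    intro j hj
    obtain ⟨hD'o, hD'c, ⟨x, hx⟩, hD'U, -, γ, E, ⟨y, hy⟩, ⟨w, hw⟩, hγ, hE, hγU, hEU, hDγ, hDE,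
      hcov⟩ := (hD'.1 j).exists_pieces hU
    filter_upwards [hev x (hD'U hx), hev y (hγU hy), hev w (hEU hw)] with n hxn hyn hwn
    by_contra hne
    have hDo : IsOpen (D n) := ((hD.1 n).exists_pieces hU).1
    have hd : Disjoint (bdIn U (D n)) (bdIn U (D' j)) :=
      (disjoint_iff_inter_eq_empty.2 (not_nonempty_iff_eq_empty.1 hne)).mono_right
        subset_closure
    by_cases hcase : (bdIn U (D n) ∩ D' j).Nonempty
    · have hsub := (hS n).subset_of_disjoint_bdIn hD'o inter_subset_right hd hcase
      obtain ⟨v, hv, hv'⟩ := not_subset.1 fun h => hk n (h.trans (hD'.2.1 _ _ hj))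
      rcases hcov (hD.subset n hv) with (h | h) | h
      · exact hv' h
      · exact hyn (hγ.subset_of_disjoint_bdIn hDo hγU (hDγ.symm.mono_right hsub) ⟨v, h, hv⟩ hy)
      · exact hwn (hE.subset_of_disjoint_bdIn hDo hEU (hDE.symm.mono_right hsub) ⟨v, h, hv⟩ hw)
    · obtain ⟨m, hm⟩ := hdiv n
      obtain ⟨v, hv⟩ := ((hD'.1 (max m j)).exists_pieces hU).2.2.1
      refine hxn (hD'c.subset_of_disjoint_bdIn hDo hD'U ?_
        ⟨v, hD'.2.1 _ _ (le_max_right _ _) hv, hm (hD'.2.1 _ _ (le_max_left _ _) hv)⟩ hx)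
      exact (disjoint_iff_inter_eq_empty.2 (not_nonempty_iff_eq_empty.1 hcase)).symm
  obtain ⟨n, h1, h2, h3⟩ := ((hmeet k le_rfl).and ((hmeet (k + 1) k.le_succ).and
    (hnull _ _ ((hD'.1 k).exists_pieces hU).2.2.2.2.1
      ((hD'.1 (k + 1)).exists_pieces hU).2.2.2.2.1
      (disjoint_iff_inter_eq_empty.2 (hD'.2.2 k (k + 1) (by simp)))))).exists
  exact h3 ⟨h1, h2⟩

open Metric in
/-- A quantitative Hurwitz theorem: nearby functions take all values close to `g a` near `a`. -/
theorem hurwitz_local {ι : Type*} {p : Filter ι} {V : Set ℂ} (hV : IsOpen V) {F : ι → ℂ → ℂ}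
    {g : ℂ → ℂ} (hF : TendstoLocallyUniformlyOn F g p V)
    (hFd : ∀ᶠ n in p, DifferentiableOn ℂ (F n) V) (hg : DifferentiableOn ℂ g V) {a : ℂ}
    (ha : a ∈ V) (hne : ¬ ∀ᶠ z in 𝓝 a, g z = g a) {r : ℝ} (hr : 0 < r) :
    ∃ ε > 0, ∀ᶠ n in p, ball (g a) ε ⊆ F n '' (closedBall a r ∩ V) := by
  have hga : AnalyticAt ℂ g a := hg.analyticOnNhd hV a ha
  have h1 : ∀ᶠ z in 𝓝[≠] a, g z ≠ g a :=
    (hga.eventually_eq_or_eventually_ne analyticAt_const).resolve_left hne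
  rw [eventually_nhdsWithin_iff] at h1
  obtain ⟨R, hR, hRs⟩ := nhds_basis_ball.eventually_iff.1 (h1.and (hV.mem_nhds ha))
  set s := min (R / 2) r with hs
  have hs0 : 0 < s := lt_min (half_pos hR) hr
  have hsR : closedBall a s ⊆ ball a R :=
    closedBall_subset_ball ((min_le_left _ _).trans_lt (half_lt_self hR))
  have hRV : ball a R ⊆ V := fun z hz => (hRs hz).2
  have hsph : IsCompact (sphere a s) := isCompact_sphere a s
  have hsphne : (sphere a s).Nonempty := NormedSpace.sphere_nonempty.2 hs0.le
  have hgc : ContinuousOn (fun z => ‖g z - g a‖) (sphere a s) :=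
    ((hg.continuousOn.mono ((sphere_subset_closedBall.trans hsR).trans hRV)).sub
      continuousOn_const).norm
  obtain ⟨b, hb, hbmin⟩ := hsph.exists_isMinOn hsphne hgc
  set ε := ‖g b - g a‖ with hε
  have hba : b ≠ a := by
    rintro rfl
    simp only [mem_sphere, dist_self] at hb
    exact hs0.ne hb
  have hε0 : 0 < ε := norm_pos_iff.2
    (sub_ne_zero.2 ((hRs (hsR (sphere_subset_closedBall hb))).1 hba))
  refine ⟨ε / 8, by positivity, ?_⟩
  have hun := (tendstoLocallyUniformlyOn_iff_forall_isCompact hV).1 hF _ (hsR.trans hRV)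
    (isCompact_closedBall a s)
  filter_upwards [hFd, tendstoUniformlyOn_iff.1 hun (ε / 8) (by positivity)] with n hn hnu
  have hFa := hnu a (mem_closedBall_self hs0.le)
  have hlow : ∀ z ∈ sphere a s, ε / 2 ≤ ‖F n z - F n a‖ := fun z hz => by
    have h2 : ε ≤ ‖g z - g a‖ := hbmin hz
    have h3 := hnu z (sphere_subset_closedBall hz)
    rw [dist_eq_norm] at h3 hFa
    have h4 : g z - g a = (g z - F n z) + (F n z - F n a) - (g a - F n a) := by ring
    have h5 := norm_sub_le ((g z - F n z) + (F n z - F n a)) (g a - F n a)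
    have h6 := norm_add_le (g z - F n z) (F n z - F n a)
    rw [← h4] at h5
    linarith
  have hd : DiffContOnCl ℂ (F n) (ball a s) := by
    apply DifferentiableOn.diffContOnCl
    rw [closure_ball a hs0.ne']
    exact hn.mono (hsR.trans hRV)
  have hfr : ∃ᶠ z in 𝓝 a, F n z ≠ F n a := by
    intro hcon
    simp only [ne_eq, not_not] at hcon
    have := ((hn.mono hRV).analyticOnNhd isOpen_ball).eqOn_of_preconnected_of_eventuallyEq
      (analyticOnNhd_const (v := F n a)) (convex_ball a R).isPreconnected (mem_ball_self hR) hcon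
    have h2 := hlow b hb
    rw [this (hsR (sphere_subset_closedBall hb)), sub_self, norm_zero] at h2
    linarith
  have hsub := hd.ball_subset_image_closedBall hs0 hlow hfr
  intro z hz
  have hz' : z ∈ ball (F n a) (ε / 2 / 2) := by
    rw [mem_ball] at hz ⊢
    linarith [dist_triangle z (g a) (F n a)]
  obtain ⟨w, hw, rfl⟩ := hsub hz'
  exact ⟨w, ⟨closedBall_subset_closedBall (min_le_right _ _) hw, hRV (hsR hw)⟩, rfl⟩

open Metric in
/-- Along an ultrafilter, a family of holomorphic maps to the disk converges locally uniformly. -/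
theorem exists_tendstoLocallyUniformlyOn_of_mapsTo_ball {ι : Type*} (p : Ultrafilter ι)
    {V : Set ℂ} (hV : IsOpen V) {F : ι → ℂ → ℂ} (hFd : ∀ n, DifferentiableOn ℂ (F n) V)
    (hF : ∀ n, MapsTo (F n) V (ball 0 1)) :
    ∃ g : ℂ → ℂ, TendstoLocallyUniformlyOn F g p V ∧
      ∀ z ∈ V, Tendsto (fun n => F n z) p (𝓝 (g z)) := by
  have hlim : ∀ z, ∃ w, z ∈ V → Tendsto (fun n => F n z) p (𝓝 w) := fun z => by
    by_cases hz : z ∈ V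
    · have := (isCompact_closedBall (0 : ℂ) 1).ultrafilter_le_nhds (p.map fun n => F n z) (by
        rw [le_principal_iff]
        exact Filter.mem_map.2 (univ_mem' fun n => ball_subset_closedBall (hF n hz)))
      obtain ⟨w, -, hw⟩ := this
      exact ⟨w, fun _ => hw⟩
    · exact ⟨0, fun h => absurd h hz⟩
  choose g hg using hlim
  refine ⟨g, Metric.tendstoLocallyUniformlyOn_iff.2 fun ε hε z hz => ?_, hg⟩
  obtain ⟨R, hR, hRV⟩ := Metric.isOpen_iff.1 hV z hz
  have hLip : ∀ n, ∀ w ∈ ball z R, dist (F n w) (F n z) ≤ 2 / R * dist w z := fun n w hw => by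
    refine Complex.dist_le_div_mul_dist_of_mapsTo_ball ((hFd n).mono hRV) (fun v hv => ?_) hw
    have h1 := hF n (hRV hv)
    have h2 := hF n hz
    rw [mem_ball_zero_iff] at h1 h2
    rw [mem_closedBall, dist_eq_norm]
    linarith [norm_sub_le (F n v) (F n z)]
  have hLg : ∀ w ∈ ball z R, dist (g w) (g z) ≤ 2 / R * dist w z := fun w hw =>
    le_of_tendsto ((hg w (hRV hw)).dist (hg z hz)) (Eventually.of_forall fun n => hLip n w hw)
  set δ := min R (R * ε / 8) with hδ
  have hδ0 : 0 < δ := lt_min hR (by positivity)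
  refine ⟨ball z δ, mem_nhdsWithin_of_mem_nhds (ball_mem_nhds z hδ0), ?_⟩
  filter_upwards [Metric.tendsto_nhds.1 (hg z hz) (ε / 4) (by positivity)] with n hn w hw
  have hwR : w ∈ ball z R := ball_subset_ball (min_le_left _ _) hw
  have hs : 2 / R * dist w z ≤ ε / 4 := by
    have : dist w z ≤ R * ε / 8 := (mem_ball.1 hw).le.trans (min_le_right _ _)
    calc 2 / R * dist w z ≤ 2 / R * (R * ε / 8) := by gcongr
      _ = ε / 4 := by field_simp; norm_num
  have h1 := hLip n w hwR
  have h2 := hLg w hwR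
  have h3 := dist_triangle (g w) (g z) (F n w)
  have h4 := dist_triangle (g z) (F n z) (F n w)
  rw [dist_comm (F n w)] at h1
  rw [dist_comm (F n z)] at hn
  linarith

open Metric in
/-- A simply connected proper plane domain embeds holomorphically into the unit disk. -/
theorem exists_mapsTo_ball_injOn_deriv_ne_zero {V : Set ℂ} (hV : IsOpen V)
    (hVc : IsSimplyConnected V) (hne : V ≠ univ) :
    ∃ f : ℂ → ℂ, DifferentiableOn ℂ f V ∧ MapsTo f V (ball 0 1) ∧ InjOn f V ∧
      ∀ z ∈ V, deriv f z ≠ 0 := by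
  obtain ⟨a, ha⟩ := (ne_univ_iff_exists_notMem _).1 hne
  have hza : ∀ z ∈ V, z - a ≠ 0 := fun z hz h => ha (sub_eq_zero.1 h ▸ hz)
  obtain ⟨f, hfc, hf2⟩ := Complex.exists_continuousOn_pow_eq hVc hV (g := fun z => z - a)
    (by fun_prop) (by rintro ⟨z, hz, h⟩; exact hza z hz h) two_ne_zero
  have hf0 : ∀ z ∈ V, f z ≠ 0 := fun z hz h => hza z hz (by rw [← hf2, h]; simp)
  have hdf : ∀ z ∈ V, HasStrictDerivAt f (2 * f z)⁻¹ z := by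
    intro z hz
    refine HasStrictDerivAt.of_local_left_inverse (f := fun w => w ^ 2 + a)
      (hfc.continuousAt (hV.mem_nhds hz)) ?_ (mul_ne_zero two_ne_zero (hf0 z hz))
      (Eventually.of_forall fun y => by simp [hf2])
    simpa using (hasStrictDerivAt_pow 2 (f z)).add_const a
  have hinj : Function.Injective f := fun x y h => by
    have := hf2 x
    rw [h, hf2] at this
    exact (sub_left_injective this).symm
  obtain ⟨x, hx⟩ := hVc.nonempty
  have hnear : f '' V ∈ 𝓝 (f x) := by
    rw [← (hdf x hx).map_nhds_eq (inv_ne_zero (mul_ne_zero two_ne_zero (hf0 x hx)))]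
    exact image_mem_map (hV.mem_nhds hx)
  obtain ⟨ε, hε, hball⟩ := Metric.mem_nhds_iff.1 hnear
  have hfar : ∀ z ∈ V, ε ≤ ‖f z + f x‖ := by
    intro z hz
    by_contra! hlt
    obtain ⟨w, hw, hwz⟩ := hball (show -f z ∈ ball (f x) ε by
      rwa [mem_ball, dist_eq_norm, ← norm_neg, neg_sub, sub_neg_eq_add, add_comm])
    have h2 : w = z := by
      have := hf2 w
      rw [hwz, neg_sq, hf2] at this
      exact (sub_left_injective this).symm
    subst h2
    exact hf0 w hw (by linear_combination hwz / 2)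
  have hne0 : ∀ z ∈ V, f z + f x ≠ 0 := fun z hz h => by
    have := hfar z hz
    rw [h, norm_zero] at this
    linarith
  have hder : ∀ z ∈ V, HasDerivAt (fun z => (ε / 2 : ℂ) * (f z + f x)⁻¹)
      ((ε / 2 : ℂ) * (-(2 * f z)⁻¹ / (f z + f x) ^ 2)) z := fun z hz =>
    (((hdf z hz).hasDerivAt.add_const (f x)).inv (hne0 z hz)).const_mul _
  have hε' : (ε / 2 : ℂ) ≠ 0 := by
    have : (ε : ℂ) ≠ 0 := by exact_mod_cast hε.ne'
    simp [this]
  refine ⟨_, fun z hz => (hder z hz).differentiableAt.differentiableWithinAt, fun z hz => ?_,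
    fun z hz w hw h => ?_, fun z hz => ?_⟩
  · rw [mem_ball_zero_iff, norm_mul, norm_inv, ← div_eq_mul_inv,
      div_lt_one (norm_pos_iff.2 (hne0 z hz))]
    refine lt_of_lt_of_le ?_ (hfar z hz)
    rw [norm_div, Complex.norm_real, Real.norm_of_nonneg hε.le]
    simpa using hε
  · exact hinj (add_left_injective _ (inv_injective (mul_left_cancel₀ hε' h)))
  · rw [(hder z hz).deriv]
    refine mul_ne_zero hε' (div_ne_zero (neg_ne_zero.2 (inv_ne_zero ?_)) (pow_ne_zero _ ?_))
    · exact mul_ne_zero two_ne_zero (hf0 z hz)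
    · exact hne0 z hz

/-- The disk automorphism sending `w` to `0`. -/
def diskAut (w z : ℂ) : ℂ := (z - w) / (1 - (starRingEnd ℂ) w * z)

section DiskAut

open Metric

theorem diskAut_denom_ne_zero {w z : ℂ} (hw : ‖w‖ < 1) (hz : ‖z‖ < 1) :
    1 - (starRingEnd ℂ) w * z ≠ 0 := by
  intro h
  have h1 : ‖(starRingEnd ℂ) w * z‖ = 1 := by
    rw [← sub_eq_zero.1 h, norm_one]
  rw [norm_mul, RCLike.norm_conj] at h1
  nlinarith [norm_nonneg w, norm_nonneg z]

theorem norm_diskAut_lt_one {w z : ℂ} (hw : ‖w‖ < 1) (hz : ‖z‖ < 1) : ‖diskAut w z‖ < 1 := by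
  have h0 := diskAut_denom_ne_zero hw hz
  rw [diskAut, norm_div, div_lt_one (norm_pos_iff.2 h0)]
  apply lt_of_pow_lt_pow_left₀ 2 (norm_nonneg _)
  rw [← Complex.normSq_eq_norm_sq, ← Complex.normSq_eq_norm_sq]
  have h1 : ‖w‖ ^ 2 < 1 := by nlinarith [norm_nonneg w]
  have h2 : ‖z‖ ^ 2 < 1 := by nlinarith [norm_nonneg z]
  rw [← Complex.normSq_eq_norm_sq] at h1 h2
  simp only [Complex.normSq_apply, Complex.sub_re, Complex.sub_im, Complex.one_re, Complex.one_im,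
    Complex.mul_re, Complex.mul_im, Complex.conj_re, Complex.conj_im] at *
  nlinarith [mul_pos (sub_pos.2 h1) (sub_pos.2 h2)]

theorem hasDerivAt_diskAut {w z : ℂ} (hw : ‖w‖ < 1) (hz : ‖z‖ < 1) :
    HasDerivAt (diskAut w) ((1 - ‖w‖ ^ 2 : ℝ) / (1 - (starRingEnd ℂ) w * z) ^ 2) z := by
  have h1 : HasDerivAt (fun z : ℂ => z - w) 1 z := (hasDerivAt_id z).sub_const w
  have h2 : HasDerivAt (fun z : ℂ => 1 - (starRingEnd ℂ) w * z) (-(starRingEnd ℂ) w) z := by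
    simpa using ((hasDerivAt_id z).const_mul ((starRingEnd ℂ) w)).const_sub 1
  refine (h1.div h2 (diskAut_denom_ne_zero hw hz)).congr_deriv ?_
  congr 1
  have : ((‖w‖ ^ 2 : ℝ) : ℂ) = w * (starRingEnd ℂ) w := by
    rw [Complex.mul_conj, Complex.normSq_eq_norm_sq]
  push_cast at this ⊢
  rw [this]
  ring

theorem diskAut_injOn {w : ℂ} (hw : ‖w‖ < 1) : InjOn (diskAut w) (ball 0 1) := by
  intro x hx y hy h
  rw [mem_ball_zero_iff] at hx hy
  rw [diskAut, diskAut, div_eq_div_iff (diskAut_denom_ne_zero hw hx)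
    (diskAut_denom_ne_zero hw hy)] at h
  have h1 : (1 - w * (starRingEnd ℂ) w) * (x - y) = 0 := by linear_combination h
  rcases mul_eq_zero.1 h1 with h2 | h2
  · exfalso
    rw [Complex.mul_conj, Complex.normSq_eq_norm_sq, sub_eq_zero] at h2
    have : ‖w‖ ^ 2 = 1 := by exact_mod_cast h2.symm
    nlinarith [norm_nonneg w]
  · exact sub_eq_zero.1 h2

end DiskAut

section Riemann

open Metric

/-- Injective holomorphic maps into the disk, normalized at `a`. -/
def IsDiskEmbedding (V : Set ℂ) (a : ℂ) (g : ℂ → ℂ) : Prop :=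
  DifferentiableOn ℂ g V ∧ MapsTo g V (ball 0 1) ∧ InjOn g V ∧ (∀ z ∈ V, deriv g z ≠ 0) ∧ g a = 0

/-- Composition with a disk automorphism. -/
theorem IsDiskEmbedding.of_diskAut {V : Set ℂ} (hV : IsOpen V) {a : ℂ} (ha : a ∈ V) {g : ℂ → ℂ}
    (h1 : DifferentiableOn ℂ g V) (h2 : MapsTo g V (ball 0 1)) (h3 : InjOn g V)
    (h4 : ∀ z ∈ V, deriv g z ≠ 0) :
    IsDiskEmbedding V a (fun z => diskAut (g a) (g z)) ∧
      deriv (fun z => diskAut (g a) (g z)) a = deriv g a / (1 - ‖g a‖ ^ 2 : ℝ) := by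
  have hlt : ∀ z ∈ V, ‖g z‖ < 1 := fun z hz => mem_ball_zero_iff.1 (h2 hz)
  have hder : ∀ z ∈ V, HasDerivAt (fun z => diskAut (g a) (g z))
      ((1 - ‖g a‖ ^ 2 : ℝ) / (1 - (starRingEnd ℂ) (g a) * g z) ^ 2 * deriv g z) z := fun z hz =>
    (hasDerivAt_diskAut (hlt a ha) (hlt z hz)).comp z
      (h1.differentiableAt (hV.mem_nhds hz)).hasDerivAt
  have hpos : 0 < 1 - ‖g a‖ ^ 2 := by nlinarith [hlt a ha, norm_nonneg (g a)]
  have hpos' : ((1 - ‖g a‖ ^ 2 : ℝ) : ℂ) ≠ 0 := by exact_mod_cast hpos.ne'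
  refine ⟨⟨fun z hz => (hder z hz).differentiableAt.differentiableWithinAt,
    fun z hz => mem_ball_zero_iff.2 (norm_diskAut_lt_one (hlt a ha) (hlt z hz)),
    (diskAut_injOn (hlt a ha)).comp h3 h2, fun z hz => ?_, by simp [diskAut]⟩, ?_⟩
  · rw [(hder z hz).deriv]
    exact mul_ne_zero (div_ne_zero hpos'
      (pow_ne_zero _ (diskAut_denom_ne_zero (hlt a ha) (hlt z hz)))) (h4 z hz)
  · rw [(hder a ha).deriv]
    have : (starRingEnd ℂ) (g a) * g a = (‖g a‖ ^ 2 : ℝ) := by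
      rw [mul_comm, Complex.mul_conj, Complex.normSq_eq_norm_sq]
    rw [this, ← Complex.ofReal_one, ← Complex.ofReal_sub]
    field_simp

/-- The extremal problem of the Riemann mapping theorem has a solution. -/
theorem exists_extremal_diskEmbedding {V : Set ℂ} (hV : IsOpen V) (hVc : IsSimplyConnected V)
    (hne : V ≠ univ) {a : ℂ} (ha : a ∈ V) :
    ∃ g, IsDiskEmbedding V a g ∧
      ∀ k, IsDiskEmbedding V a k → ‖deriv k a‖ ≤ ‖deriv g a‖ := by
  have hpre : IsPreconnected V := hVc.isPathConnected.isConnected.isPreconnected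
  set S : Set ℝ := (fun k : ℂ → ℂ => ‖deriv k a‖) '' {k | IsDiskEmbedding V a k} with hS
  have hSne : S.Nonempty := by
    obtain ⟨f, h1, h2, h3, h4⟩ := exists_mapsTo_ball_injOn_deriv_ne_zero hV hVc hne
    exact ⟨_, _, (IsDiskEmbedding.of_diskAut hV ha h1 h2 h3 h4).1, rfl⟩
  obtain ⟨R, hR, hRV⟩ := Metric.isOpen_iff.1 hV a ha
  have hSb : BddAbove S := by
    refine ⟨1 / R, ?_⟩
    rintro _ ⟨k, hk, rfl⟩
    refine Complex.norm_deriv_le_div_of_mapsTo_ball (hk.1.mono hRV) (fun z hz => ?_) hR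
    rw [hk.2.2.2.2]
    exact ball_subset_closedBall (hk.2.1 (hRV hz))
  obtain ⟨u, -, hu, huS⟩ := exists_seq_tendsto_sSup hSne hSb
  choose F hFe hFu using huS
  set p : Ultrafilter ℕ := hyperfilter ℕ with hp
  have hpt : (p : Filter ℕ) ≤ atTop := Nat.hyperfilter_le_atTop
  have hFd : ∀ n, DifferentiableOn ℂ (F n) V := fun n => (hFe n).1
  obtain ⟨g, hg, hgp⟩ := exists_tendstoLocallyUniformlyOn_of_mapsTo_ball p hV hFd
    fun n => (hFe n).2.1
  have hFd' : ∀ᶠ n in (p : Filter ℕ), DifferentiableOn ℂ (F n) V := Eventually.of_forall hFd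
  have hgd : DifferentiableOn ℂ g V := hg.differentiableOn hFd' hV
  have hgan := hgd.analyticOnNhd hV
  have hdg := hg.deriv hFd' hV
  have hgM : ‖deriv g a‖ = sSup S := by
    refine tendsto_nhds_unique (hdg.tendsto_at ha).norm ?_
    refine (hu.mono_left hpt).congr fun n => ?_
    exact (hFu n).symm
  have hMpos : 0 < sSup S := by
    obtain ⟨_, k, hk, rfl⟩ := hSne
    exact (norm_pos_iff.2 (hk.2.2.2.1 a ha)).trans_le (le_csSup hSb ⟨k, hk, rfl⟩)
  have hnc : ∀ z ∈ V, ¬ ∀ᶠ w in 𝓝 z, g w = g z := by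
    intro z hz hc
    have heq := hgan.eqOn_of_preconnected_of_eventuallyEq (analyticOnNhd_const (v := g z)) hpre
      hz hc
    have : deriv g a = 0 := by
      rw [(heq.eventuallyEq_of_mem (hV.mem_nhds ha)).deriv_eq, deriv_const]
    rw [← hgM, this, norm_zero] at hMpos
    exact lt_irrefl _ hMpos
  have hnc' : ∀ z ∈ V, deriv g z = 0 → ¬ ∀ᶠ w in 𝓝 z, deriv g w = deriv g z := by
    intro z hz h0 hc
    have heq := (hgan.deriv).eqOn_of_preconnected_of_eventuallyEq
      (analyticOnNhd_const (v := deriv g z)) hpre hz hc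
    rw [← hgM, heq ha, h0, norm_zero] at hMpos
    exact lt_irrefl _ hMpos
  have hinj : InjOn g V := by
    intro x hx y hy hxy
    by_contra hne
    have hd : 0 < dist x y / 3 := by have := dist_pos.2 hne; positivity
    obtain ⟨ε, hε, h1⟩ := hurwitz_local hV hg hFd' hgd hx (hnc x hx) hd
    obtain ⟨ε', hε', h2⟩ := hurwitz_local hV hg hFd' hgd hy (hnc y hy) hd
    obtain ⟨n, hn1, hn2⟩ := (h1.and h2).exists
    obtain ⟨v, ⟨hv, hvV⟩, hvx⟩ := hn1 (mem_ball_self hε)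
    obtain ⟨w, ⟨hw, hwV⟩, hwy⟩ := hn2 (mem_ball_self hε')
    have hvw : v = w := (hFe n).2.2.1 hvV hwV (by rw [hvx, hwy, hxy])
    subst hvw
    rw [mem_closedBall] at hv hw
    have := dist_triangle_left x y v
    linarith
  have hder : ∀ z ∈ V, deriv g z ≠ 0 := by
    intro z hz h0
    obtain ⟨ε, hε, h1⟩ := hurwitz_local hV hdg
      (Eventually.of_forall fun n => (hFd n).deriv hV) (hgd.deriv hV) hz (hnc' z hz h0) one_pos
    obtain ⟨n, hn⟩ := h1.exists
    obtain ⟨v, ⟨-, hvV⟩, hv⟩ := hn (mem_ball_self hε)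
    exact (hFe n).2.2.2.1 v hvV (hv.trans h0)
  have hmaps : MapsTo g V (ball 0 1) := by
    have hcl : g '' V ⊆ closedBall 0 1 := by
      rintro _ ⟨z, hz, rfl⟩
      exact isClosed_closedBall.mem_of_tendsto (hgp z hz)
        (Eventually.of_forall fun n => ball_subset_closedBall ((hFe n).2.1 hz))
    have hopen : IsOpen (g '' V) := by
      rcases hgan.is_constant_or_isOpen hpre with ⟨w, hw⟩ | h
      · refine absurd ?_ (hnc a ha)
        filter_upwards [hV.mem_nhds ha] with z hz
        rw [hw z hz, hw a ha]
      · exact h V Subset.rfl hV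
    have := hopen.subset_interior_iff.2 hcl
    rw [interior_closedBall _ one_ne_zero] at this
    exact fun z hz => this (mem_image_of_mem g hz)
  refine ⟨g, ⟨hgd, hmaps, hinj, hder, ?_⟩, fun k hk => ?_⟩
  · refine tendsto_nhds_unique (hgp a ha) (tendsto_const_nhds.congr fun n => ?_)
    exact (hFe n).2.2.2.2.symm
  · rw [hgM]
    exact le_csSup hSb ⟨k, hk, rfl⟩

/-- **Riemann mapping theorem**. -/
theorem exists_riemann_map {V : Set ℂ} (hV : IsOpen V) (hVc : IsSimplyConnected V)
    (hne : V ≠ univ) :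
    ∃ φ ψ : ℂ → ℂ, DifferentiableOn ℂ φ (ball 0 1) ∧ DifferentiableOn ℂ ψ V ∧
      MapsTo φ (ball 0 1) V ∧ MapsTo ψ V (ball 0 1) ∧ (∀ w ∈ ball (0 : ℂ) 1, ψ (φ w) = w) ∧
      ∀ v ∈ V, φ (ψ v) = v := by
  obtain ⟨a, ha⟩ := hVc.nonempty
  obtain ⟨g, ⟨hgd, hgm, hgi, hg', hga⟩, hmax⟩ := exists_extremal_diskEmbedding hV hVc hne ha
  have hsurj : SurjOn g V (ball 0 1) := by
    intro w hw
    by_contra hwg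
    rw [mem_ball_zero_iff] at hw
    have hlt : ∀ z ∈ V, ‖g z‖ < 1 := fun z hz => mem_ball_zero_iff.1 (hgm hz)
    have hder : ∀ z ∈ V, HasDerivAt (fun z => diskAut w (g z))
        ((1 - ‖w‖ ^ 2 : ℝ) / (1 - (starRingEnd ℂ) w * g z) ^ 2 * deriv g z) z := fun z hz =>
      (hasDerivAt_diskAut hw (hlt z hz)).comp z
        (hgd.differentiableAt (hV.mem_nhds hz)).hasDerivAt
    have hh0 : ∀ z ∈ V, diskAut w (g z) ≠ 0 := by
      intro z hz h
      rcases div_eq_zero_iff.1 h with h | h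
      · exact hwg ⟨z, hz, sub_eq_zero.1 h⟩
      · exact diskAut_denom_ne_zero hw (hlt z hz) h
    obtain ⟨s, hsc, hs2⟩ := Complex.exists_continuousOn_pow_eq hVc hV
      (g := fun z => diskAut w (g z))
      (fun z hz => (hder z hz).continuousAt.continuousWithinAt)
      (by rintro ⟨z, hz, h⟩; exact hh0 z hz h) two_ne_zero
    have hs0 : ∀ z ∈ V, s z ≠ 0 := fun z hz h => hh0 z hz (by rw [← hs2, h]; simp)
    have hpos : 0 < 1 - ‖w‖ ^ 2 := by nlinarith [norm_nonneg w]
    have hpos' : ((1 - ‖w‖ ^ 2 : ℝ) : ℂ) ≠ 0 := by exact_mod_cast hpos.ne'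
    have hsd : ∀ z ∈ V, DifferentiableAt ℂ s z ∧ 2 * s z * deriv s z =
        (1 - ‖w‖ ^ 2 : ℝ) / (1 - (starRingEnd ℂ) w * g z) ^ 2 * deriv g z := by
      intro z hz
      have hinv : HasStrictDerivAt (fun x : ℂ => x ^ 2) (2 * s z) (s z) := by
        simpa using hasStrictDerivAt_pow 2 (s z)
      have h20 : 2 * s z ≠ 0 := mul_ne_zero two_ne_zero (hs0 z hz)
      have hloc := hinv.to_localInverse h20
      have hloc' : HasStrictDerivAt (hinv.localInverse _ _ _ h20) (2 * s z)⁻¹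
        (diskAut w (g z)) := by rw [← hs2]; exact hloc
      have hev : s =ᶠ[𝓝 z] fun x => hinv.localInverse _ _ _ h20 (diskAut w (g x)) := by
        have := (hsc.continuousAt (hV.mem_nhds hz)).eventually
          (hinv.eventually_left_inverse h20)
        filter_upwards [this] with x hx
        rw [← hs2]
        exact hx.symm
      have hd : HasDerivAt s _ z := (hloc'.hasDerivAt.comp z (hder z hz)).congr_of_eventuallyEq hev
      refine ⟨hd.differentiableAt, ?_⟩
      rw [hd.deriv, ← mul_assoc, mul_inv_cancel₀ h20, one_mul]
    have hsm : MapsTo s V (ball 0 1) := by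
      intro z hz
      have h1 : ‖s z‖ ^ 2 < 1 := by
        rw [← norm_pow, hs2]
        exact norm_diskAut_lt_one hw (hlt z hz)
      rw [mem_ball_zero_iff]
      nlinarith [norm_nonneg (s z)]
    have hsi : InjOn s V := by
      intro x hx y hy h
      have h1 : diskAut w (g x) = diskAut w (g y) := by rw [← hs2, ← hs2, h]
      exact hgi hx hy (diskAut_injOn hw (hgm hx) (hgm hy) h1)
    have hs' : ∀ z ∈ V, deriv s z ≠ 0 := by
      intro z hz h
      have h1 := (hsd z hz).2
      rw [h, mul_zero] at h1
      exact mul_ne_zero (div_ne_zero hpos'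
        (pow_ne_zero _ (diskAut_denom_ne_zero hw (hlt z hz)))) (hg' z hz) h1.symm
    obtain ⟨hk, hkd⟩ := IsDiskEmbedding.of_diskAut hV ha
      (fun z hz => (hsd z hz).1.differentiableWithinAt) hsm hsi hs'
    have hle := hmax _ hk
    rw [hkd] at hle
    have h1 := (hsd a ha).2
    have h2 := hs2 a
    simp only [hga, mul_zero, sub_zero, one_pow, div_one, diskAut, zero_sub] at h1 h2
    have h3 : ‖s a‖ ^ 2 = ‖w‖ := by rw [← norm_pow, h2, norm_neg]
    have h4 := congrArg norm h1
    rw [norm_mul, norm_mul, norm_mul, Complex.norm_real, Real.norm_of_nonneg hpos.le] at h4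
    simp only [Complex.norm_ofNat] at h4
    have hsa : 0 < ‖s a‖ := norm_pos_iff.2 (hs0 a ha)
    have hsa1 : ‖s a‖ < 1 := mem_ball_zero_iff.1 (hsm ha)
    have hp2 : 0 < 1 - ‖s a‖ ^ 2 := by nlinarith
    rw [norm_div, Complex.norm_real, Real.norm_of_nonneg hp2.le, div_le_iff₀ hp2] at hle
    rw [← h3] at h4
    have hG : 0 < ‖deriv g a‖ := norm_pos_iff.2 (hg' a ha)
    have h5 : (1 - (‖s a‖ ^ 2) ^ 2) * ‖deriv g a‖ ≤
        2 * ‖s a‖ * (‖deriv g a‖ * (1 - ‖s a‖ ^ 2)) := by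
      rw [← h4]
      gcongr
    have h6 : 0 < ‖deriv g a‖ * (1 - ‖s a‖ ^ 2) * (1 - ‖s a‖) ^ 2 := by
      have : 0 < 1 - ‖s a‖ := by linarith
      positivity
    nlinarith
  refine ⟨Function.invFunOn g V, g, ?_, hgd, ?_, hgm, ?_, fun v hv => ?_⟩
  · intro w hw
    have hmem := Function.invFunOn_mem (hsurj hw)
    have heq := Function.invFunOn_eq (hsurj hw)
    have hstr := ((hgd.analyticOnNhd hV) _ hmem).hasStrictDerivAt
    have hd : HasStrictDerivAt (Function.invFunOn g V) (deriv g (Function.invFunOn g V w))⁻¹ w := by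
      refine HasStrictDerivAt.of_local_left_inverse ?_ hstr (hg' _ hmem) ?_
      · rw [ContinuousAt, ← heq, ← hstr.map_nhds_eq (hg' _ hmem), heq, tendsto_map'_iff]
        refine tendsto_id.congr' ?_
        filter_upwards [hV.mem_nhds hmem] with x hx
        exact (hgi.leftInvOn_invFunOn hx).symm
      · filter_upwards [isOpen_ball.mem_nhds hw] with y hy
        exact Function.invFunOn_eq (hsurj hy)
    exact hd.hasDerivAt.differentiableAt.differentiableWithinAt
  · exact fun w hw => Function.invFunOn_mem (hsurj hw)
  · exact fun w hw => Function.invFunOn_eq (hsurj hw)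
  · exact hgi.leftInvOn_invFunOn hv

end Riemann

open MeasureTheory in
/-- The displacement of a curve is at most its length. -/
theorem enorm_sub_le_lintegral_enorm_deriv {E : Type*} [NormedAddCommGroup E] [NormedSpace ℝ E]
    [CompleteSpace E] {a b : ℝ} {x x' : ℝ → E} (hx : ∀ t ∈ Ioo a b, HasDerivAt x (x' t) t)
    (hx' : ContinuousOn x' (Ioo a b)) {s t : ℝ} (hs : s ∈ Ioo a b) (ht : t ∈ Ioo a b) :
    ‖x t - x s‖ₑ ≤ ∫⁻ u in Ioo a b, ‖x' u‖ₑ := by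
  have hsub : uIcc s t ⊆ Ioo a b := (ordConnected_Ioo).uIcc_subset hs ht
  rw [← intervalIntegral.integral_eq_sub_of_hasDerivAt (fun u hu => hx u (hsub hu))
    ((hx'.mono hsub).intervalIntegrable)]
  rw [← ofReal_norm, intervalIntegral.norm_intervalIntegral_eq, ofReal_norm]
  exact (enorm_integral_le_lintegral_enorm _).trans
    (lintegral_mono_set (uIoc_subset_uIcc.trans hsub))

open MeasureTheory in
/-- A curve of finite length has limits at both ends. -/
theorem exists_tendsto_of_lintegral_enorm_deriv_lt_top {E : Type*} [NormedAddCommGroup E]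
    [NormedSpace ℝ E] [CompleteSpace E] {a b : ℝ} (hab : a < b) {x x' : ℝ → E}
    (hx : ∀ t ∈ Ioo a b, HasDerivAt x (x' t) t) (hx' : ContinuousOn x' (Ioo a b))
    (hfin : ∫⁻ u in Ioo a b, ‖x' u‖ₑ < ⊤) :
    (∃ p, Tendsto x (𝓝[>] a) (𝓝 p)) ∧ ∃ q, Tendsto x (𝓝[<] b) (𝓝 q) := by
  have hint : IntegrableOn x' (Ioo a b) :=
    ⟨hx'.aestronglyMeasurable measurableSet_Ioo, hfin⟩
  obtain ⟨c, hc⟩ := nonempty_Ioo.2 hab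
  have hint' : IntegrableOn x' (Icc a b) := by
    rwa [integrableOn_Icc_iff_integrableOn_Ioo]
  have hI : IntervalIntegrable x' volume a b := by
    rw [intervalIntegrable_iff_integrableOn_Icc_of_le hab.le]; exact hint'
  have hcont : ContinuousOn (fun t => x c + ∫ u in c..t, x' u) (Icc a b) := by
    rw [← uIcc_of_le hab.le] at hint' ⊢
    exact continuousOn_const.add
      (intervalIntegral.continuousOn_primitive_interval' hI (by
        rw [uIcc_of_le hab.le]; exact Ioo_subset_Icc_self hc))
  have heq : ∀ t ∈ Ioo a b, x c + ∫ u in c..t, x' u = x t := by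
    intro t ht
    have hsub : uIcc c t ⊆ Ioo a b := (ordConnected_Ioo).uIcc_subset hc ht
    rw [intervalIntegral.integral_eq_sub_of_hasDerivAt (fun u hu => hx u (hsub hu))
      ((hx'.mono hsub).intervalIntegrable)]
    abel
  constructor
  · refine ⟨_, ((hcont a (left_mem_Icc.2 hab.le)).mono_left
      (nhdsWithin_mono a Ioo_subset_Icc_self)).congr' ?_ |>.mono_left
        (nhdsWithin_Ioo_eq_nhdsGT hab).ge⟩
    filter_upwards [self_mem_nhdsWithin] with t ht using heq t ht
  · refine ⟨_, ((hcont b (right_mem_Icc.2 hab.le)).mono_left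
      (nhdsWithin_mono b Ioo_subset_Icc_self)).congr' ?_ |>.mono_left
        (nhdsWithin_Ioo_eq_nhdsLT hab).ge⟩
    filter_upwards [self_mem_nhdsWithin] with t ht using heq t ht

/-- The logarithmic weight with centre `a`, whose square is integrable on the plane, while its
integral over any curve tending to `a` or to infinity diverges. -/
def logWeight (a x : ℂ) : ℝ := 1 / (‖x - a‖ * √(1 + Real.log ‖x - a‖ ^ 2))

theorem logWeight_nonneg (a x : ℂ) : 0 ≤ logWeight a x := by
  unfold logWeight; positivity

theorem continuousAt_logWeight {a x : ℂ} (h : x ≠ a) : ContinuousAt (logWeight a) x := by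
  have h0 : 0 < ‖x - a‖ := norm_pos_iff.2 (sub_ne_zero.2 h)
  have h1 : ‖x - a‖ * √(1 + Real.log ‖x - a‖ ^ 2) ≠ 0 := by positivity
  unfold logWeight
  refine ContinuousAt.div (by fun_prop) ?_ h1
  have hl : ContinuousAt (fun x => Real.log ‖x - a‖) x := ContinuousAt.log (by fun_prop) h0.ne'
  exact ContinuousAt.mul (by fun_prop) (ContinuousAt.sqrt (continuousAt_const.add (hl.pow 2)))

open MeasureTheory in
theorem lintegral_logWeight_sq_lt_top (a : ℂ) :
    ∫⁻ x, ENNReal.ofReal (logWeight a x ^ 2) < ⊤ := by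
  have h1 : ∫⁻ x, ENNReal.ofReal (logWeight a x ^ 2) =
      ∫⁻ x, ENNReal.ofReal (logWeight 0 x ^ 2) := by
    rw [← lintegral_sub_right_eq_self (fun x => ENNReal.ofReal (logWeight 0 x ^ 2)) a]
    simp [logWeight]
  rw [h1, ← Complex.lintegral_comp_polarCoord_symm]
  have h2 : ∀ p ∈ polarCoord.target, ENNReal.ofReal p.1 •
      ENNReal.ofReal (logWeight 0 (Complex.polarCoord.symm p) ^ 2) =
      ENNReal.ofReal (1 / (p.1 * (1 + Real.log p.1 ^ 2))) := by
    rintro ⟨r, θ⟩ hp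
    have hr : 0 < r := hp.1
    rw [smul_eq_mul, ← ENNReal.ofReal_mul hr.le]
    congr 1
    have : ‖Complex.polarCoord.symm (r, θ)‖ = r := by
      rw [Complex.norm_polarCoord_symm, abs_of_pos hr]
    simp only [logWeight, sub_zero, this]
    rw [div_pow, mul_pow, Real.sq_sqrt (by positivity)]
    field_simp
  rw [setLIntegral_congr_fun polarCoord.open_target.measurableSet h2]
  rw [polarCoord_target, Measure.volume_eq_prod, ← Measure.prod_restrict,
    lintegral_prod _ (by fun_prop)]
  simp only [lintegral_const, MeasurableSet.univ, Measure.restrict_apply, univ_inter,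
    Real.volume_Ioo]
  rw [lintegral_mul_const _ (by fun_prop)]
  refine ENNReal.mul_lt_top ?_ ENNReal.ofReal_lt_top
  have hexp : Ioi (0:ℝ) = Real.exp '' univ := by rw [image_univ, Real.range_exp]
  rw [hexp, lintegral_image_eq_lintegral_abs_deriv_mul MeasurableSet.univ
    (fun x _ => (Real.hasDerivAt_exp x).hasDerivWithinAt) Real.exp_injective.injOn]
  rw [Measure.restrict_univ]
  have h3 := integrable_inv_one_add_sq.lintegral_lt_top
  refine lt_of_eq_of_lt (lintegral_congr fun x => ?_) h3
  rw [← ENNReal.ofReal_mul (by positivity), Real.log_exp, abs_of_pos (Real.exp_pos x)]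
  congr 1
  have := (Real.exp_pos x).ne'
  field_simp

/-- `φ` and `ψ` are mutually inverse holomorphic maps between the unit disk and the open
set `V`. -/
structure IsRiemannMap (V : Set ℂ) (φ ψ : ℂ → ℂ) : Prop where
  isOpen : IsOpen V
  diff : DifferentiableOn ℂ φ (Metric.ball 0 1)
  diff_inv : DifferentiableOn ℂ ψ V
  mapsTo : MapsTo φ (Metric.ball 0 1) V
  mapsTo_inv : MapsTo ψ V (Metric.ball 0 1)
  left_inv : ∀ w ∈ Metric.ball (0 : ℂ) 1, ψ (φ w) = w
  right_inv : ∀ v ∈ V, φ (ψ v) = v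

namespace IsRiemannMap

variable {V : Set ℂ} {φ ψ : ℂ → ℂ}

theorem injOn (h : IsRiemannMap V φ ψ) : InjOn φ (Metric.ball 0 1) :=
  (show LeftInvOn ψ φ (Metric.ball 0 1) from h.left_inv).injOn

theorem hasDerivAt (h : IsRiemannMap V φ ψ) {w : ℂ} (hw : w ∈ Metric.ball (0 : ℂ) 1) :
    HasDerivAt φ (deriv φ w) w :=
  (h.diff.differentiableAt (Metric.isOpen_ball.mem_nhds hw)).hasDerivAt

theorem image_ball (h : IsRiemannMap V φ ψ) : φ '' Metric.ball 0 1 = V :=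
  Subset.antisymm h.mapsTo.image_subset fun v hv => ⟨ψ v, h.mapsTo_inv hv, h.right_inv v hv⟩

theorem continuousOn_deriv (h : IsRiemannMap V φ ψ) :
    ContinuousOn (deriv φ) (Metric.ball 0 1) :=
  (h.diff.deriv Metric.isOpen_ball).continuousOn

end IsRiemannMap

theorem Complex.det_restrictScalars_toSpanSingleton (c : ℂ) :
    ((ContinuousLinearMap.toSpanSingleton ℂ c).restrictScalars ℝ).det = ‖c‖ ^ 2 := by
  rw [ContinuousLinearMap.det, ← Complex.normSq_eq_norm_sq, ← Algebra.norm_complex_apply,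
    Algebra.norm_apply]
  congr 1
  ext x
  simp [mul_comm]

/-- The density whose integral is the area of `V` for the metric `logWeight a`. -/
def pullbackDensity (φ : ℂ → ℂ) (a : ℂ) (w : ℂ) : ENNReal :=
  (Metric.ball (0 : ℂ) 1).indicator
    (fun w => ENNReal.ofReal ((‖deriv φ w‖ * logWeight a (φ w)) ^ 2)) w

namespace IsRiemannMap

variable {V : Set ℂ} {φ ψ : ℂ → ℂ}

theorem continuousOn_deriv_mul_logWeight (h : IsRiemannMap V φ ψ) {a : ℂ} (ha : a ∉ V) :
    ContinuousOn (fun w => ‖deriv φ w‖ * logWeight a (φ w)) (Metric.ball 0 1) := by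
  refine h.continuousOn_deriv.norm.mul fun w hw => ?_
  exact (continuousAt_logWeight (fun e : φ w = a => ha (e ▸ h.mapsTo hw))).comp_continuousWithinAt
    (h.diff.continuousOn w hw)

theorem measurable_pullbackDensity (h : IsRiemannMap V φ ψ) {a : ℂ} (ha : a ∉ V) :
    Measurable (pullbackDensity φ a) := by
  classical
  unfold pullbackDensity
  rw [← piecewise_eq_indicator]
  refine ContinuousOn.measurable_piecewise ?_ continuousOn_const measurableSet_ball
  exact ENNReal.continuous_ofReal.comp_continuousOn
    ((h.continuousOn_deriv_mul_logWeight ha).pow 2)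

open MeasureTheory in
theorem lintegral_pullbackDensity_lt_top (h : IsRiemannMap V φ ψ) (a : ℂ) :
    ∫⁻ w, pullbackDensity φ a w < ⊤ := by
  refine lt_of_le_of_lt ?_ (lintegral_logWeight_sq_lt_top a)
  refine le_trans (le_of_eq ?_) (setLIntegral_le_lintegral (φ '' Metric.ball 0 1) _)
  rw [lintegral_image_eq_lintegral_abs_det_fderiv_mul volume measurableSet_ball
    (fun w hw => (((h.hasDerivAt hw).hasFDerivAt).restrictScalars ℝ).hasFDerivWithinAt) h.injOn]
  unfold pullbackDensity
  rw [lintegral_indicator measurableSet_ball]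
  refine lintegral_congr fun w => ?_
  rw [Complex.det_restrictScalars_toSpanSingleton, abs_of_nonneg (sq_nonneg _),
    ← ENNReal.ofReal_mul (sq_nonneg _), mul_pow]

end IsRiemannMap

/-- The point at distance `r` from `ζ` in the direction `-ζ * exp (θ * I)`. -/
def arcPt (ζ : ℂ) (r θ : ℝ) : ℂ := ζ * (1 - r * Complex.exp (θ * Complex.I))

theorem norm_arcPt_sub {ζ : ℂ} (hζ : ‖ζ‖ = 1) {r : ℝ} (hr : 0 ≤ r) (θ : ℝ) :
    ‖arcPt ζ r θ - ζ‖ = r := by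
  have : arcPt ζ r θ - ζ = -(ζ * r * Complex.exp (θ * Complex.I)) := by unfold arcPt; ring
  rw [this, norm_neg, norm_mul, norm_mul, hζ, Complex.norm_exp_ofReal_mul_I, Complex.norm_real,
    Real.norm_of_nonneg hr]
  ring

theorem norm_arcPt_sq {ζ : ℂ} (hζ : ‖ζ‖ = 1) (r θ : ℝ) :
    ‖arcPt ζ r θ‖ ^ 2 = 1 - 2 * r * Real.cos θ + r ^ 2 := by
  unfold arcPt
  rw [norm_mul, hζ, one_mul, ← Complex.normSq_eq_norm_sq, Complex.normSq_apply]
  simp only [Complex.sub_re, Complex.one_re, Complex.mul_re, Complex.ofReal_re,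
    Complex.exp_ofReal_mul_I_re, Complex.ofReal_im, Complex.exp_ofReal_mul_I_im, zero_mul,
    sub_zero, Complex.sub_im, Complex.one_im, Complex.mul_im, add_zero, zero_sub]
  nlinarith [Real.sin_sq_add_cos_sq θ]

theorem arcPt_mem_ball_iff {ζ : ℂ} (hζ : ‖ζ‖ = 1) {r : ℝ} (hr : 0 < r) (θ : ℝ) :
    arcPt ζ r θ ∈ Metric.ball (0 : ℂ) 1 ↔ r < 2 * Real.cos θ := by
  rw [mem_ball_zero_iff, ← sq_lt_one_iff₀ (norm_nonneg _), norm_arcPt_sq hζ]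
  constructor
  · intro h; nlinarith
  · intro h; nlinarith

/-- Half of the opening angle of the arc of the circle of radius `r` around a boundary point
lying in the unit disk. -/
def arcAngle (r : ℝ) : ℝ := Real.arccos (r / 2)

theorem arcAngle_pos {r : ℝ} (hr1 : r < 1) : 0 < arcAngle r :=
  Real.arccos_pos.2 (by linarith)

theorem arcAngle_lt_pi {r : ℝ} (hr : 0 < r) : arcAngle r < Real.pi := by
  unfold arcAngle
  have := Real.arccos_lt_pi_div_two.2 (half_pos hr)
  linarith [Real.pi_pos]

theorem lt_two_mul_cos_iff {r θ : ℝ} (hr : 0 < r) (hr1 : r < 1) (hθ : θ ∈ Icc (-Real.pi) Real.pi) :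
    r < 2 * Real.cos θ ↔ θ ∈ Ioo (-arcAngle r) (arcAngle r) := by
  have hc : Real.cos (arcAngle r) = r / 2 := Real.cos_arccos (by linarith) (by linarith)
  have h1 : θ ∈ Ioo (-arcAngle r) (arcAngle r) ↔ |θ| < arcAngle r := by rw [abs_lt]; rfl
  rw [h1, ← Real.cos_abs θ]
  have h2 : |θ| ∈ Icc 0 Real.pi := ⟨abs_nonneg _, abs_le.2 ⟨hθ.1, hθ.2⟩⟩
  have h3 : arcAngle r ∈ Icc 0 Real.pi := ⟨(arcAngle_pos hr1).le, (arcAngle_lt_pi hr).le⟩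
  rw [← Real.strictAntiOn_cos.lt_iff_gt h3 h2, hc]
  constructor <;> intro h <;> linarith

theorem arcPt_mem_ball {ζ : ℂ} (hζ : ‖ζ‖ = 1) {r θ : ℝ} (hr : 0 < r) (hr1 : r < 1)
    (hθ : θ ∈ Ioo (-arcAngle r) (arcAngle r)) : arcPt ζ r θ ∈ Metric.ball (0 : ℂ) 1 := by
  rw [arcPt_mem_ball_iff hζ hr, lt_two_mul_cos_iff hr hr1]
  · exact hθ
  · have := arcAngle_lt_pi hr
    exact ⟨by linarith [hθ.1], by linarith [hθ.2]⟩

theorem exists_arcPt_eq {ζ : ℂ} (hζ : ‖ζ‖ = 1) {r : ℝ} (hr : 0 < r) (hr1 : r < 1) {w : ℂ}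
    (hw : w ∈ Metric.ball (0 : ℂ) 1) (hwr : ‖w - ζ‖ = r) :
    ∃ θ ∈ Ioo (-arcAngle r) (arcAngle r), arcPt ζ r θ = w := by
  have hζ0 : ζ ≠ 0 := norm_ne_zero_iff.1 (by rw [hζ]; exact one_ne_zero)
  have h1 : ‖1 - w / ζ‖ = r := by
    rw [← hwr, one_sub_div hζ0, norm_div, hζ, div_one, norm_sub_rev]
  have h2 : arcPt ζ r (Complex.arg (1 - w / ζ)) = w := by
    unfold arcPt
    rw [← h1, Complex.norm_mul_exp_arg_mul_I]
    field_simp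
    ring
  refine ⟨_, ?_, h2⟩
  rw [← lt_two_mul_cos_iff hr hr1, ← arcPt_mem_ball_iff hζ hr, h2]
  · exact hw
  · exact ⟨(Complex.neg_pi_lt_arg _).le, Complex.arg_le_pi _⟩

theorem image_arcPt {ζ : ℂ} (hζ : ‖ζ‖ = 1) {r : ℝ} (hr : 0 < r) (hr1 : r < 1) :
    arcPt ζ r '' Ioo (-arcAngle r) (arcAngle r) = Metric.sphere ζ r ∩ Metric.ball 0 1 := by
  ext w
  constructor
  · rintro ⟨θ, hθ, rfl⟩
    exact ⟨by rw [mem_sphere_iff_norm, norm_arcPt_sub hζ hr.le], arcPt_mem_ball hζ hr hr1 hθ⟩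
  · rintro ⟨h1, h2⟩
    exact exists_arcPt_eq hζ hr hr1 h2 (mem_sphere_iff_norm.1 h1)

theorem hasDerivAt_arcPt (ζ : ℂ) (r θ : ℝ) :
    HasDerivAt (arcPt ζ r) (-(ζ * r * Complex.I * Complex.exp (θ * Complex.I))) θ := by
  unfold arcPt
  have h1 : HasDerivAt (fun θ : ℝ => Complex.exp (θ * Complex.I))
      (Complex.exp (θ * Complex.I) * (1 * Complex.I)) θ :=
    ((Complex.ofRealCLM.hasDerivAt (x := θ)).mul_const Complex.I).cexp
  refine (((h1.const_mul (r : ℂ)).const_sub 1).const_mul ζ).congr_deriv ?_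
  ring

theorem continuous_arcPt (ζ : ℂ) (r : ℝ) : Continuous (arcPt ζ r) := by
  unfold arcPt; fun_prop

open MeasureTheory in
/-- Integration in polar coordinates centred at a point of the unit circle. -/
theorem lintegral_eq_lintegral_arcPt {ζ : ℂ} (hζ : ‖ζ‖ = 1) {g : ℂ → ENNReal} (hg : Measurable g) :
    ∫⁻ w, g w = ∫⁻ r in Ioi (0 : ℝ), ∫⁻ θ in Ioo (-Real.pi) Real.pi,
      ENNReal.ofReal r * g (arcPt ζ r θ) := by
  have hrot : ∫⁻ w, g w = ∫⁻ x, g (ζ * (1 - x)) := by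
    have h1 := (LinearIsometryEquiv.measurePreserving
      (rotation (⟨ζ, mem_sphere_zero_iff_norm.2 hζ⟩ : Circle))).lintegral_comp hg
    rw [← h1, ← lintegral_sub_left_eq_self _ (1 : ℂ)]
    rfl
  rw [hrot, ← Complex.lintegral_comp_polarCoord_symm, polarCoord_target,
    Measure.volume_eq_prod, ← Measure.prod_restrict, lintegral_prod]
  · refine lintegral_congr fun r => lintegral_congr fun θ => ?_
    rw [smul_eq_mul]
    congr 3
    rw [Complex.polarCoord_symm_apply, Complex.exp_mul_I]
    simp
  · refine Measurable.aemeasurable ?_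
    simp only [smul_eq_mul, Complex.polarCoord_symm_apply]
    refine Measurable.mul (by fun_prop) (hg.comp ?_)
    fun_prop

open MeasureTheory in
theorem sq_lintegral_le_measure_mul_lintegral_sq {α : Type*} [MeasurableSpace α] (μ : Measure α)
    {f : α → ENNReal} (hf : AEMeasurable f μ) :
    (∫⁻ x, f x ∂μ) ^ 2 ≤ μ univ * ∫⁻ x, f x ^ 2 ∂μ := by
  have h := ENNReal.lintegral_mul_le_Lp_mul_Lq μ Real.HolderConjugate.two_two
    (f := fun _ => 1) (g := f) aemeasurable_const hf
  simp only [Pi.mul_apply, one_mul, ENNReal.one_rpow, lintegral_const] at h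
  calc (∫⁻ x, f x ∂μ) ^ 2 ≤ _ := pow_le_pow_left' h 2
    _ = _ := by
      rw [mul_pow, ← ENNReal.rpow_natCast, ← ENNReal.rpow_natCast, ← ENNReal.rpow_mul,
        ← ENNReal.rpow_mul]
      norm_num

/-- The length, for the metric `logWeight a`, of the image under `φ` of the circular arc of
radius `r` around `ζ`. -/
def arcLength (φ : ℂ → ℂ) (a ζ : ℂ) (r : ℝ) : ENNReal :=
  ∫⁻ θ in Ioo (-arcAngle r) (arcAngle r),
    ENNReal.ofReal (r * (‖deriv φ (arcPt ζ r θ)‖ * logWeight a (φ (arcPt ζ r θ))))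

namespace IsRiemannMap

variable {V : Set ℂ} {φ ψ : ℂ → ℂ}

open MeasureTheory in
theorem arcLength_sq_le (h : IsRiemannMap V φ ψ) {a : ℂ} (ha : a ∉ V) {ζ : ℂ} (hζ : ‖ζ‖ = 1)
    {r : ℝ} (hr : 0 < r) (hr1 : r < 1) :
    arcLength φ a ζ r ^ 2 ≤ ENNReal.ofReal (2 * Real.pi * r ^ 2) *
      ∫⁻ θ in Ioo (-Real.pi) Real.pi, pullbackDensity φ a (arcPt ζ r θ) := by
  have hc : ContinuousOn (fun θ => ENNReal.ofReal
      (r * (‖deriv φ (arcPt ζ r θ)‖ * logWeight a (φ (arcPt ζ r θ)))))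
      (Ioo (-arcAngle r) (arcAngle r)) :=
    ENNReal.continuous_ofReal.comp_continuousOn (continuousOn_const.mul
      ((h.continuousOn_deriv_mul_logWeight ha).comp (continuous_arcPt ζ r).continuousOn
        fun θ hθ => arcPt_mem_ball hζ hr hr1 hθ))
  have hle := arcAngle_lt_pi hr
  refine (sq_lintegral_le_measure_mul_lintegral_sq _ (hc.aemeasurable measurableSet_Ioo)).trans ?_
  have h1 : ∫⁻ θ in Ioo (-arcAngle r) (arcAngle r), ENNReal.ofReal
      (r * (‖deriv φ (arcPt ζ r θ)‖ * logWeight a (φ (arcPt ζ r θ)))) ^ 2 =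
      ENNReal.ofReal (r ^ 2) *
        ∫⁻ θ in Ioo (-arcAngle r) (arcAngle r), pullbackDensity φ a (arcPt ζ r θ) := by
    rw [← lintegral_const_mul' _ _ ENNReal.ofReal_ne_top]
    refine setLIntegral_congr_fun measurableSet_Ioo fun θ hθ => ?_
    unfold pullbackDensity
    rw [indicator_of_mem (arcPt_mem_ball hζ hr hr1 hθ), ← ENNReal.ofReal_pow,
      ← ENNReal.ofReal_mul (sq_nonneg r), mul_pow]
    exact mul_nonneg hr.le (mul_nonneg (norm_nonneg _) (logWeight_nonneg _ _))
  rw [h1, ← mul_assoc]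
  gcongr
  · rw [Measure.restrict_apply_univ, Real.volume_Ioo,
      ENNReal.ofReal_mul (by positivity)]
    gcongr
    linarith

open MeasureTheory in
/-- The length–area principle: there are arbitrarily small circular arcs around a boundary point
whose images are short for finitely many given metrics. -/
theorem exists_arcLength_lt (h : IsRiemannMap V φ ψ) (F : Finset ℂ) (hF : ∀ a ∈ F, a ∉ V)
    {ζ : ℂ} (hζ : ‖ζ‖ = 1) {δ ε : ℝ} (hδ : 0 < δ) (hε : 0 < ε) :
    ∃ r, 0 < r ∧ r < δ ∧ r < 1 ∧ ∀ a ∈ F, arcLength φ a ζ r < ENNReal.ofReal ε := by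
  set A : ℝ → ENNReal := fun r => ∑ a ∈ F,
    ∫⁻ θ in Ioo (-Real.pi) Real.pi, pullbackDensity φ a (arcPt ζ r θ) with hA
  have hfin : ∫⁻ r in Ioi (0 : ℝ), ENNReal.ofReal r * A r < ⊤ := by
    have h1 : ∀ a ∈ F, ∫⁻ r in Ioi (0 : ℝ), ∫⁻ θ in Ioo (-Real.pi) Real.pi,
        ENNReal.ofReal r * pullbackDensity φ a (arcPt ζ r θ) < ⊤ := fun a ha => by
      rw [← lintegral_eq_lintegral_arcPt hζ (h.measurable_pullbackDensity (hF a ha))]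
      exact h.lintegral_pullbackDensity_lt_top a
    refine lt_of_le_of_lt (le_of_eq ?_) (ENNReal.sum_lt_top.2 h1)
    rw [← lintegral_finsetSum']
    · refine lintegral_congr fun r => ?_
      rw [hA, Finset.mul_sum]
      exact Finset.sum_congr rfl fun a ha => (lintegral_const_mul' _ _ ENNReal.ofReal_ne_top).symm
    · intro a ha
      have hm := h.measurable_pullbackDensity (hF a ha)
      have : Measurable fun p : ℝ × ℝ =>
          ENNReal.ofReal p.1 * pullbackDensity φ a (arcPt ζ p.1 p.2) := by
        refine Measurable.mul (by fun_prop) (hm.comp ?_)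
        unfold arcPt
        fun_prop
      exact this.lintegral_prod_right'.aemeasurable
  set κ : ℝ := ε ^ 2 / (2 * Real.pi) with hκ
  have hκ0 : 0 < κ := by have := Real.pi_pos; positivity
  obtain ⟨r, hr, hrA⟩ : ∃ r ∈ Ioo 0 (min δ 1), ENNReal.ofReal (r ^ 2) * A r < ENNReal.ofReal κ := by
    by_contra! hcon
    have hlow : ∀ r ∈ Ioo 0 (min δ 1), ENNReal.ofReal κ * ‖r⁻¹‖ₑ ≤ ENNReal.ofReal r * A r := by
      intro r hr
      have hr0 : 0 < r := hr.1
      calc ENNReal.ofReal κ * ‖r⁻¹‖ₑ ≤ ENNReal.ofReal (r ^ 2) * A r * ‖r⁻¹‖ₑ := by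
            gcongr; exact hcon r hr
        _ = ENNReal.ofReal r * A r := by
            rw [Real.enorm_eq_ofReal (by positivity), mul_right_comm, ← ENNReal.ofReal_mul
              (sq_nonneg r)]
            congr 2
            field_simp
    have h2 : ∫⁻ r in Ioo 0 (min δ 1), ENNReal.ofReal κ * ‖r⁻¹‖ₑ < ⊤ :=
      (setLIntegral_mono' measurableSet_Ioo hlow).trans_lt
        ((lintegral_mono_set Ioo_subset_Ioi_self).trans_lt hfin)
    rw [lintegral_const_mul' _ _ ENNReal.ofReal_ne_top] at h2
    have h3 : ∫⁻ r in Ioo 0 (min δ 1), ‖(r : ℝ)⁻¹‖ₑ < ⊤ := by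
      by_contra h4
      rw [not_lt_top_iff] at h4
      rw [h4, ENNReal.mul_top (by simpa using hκ0)] at h2
      exact lt_irrefl _ h2
    have h5 : IntervalIntegrable (fun r : ℝ => r⁻¹) volume 0 (min δ 1) := by
      rw [intervalIntegrable_iff_integrableOn_Ioo_of_le (by positivity)]
      exact ⟨(measurable_inv).aestronglyMeasurable, h3⟩
    rw [intervalIntegrable_inv_iff] at h5
    rcases h5 with h5 | h5
    · exact absurd h5 (by positivity)
    · exact h5 (left_mem_uIcc)
  refine ⟨r, hr.1, hr.2.trans_le (min_le_left _ _), hr.2.trans_le (min_le_right _ _), ?_⟩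
  intro a ha
  have h1 := h.arcLength_sq_le (hF a ha) hζ hr.1 (hr.2.trans_le (min_le_right _ _))
  have hle : ∫⁻ θ in Ioo (-Real.pi) Real.pi, pullbackDensity φ a (arcPt ζ r θ) ≤ A r :=
    Finset.single_le_sum (f := fun a : ℂ =>
      ∫⁻ θ in Ioo (-Real.pi) Real.pi, pullbackDensity φ a (arcPt ζ r θ))
      (fun _ _ => zero_le) ha
  have h2 : arcLength φ a ζ r ^ 2 < ENNReal.ofReal ε ^ 2 := by
    calc arcLength φ a ζ r ^ 2 ≤ ENNReal.ofReal (2 * Real.pi * r ^ 2) * A r :=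
          h1.trans (by gcongr)
      _ = ENNReal.ofReal (2 * Real.pi) * (ENNReal.ofReal (r ^ 2) * A r) := by
          rw [ENNReal.ofReal_mul (by positivity), mul_assoc]
      _ < ENNReal.ofReal (2 * Real.pi) * ENNReal.ofReal κ :=
          (ENNReal.mul_lt_mul_iff_right (by simpa using Real.pi_pos) ENNReal.ofReal_ne_top).2 hrA
      _ = ENNReal.ofReal ε ^ 2 := by
          rw [← ENNReal.ofReal_mul (by positivity), ← ENNReal.ofReal_pow hε.le, hκ]
          congr 1
          have := Real.pi_pos.ne'
          field_simp
  exact lt_of_not_ge fun hc => absurd (pow_le_pow_left' hc 2) (not_le.2 h2)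

end IsRiemannMap

theorem hasDerivAt_arsinh_log_norm {y : ℝ → ℂ} {y' : ℂ} {t : ℝ} (hy : HasDerivAt y y' t)
    (h0 : y t ≠ 0) :
    HasDerivAt (fun t => Real.arsinh (Real.log ‖y t‖))
      ((√(1 + Real.log ‖y t‖ ^ 2))⁻¹ * (inner ℝ (y t) y' / ‖y t‖ ^ 2)) t := by
  have hn : 0 < ‖y t‖ := norm_pos_iff.2 h0
  have h1 : HasDerivAt (fun t => Real.log (‖y t‖ ^ 2) / 2)
      (2 * inner ℝ (y t) y' / ‖y t‖ ^ 2 / 2) t :=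
    (hy.norm_sq.log (by positivity)).div_const 2
  have h2 : (fun t => Real.log (‖y t‖ ^ 2) / 2) = fun t => Real.log ‖y t‖ := by
    funext t; rw [Real.log_pow]; push_cast; ring
  rw [h2] at h1
  refine (Real.hasDerivAt_arsinh _).comp t h1 |>.congr_deriv ?_
  ring

theorem norm_arsinh_log_deriv_le {y y' : ℂ} (h0 : y ≠ 0) :
    ‖(√(1 + Real.log ‖y‖ ^ 2))⁻¹ * (inner ℝ y y' / ‖y‖ ^ 2)‖ ≤
      ‖y'‖ * (1 / (‖y‖ * √(1 + Real.log ‖y‖ ^ 2))) := by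
  have hn : 0 < ‖y‖ := norm_pos_iff.2 h0
  have hs : 0 < √(1 + Real.log ‖y‖ ^ 2) := by positivity
  rw [norm_mul, norm_div, Real.norm_of_nonneg (sq_nonneg ‖y‖), norm_inv,
    Real.norm_of_nonneg hs.le]
  calc (√(1 + Real.log ‖y‖ ^ 2))⁻¹ * (‖inner ℝ y y'‖ / ‖y‖ ^ 2)
      ≤ (√(1 + Real.log ‖y‖ ^ 2))⁻¹ * (‖y‖ * ‖y'‖ / ‖y‖ ^ 2) := by
        gcongr; exact norm_inner_le_norm y y'
    _ = _ := by field_simp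

section Curve

variable {a : ℂ} {α β : ℝ} {x x' : ℝ → ℂ}

open MeasureTheory in
theorem enorm_arsinh_log_sub_le (hx : ∀ t ∈ Ioo α β, HasDerivAt x (x' t) t)
    (hx' : ContinuousOn x' (Ioo α β)) (ha : ∀ t ∈ Ioo α β, x t ≠ a) {s t : ℝ}
    (hs : s ∈ Ioo α β) (ht : t ∈ Ioo α β) :
    ‖Real.arsinh (Real.log ‖x t - a‖) - Real.arsinh (Real.log ‖x s - a‖)‖ₑ ≤
      ∫⁻ u in Ioo α β, ENNReal.ofReal (‖x' u‖ * logWeight a (x u)) := by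
  have hxc : ContinuousOn (fun t => x t - a) (Ioo α β) := fun t ht =>
    ((hx t ht).continuousAt.sub continuousAt_const).continuousWithinAt
  have hne : ∀ t ∈ Ioo α β, ‖x t - a‖ ≠ 0 := fun t ht => norm_ne_zero_iff.2 (sub_ne_zero.2 (ha t ht))
  refine (enorm_sub_le_lintegral_enorm_deriv
    (fun t ht => hasDerivAt_arsinh_log_norm ((hx t ht).sub_const a) (sub_ne_zero.2 (ha t ht)))
    ?_ hs ht).trans (setLIntegral_mono' measurableSet_Ioo fun u hu => ?_)
  · refine ContinuousOn.mul ?_ ((hxc.inner (𝕜 := ℝ) hx').div (hxc.norm.pow 2)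
      fun t ht => pow_ne_zero 2 (hne t ht))
    refine ContinuousOn.inv₀ ?_ fun t _ => by positivity
    exact ContinuousOn.sqrt (continuousOn_const.add ((hxc.norm.log hne).pow 2))
  · rw [← ofReal_norm]
    exact ENNReal.ofReal_le_ofReal (norm_arsinh_log_deriv_le (sub_ne_zero.2 (ha u hu)))

theorem Real.le_exp_sinh_of_arsinh_log_le {s T : ℝ} (hs : 0 < s)
    (h : Real.arsinh (Real.log s) ≤ T) : s ≤ Real.exp (Real.sinh T) := by
  rw [← Real.log_le_iff_le_exp hs, ← Real.arsinh_le_arsinh, Real.arsinh_sinh]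
  exact h

theorem Real.exp_sinh_le_of_le_arsinh_log {s T : ℝ} (hs : 0 < s)
    (h : T ≤ Real.arsinh (Real.log s)) : Real.exp (Real.sinh T) ≤ s := by
  rw [← Real.le_log_iff_exp_le hs, ← Real.arsinh_le_arsinh, Real.arsinh_sinh]
  exact h

theorem exists_mul_logWeight_ge (M : ℝ) :
    ∃ C > 0, ∀ a x : ℂ, x ≠ a → ‖x - a‖ ≤ M → 1 ≤ C * logWeight a x := by
  have hcont : Continuous fun s : ℝ => s ^ 2 + (s * Real.log s) ^ 2 :=
    (continuous_pow 2).add (Real.continuous_mul_log.pow 2)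
  obtain ⟨B, hB⟩ := (isCompact_Icc (a := (0 : ℝ)) (b := M)).bddAbove_image hcont.continuousOn
  refine ⟨√(max B 1), by positivity, fun a x hxa hM => ?_⟩
  have hn : 0 < ‖x - a‖ := norm_pos_iff.2 (sub_ne_zero.2 hxa)
  have h1 : ‖x - a‖ * √(1 + Real.log ‖x - a‖ ^ 2) ≤ √(max B 1) := by
    refine Real.le_sqrt_of_sq_le ?_
    rw [mul_pow, Real.sq_sqrt (by positivity)]
    refine le_trans ?_ (le_max_left _ _)
    refine le_trans (le_of_eq ?_) (hB ⟨‖x - a‖, ⟨hn.le, hM⟩, rfl⟩)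
    ring
  unfold logWeight
  rw [mul_one_div, le_div_iff₀ (by positivity), one_mul]
  exact h1

open MeasureTheory in
theorem lintegral_enorm_le_of_norm_sub_le {M C : ℝ} (ha : ∀ t ∈ Ioo α β, x t ≠ a)
    (hM : ∀ t ∈ Ioo α β, ‖x t - a‖ ≤ M) (hC0 : 0 < C)
    (hC : ∀ a x : ℂ, x ≠ a → ‖x - a‖ ≤ M → 1 ≤ C * logWeight a x) :
    ∫⁻ u in Ioo α β, ‖x' u‖ₑ ≤
      ENNReal.ofReal C * ∫⁻ u in Ioo α β, ENNReal.ofReal (‖x' u‖ * logWeight a (x u)) := by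
  rw [← lintegral_const_mul' _ _ ENNReal.ofReal_ne_top]
  refine setLIntegral_mono' measurableSet_Ioo fun u hu => ?_
  rw [← ofReal_norm, ← ENNReal.ofReal_mul hC0.le]
  refine ENNReal.ofReal_le_ofReal ?_
  have := mul_le_mul_of_nonneg_left (hC a (x u) (ha u hu) (hM u hu)) (norm_nonneg (x' u))
  linarith

theorem abs_sub_le_of_enorm_sub_le {A B L : ℝ} (hL : 0 ≤ L)
    (h : ‖A - B‖ₑ ≤ ENNReal.ofReal L) : |A - B| ≤ L := by
  rw [← ofReal_norm] at h
  exact (ENNReal.ofReal_le_ofReal_iff hL).1 h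

open MeasureTheory in
theorem exists_tendsto_ne_of_logWeight_length_lt_top (hαβ : α < β)
    (hx : ∀ t ∈ Ioo α β, HasDerivAt x (x' t) t)
    (hx' : ContinuousOn x' (Ioo α β)) (ha : ∀ t ∈ Ioo α β, x t ≠ a)
    (hfin : ∫⁻ u in Ioo α β, ENNReal.ofReal (‖x' u‖ * logWeight a (x u)) < ⊤) :
    (∃ p, p ≠ a ∧ Tendsto x (𝓝[>] α) (𝓝 p)) ∧ ∃ q, q ≠ a ∧ Tendsto x (𝓝[<] β) (𝓝 q) := by
  obtain ⟨c, hc⟩ := nonempty_Ioo.2 hαβ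
  set L := (∫⁻ u in Ioo α β, ENNReal.ofReal (‖x' u‖ * logWeight a (x u))).toReal
  have hpos : ∀ t ∈ Ioo α β, 0 < ‖x t - a‖ := fun t ht => norm_pos_iff.2 (sub_ne_zero.2 (ha t ht))
  have hT : ∀ t ∈ Ioo α β,
      |Real.arsinh (Real.log ‖x t - a‖) - Real.arsinh (Real.log ‖x c - a‖)| ≤ L := by
    intro t ht
    refine abs_sub_le_of_enorm_sub_le ENNReal.toReal_nonneg ?_
    rw [ENNReal.ofReal_toReal hfin.ne]
    exact enorm_arsinh_log_sub_le hx hx' ha hc ht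
  set T := Real.arsinh (Real.log ‖x c - a‖)
  have hM : ∀ t ∈ Ioo α β, ‖x t - a‖ ≤ Real.exp (Real.sinh (T + L)) := fun t ht =>
    Real.le_exp_sinh_of_arsinh_log_le (hpos t ht) (by linarith [(abs_le.1 (hT t ht)).2])
  have hm : ∀ t ∈ Ioo α β, Real.exp (Real.sinh (T - L)) ≤ ‖x t - a‖ := fun t ht =>
    Real.exp_sinh_le_of_le_arsinh_log (hpos t ht) (by linarith [(abs_le.1 (hT t ht)).1])
  obtain ⟨C, hC0, hC⟩ := exists_mul_logWeight_ge (Real.exp (Real.sinh (T + L)))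
  have hlen := lintegral_enorm_le_of_norm_sub_le (x' := x') ha hM hC0 hC
  have hne : ∀ (l : Filter ℝ) [l.NeBot] (p : ℂ), (∀ᶠ t in l, t ∈ Ioo α β) → Tendsto x l (𝓝 p) →
      p ≠ a := by
    intro l _ p hl hp
    have h1 : Real.exp (Real.sinh (T - L)) ≤ ‖p - a‖ :=
      ge_of_tendsto (hp.sub_const a).norm (hl.mono hm)
    exact sub_ne_zero.1 (norm_pos_iff.1 ((Real.exp_pos _).trans_le h1))
  obtain ⟨⟨p, hp⟩, q, hq⟩ := exists_tendsto_of_lintegral_enorm_deriv_lt_top hαβ hx hx'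
    (hlen.trans_lt (ENNReal.mul_lt_top ENNReal.ofReal_lt_top hfin))
  exact ⟨⟨p, hne _ p (Ioo_mem_nhdsGT hαβ) hp, hp⟩, q, hne _ q (Ioo_mem_nhdsLT hαβ) hq, hq⟩

open MeasureTheory in
/-- Curves that are short for the logarithmic metric and meet a fixed ball have small diameter. -/
theorem exists_norm_sub_le_of_logWeight_length_le (a : ℂ) (R : ℝ) :
    ∃ C > 0, ∀ {α β ε : ℝ} {x x' : ℝ → ℂ}, (∀ t ∈ Ioo α β, HasDerivAt x (x' t) t) →
      ContinuousOn x' (Ioo α β) → (∀ t ∈ Ioo α β, x t ≠ a) → 0 ≤ ε → ε ≤ 1 →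
      ∫⁻ u in Ioo α β, ENNReal.ofReal (‖x' u‖ * logWeight a (x u)) ≤ ENNReal.ofReal ε →
      ∀ s ∈ Ioo α β, ‖x s - a‖ ≤ R → ∀ t ∈ Ioo α β, ‖x t - x s‖ ≤ C * ε := by
  obtain ⟨C, hC0, hC⟩ := exists_mul_logWeight_ge
    (Real.exp (Real.sinh (Real.arsinh (Real.log R) + 1)))
  refine ⟨C, hC0, fun {α β ε x x'} hx hx' ha hε0 hε1 hlen s hs hsR t ht => ?_⟩
  have hpos : ∀ t ∈ Ioo α β, 0 < ‖x t - a‖ := fun t ht => norm_pos_iff.2 (sub_ne_zero.2 (ha t ht))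
  have hM : ∀ t ∈ Ioo α β,
      ‖x t - a‖ ≤ Real.exp (Real.sinh (Real.arsinh (Real.log R) + 1)) := by
    intro t ht
    refine Real.le_exp_sinh_of_arsinh_log_le (hpos t ht) ?_
    have h1 := abs_sub_le_of_enorm_sub_le hε0 ((enorm_arsinh_log_sub_le hx hx' ha hs ht).trans hlen)
    have h2 : Real.arsinh (Real.log ‖x s - a‖) ≤ Real.arsinh (Real.log R) :=
      Real.arsinh_le_arsinh.2 (Real.log_le_log (hpos s hs) hsR)
    linarith [(abs_le.1 h1).2]
  have h3 : ‖x t - x s‖ₑ ≤ ENNReal.ofReal (C * ε) := by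
    rw [ENNReal.ofReal_mul hC0.le]
    exact (enorm_sub_le_lintegral_enorm_deriv hx hx' hs ht).trans
      ((lintegral_enorm_le_of_norm_sub_le ha hM hC0 hC).trans (by gcongr))
  rw [← ofReal_norm] at h3
  exact (ENNReal.ofReal_le_ofReal_iff (by positivity)).1 h3

end Curve

/-- The circular arcs of radius `r n` around `ζ` are mapped by `φ` to a null sequence of
cross-cuts of `V`, with end points `p n`, `q n` and pairwise disjoint closures. -/
structure IsCrosscutSeq (V : Set ℂ) (φ : ℂ → ℂ) (ζ : ℂ) (r : ℕ → ℝ) (p q : ℕ → ℂ) : Prop where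
  pos : ∀ n, 0 < r n
  lt_one : ∀ n, r n < 1
  anti : ∀ m n, m < n → r n < r m
  tendsto_zero : Tendsto r atTop (𝓝 0)
  left_mem : ∀ n, p n ∈ frontier V
  right_mem : ∀ n, q n ∈ frontier V
  tendsto_left : ∀ n, Tendsto (fun θ => φ (arcPt ζ (r n) θ)) (𝓝[>] (-arcAngle (r n))) (𝓝 (p n))
  tendsto_right : ∀ n, Tendsto (fun θ => φ (arcPt ζ (r n) θ)) (𝓝[<] (arcAngle (r n))) (𝓝 (q n))
  disjoint : ∀ m n, m ≠ n → Disjoint ({p m, q m} : Set ℂ) {p n, q n}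
  null : IsNullSeq fun n => φ '' (Metric.sphere ζ (r n) ∩ Metric.ball 0 1)

theorem norm_arcPt_arcAngle {ζ : ℂ} (hζ : ‖ζ‖ = 1) {r : ℝ} (hr : 0 < r) (hr1 : r < 1) {θ : ℝ}
    (hθ : |θ| = arcAngle r) : ‖arcPt ζ r θ‖ = 1 := by
  have h1 := norm_arcPt_sq hζ r θ
  have hc : Real.cos (arcAngle r) = r / 2 := Real.cos_arccos (by linarith) (by linarith)
  rw [← Real.cos_abs, hθ, hc] at h1
  have h2 : ‖arcPt ζ r θ‖ ^ 2 = 1 ^ 2 := by rw [h1]; ring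
  exact (sq_eq_sq₀ (norm_nonneg _) zero_le_one).1 h2

namespace IsRiemannMap

variable {V : Set ℂ} {φ ψ : ℂ → ℂ}

theorem mem_frontier_of_tendsto (h : IsRiemannMap V φ ψ) {ι : Type*} {l : Filter ι} [l.NeBot]
    {w : ι → ℂ} (hw : ∀ᶠ i in l, w i ∈ Metric.ball (0 : ℂ) 1) {ζ p : ℂ} (hζ : ‖ζ‖ = 1)
    (hwζ : Tendsto w l (𝓝 ζ)) (hp : Tendsto (fun i => φ (w i)) l (𝓝 p)) : p ∈ frontier V := by
  rw [h.isOpen.frontier_eq]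
  refine ⟨mem_closure_of_tendsto hp (hw.mono fun i hi => h.mapsTo hi), fun hpV => ?_⟩
  have h1 : Tendsto (fun i => ψ (φ (w i))) l (𝓝 (ψ p)) :=
    ((h.diff_inv.continuousOn.continuousAt (h.isOpen.mem_nhds hpV)).tendsto).comp hp
  have h2 : ψ p = ζ := tendsto_nhds_unique
    (h1.congr' (hw.mono fun i hi => h.left_inv _ hi)) hwζ
  have h3 := mem_ball_zero_iff.1 (h.mapsTo_inv hpV)
  rw [h2, hζ] at h3
  exact lt_irrefl _ h3

theorem hasDerivAt_comp_arcPt (h : IsRiemannMap V φ ψ) {ζ : ℂ} (hζ : ‖ζ‖ = 1) {r : ℝ}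
    (hr : 0 < r) (hr1 : r < 1) {θ : ℝ} (hθ : θ ∈ Ioo (-arcAngle r) (arcAngle r)) :
    HasDerivAt (fun θ => φ (arcPt ζ r θ))
      (deriv φ (arcPt ζ r θ) * -(ζ * r * Complex.I * Complex.exp (θ * Complex.I))) θ :=
  (h.hasDerivAt (arcPt_mem_ball hζ hr hr1 hθ)).comp θ (hasDerivAt_arcPt ζ r θ)

theorem continuousOn_deriv_comp_arcPt (h : IsRiemannMap V φ ψ) {ζ : ℂ} (hζ : ‖ζ‖ = 1) {r : ℝ}
    (hr : 0 < r) (hr1 : r < 1) :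
    ContinuousOn (fun θ : ℝ => deriv φ (arcPt ζ r θ) *
      -(ζ * r * Complex.I * Complex.exp (θ * Complex.I))) (Ioo (-arcAngle r) (arcAngle r)) := by
  refine ContinuousOn.mul (h.continuousOn_deriv.comp (continuous_arcPt ζ r).continuousOn
    fun θ hθ => arcPt_mem_ball hζ hr hr1 hθ) (Continuous.continuousOn (by fun_prop))

theorem arcLength_eq (φ : ℂ → ℂ) (a : ℂ) {ζ : ℂ} (hζ : ‖ζ‖ = 1) {r : ℝ} (hr : 0 < r) :
    arcLength φ a ζ r = ∫⁻ θ in Ioo (-arcAngle r) (arcAngle r), ENNReal.ofReal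
      (‖deriv φ (arcPt ζ r θ) * -(ζ * r * Complex.I * Complex.exp (θ * Complex.I))‖ *
        logWeight a (φ (arcPt ζ r θ))) := by
  unfold arcLength
  refine MeasureTheory.lintegral_congr fun θ => ?_
  congr 1
  rw [norm_mul, norm_neg, norm_mul, norm_mul, norm_mul, hζ, Complex.norm_I,
    Complex.norm_exp_ofReal_mul_I, Complex.norm_real, Real.norm_of_nonneg hr.le]
  ring

theorem comp_arcPt_ne (h : IsRiemannMap V φ ψ) {a : ℂ} (ha : a ∉ V) {ζ : ℂ} (hζ : ‖ζ‖ = 1) {r : ℝ}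
    (hr : 0 < r) (hr1 : r < 1) :
    ∀ θ ∈ Ioo (-arcAngle r) (arcAngle r), φ (arcPt ζ r θ) ≠ a := fun _ hθ e =>
  ha (e ▸ h.mapsTo (arcPt_mem_ball hζ hr hr1 hθ))

theorem exists_arc_endpoints (h : IsRiemannMap V φ ψ) {a₀ : ℂ} (ha₀ : a₀ ∉ V) (F : Finset ℂ)
    (hF : ∀ a ∈ F, a ∉ V) {ζ : ℂ} (hζ : ‖ζ‖ = 1) {δ : ℝ} (hδ : 0 < δ) :
    ∃ r p q, 0 < r ∧ r < δ ∧ r < 1 ∧ arcLength φ a₀ ζ r ≤ ENNReal.ofReal δ ∧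
      p ∈ frontier V ∧ q ∈ frontier V ∧ p ∉ F ∧ q ∉ F ∧
      Tendsto (fun θ => φ (arcPt ζ r θ)) (𝓝[>] (-arcAngle r)) (𝓝 p) ∧
      Tendsto (fun θ => φ (arcPt ζ r θ)) (𝓝[<] (arcAngle r)) (𝓝 q) := by
  classical
  obtain ⟨r, hr, hrδ, hr1, hlen⟩ := h.exists_arcLength_lt (insert a₀ F)
    (by simpa using ⟨ha₀, hF⟩) hζ hδ hδ
  have hα : -arcAngle r < arcAngle r := by linarith [arcAngle_pos hr1]
  have key : ∀ a ∈ insert a₀ F, (∃ p, p ≠ a ∧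
      Tendsto (fun θ => φ (arcPt ζ r θ)) (𝓝[>] (-arcAngle r)) (𝓝 p)) ∧
      ∃ q, q ≠ a ∧ Tendsto (fun θ => φ (arcPt ζ r θ)) (𝓝[<] (arcAngle r)) (𝓝 q) := by
    intro a ha
    have haV : a ∉ V := by
      rcases Finset.mem_insert.1 ha with rfl | ha
      exacts [ha₀, hF a ha]
    refine exists_tendsto_ne_of_logWeight_length_lt_top hα
      (fun t ht => h.hasDerivAt_comp_arcPt hζ hr hr1 ht) (h.continuousOn_deriv_comp_arcPt hζ hr hr1)
      (h.comp_arcPt_ne haV hζ hr hr1) ?_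
    rw [← arcLength_eq φ a hζ hr]
    exact (hlen a ha).trans ENNReal.ofReal_lt_top
  obtain ⟨⟨p, -, hp⟩, q, -, hq⟩ := key a₀ (Finset.mem_insert_self _ _)
  refine ⟨r, p, q, hr, hrδ, hr1, (hlen a₀ (Finset.mem_insert_self _ _)).le, ?_, ?_, ?_, ?_, hp, hq⟩
  · refine h.mem_frontier_of_tendsto (l := 𝓝[>] (-arcAngle r)) (w := arcPt ζ r) ?_
      (norm_arcPt_arcAngle hζ hr hr1 (θ := -arcAngle r) ?_)
      ((continuous_arcPt ζ r).continuousWithinAt) hp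
    · filter_upwards [Ioo_mem_nhdsGT hα] with θ hθ using arcPt_mem_ball hζ hr hr1 hθ
    · rw [abs_neg, abs_of_pos (arcAngle_pos hr1)]
  · refine h.mem_frontier_of_tendsto (l := 𝓝[<] (arcAngle r)) (w := arcPt ζ r) ?_
      (norm_arcPt_arcAngle hζ hr hr1 (θ := arcAngle r) ?_)
      ((continuous_arcPt ζ r).continuousWithinAt) hq
    · filter_upwards [Ioo_mem_nhdsLT hα] with θ hθ using arcPt_mem_ball hζ hr hr1 hθ
    · rw [abs_of_pos (arcAngle_pos hr1)]
  · intro hpF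
    obtain ⟨⟨p', hne, hp'⟩, -⟩ := key p (Finset.mem_insert_of_mem hpF)
    exact hne (tendsto_nhds_unique hp' hp)
  · intro hqF
    obtain ⟨-, q', hne, hq'⟩ := key q (Finset.mem_insert_of_mem hqF)
    exact hne (tendsto_nhds_unique hq' hq)

theorem isNullSeq_image_arc (h : IsRiemannMap V φ ψ) {a : ℂ} (ha : a ∉ V) {ζ : ℂ} (hζ : ‖ζ‖ = 1)
    {r ε : ℕ → ℝ} (hr : ∀ n, 0 < r n) (hr1 : ∀ n, r n < 1) (hε : Tendsto ε atTop (𝓝 0))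
    (hε0 : ∀ n, 0 ≤ ε n)
    (hlen : ∀ᶠ n in atTop, arcLength φ a ζ (r n) ≤ ENNReal.ofReal (ε n)) :
    IsNullSeq fun n => φ '' (Metric.sphere ζ (r n) ∩ Metric.ball 0 1) := by
  intro A B hA hB hAB
  obtain ⟨R, hR⟩ := hA.isBounded.subset_closedBall a
  obtain ⟨C, hC0, hC⟩ := exists_norm_sub_le_of_logWeight_length_le a R
  obtain ⟨d, hd0, hd⟩ := Metric.exists_pos_forall_lt_edist hA hB.isClosed hAB
  have h1 : ∀ᶠ n in atTop, ε n < 1 := hε.eventually_lt_const one_pos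
  have h2 : ∀ᶠ n in atTop, C * ε n < d :=
    (hε.const_mul C).eventually_lt_const (by simpa using hd0)
  filter_upwards [h1, h2, hlen] with n hn1 hn2 hn3
  rintro ⟨⟨_, ⟨w, hw, rfl⟩, hwA⟩, _, ⟨w', hw', rfl⟩, hwB⟩
  rw [← image_arcPt hζ (hr n) (hr1 n)] at hw hw'
  obtain ⟨s, hs, rfl⟩ := hw
  obtain ⟨t, ht, rfl⟩ := hw'
  rw [arcLength_eq φ a hζ (hr n)] at hn3
  have h4 := hC (fun t ht => h.hasDerivAt_comp_arcPt hζ (hr n) (hr1 n) ht)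
    (h.continuousOn_deriv_comp_arcPt hζ (hr n) (hr1 n)) (h.comp_arcPt_ne ha hζ (hr n) (hr1 n))
    (hε0 n) hn1.le hn3 s hs (mem_closedBall_iff_norm.1 (hR hwA)) t ht
  have h5 := hd _ hwA _ hwB
  rw [edist_comm, edist_dist, dist_eq_norm, ← ENNReal.ofReal_coe_nnreal,
    ENNReal.ofReal_lt_ofReal_iff_of_nonneg d.coe_nonneg] at h5
  linarith

theorem exists_isCrosscutSeq (h : IsRiemannMap V φ ψ) (hV : V ≠ univ) {ζ : ℂ} (hζ : ‖ζ‖ = 1) :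
    ∃ r p q, IsCrosscutSeq V φ ζ r p q := by
  classical
  obtain ⟨a₀, ha₀⟩ := (ne_univ_iff_exists_notMem V).1 hV
  have hfr : ∀ x ∈ frontier V, x ∉ V := fun x hx => by
    rw [h.isOpen.frontier_eq] at hx; exact hx.2
  obtain ⟨f, hf, hfr'⟩ := exists_seq_of_forall_finset_exists
    (fun x : ℝ × ℂ × ℂ => 0 < x.1 ∧ x.1 < 1 ∧ x.2.1 ∈ frontier V ∧ x.2.2 ∈ frontier V ∧
      Tendsto (fun θ => φ (arcPt ζ x.1 θ)) (𝓝[>] (-arcAngle x.1)) (𝓝 x.2.1) ∧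
      Tendsto (fun θ => φ (arcPt ζ x.1 θ)) (𝓝[<] (arcAngle x.1)) (𝓝 x.2.2))
    (fun x y => y.1 < x.1 / 2 ∧ arcLength φ a₀ ζ y.1 ≤ ENNReal.ofReal x.1 ∧
      Disjoint ({x.2.1, x.2.2} : Set ℂ) {y.2.1, y.2.2}) (by
    intro s hs
    obtain ⟨δ, hδs, hδ⟩ : ∃ δ : ℝ, (∀ x ∈ s, δ < x.1 / 2) ∧ 0 < δ := by
      have h1 : ∀ᶠ δ in 𝓝[>] (0 : ℝ), ∀ x ∈ s, δ < x.1 / 2 :=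
        (Filter.eventually_all_finset s).2 fun x hx =>
          nhdsWithin_le_nhds (Iio_mem_nhds (half_pos (hs x hx).1))
      exact (h1.and self_mem_nhdsWithin).exists
    obtain ⟨r, p, q, hr, hrδ, hr1, hlen, hp, hq, hpF, hqF, hpt, hqt⟩ :=
      h.exists_arc_endpoints ha₀ (s.image (fun x => x.2.1) ∪ s.image (fun x => x.2.2)) (by
        intro a ha
        rcases Finset.mem_union.1 ha with ha | ha <;> obtain ⟨x, hx, rfl⟩ := Finset.mem_image.1 ha
        exacts [hfr _ (hs x hx).2.2.1, hfr _ (hs x hx).2.2.2.1]) hζ hδ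
    refine ⟨(r, p, q), ⟨hr, hr1, hp, hq, hpt, hqt⟩, fun x hx => ⟨hrδ.trans (hδs x hx), ?_, ?_⟩⟩
    · exact hlen.trans (ENNReal.ofReal_le_ofReal (by linarith [hδs x hx, (hs x hx).1]))
    · have hmem : ∀ y ∈ ({x.2.1, x.2.2} : Set ℂ),
          y ∈ s.image (fun x => x.2.1) ∪ s.image (fun x => x.2.2) := by
        rintro y (rfl | rfl)
        · exact Finset.mem_union_left _ (Finset.mem_image_of_mem _ hx)
        · exact Finset.mem_union_right _ (Finset.mem_image_of_mem _ hx)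
      rw [disjoint_left]
      rintro y hy (rfl | rfl)
      exacts [hpF (hmem _ hy), hqF (hmem _ hy)])
  have hpow : ∀ n, (f n).1 ≤ (1 / 2 : ℝ) ^ n := by
    intro n
    induction n with
    | zero => simpa using (hf 0).2.1.le
    | succ n ih =>
      have := (hfr' n (n + 1) n.lt_succ_self).1
      rw [pow_succ]
      linarith
  have hlim : Tendsto (fun n => (1 / 2 : ℝ) ^ (n - 1)) atTop (𝓝 0) :=
    (tendsto_pow_atTop_nhds_zero_of_lt_one (by norm_num) (by norm_num)).comp
      (tendsto_sub_atTop_nat 1)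
  refine ⟨fun n => (f n).1, fun n => (f n).2.1, fun n => (f n).2.2, fun n => (hf n).1,
    fun n => (hf n).2.1, fun m n hmn => ?_, ?_, fun n => (hf n).2.2.1, fun n => (hf n).2.2.2.1,
    fun n => (hf n).2.2.2.2.1, fun n => (hf n).2.2.2.2.2, fun m n hmn => ?_, ?_⟩
  · linarith [(hfr' m n hmn).1, (hf m).1]
  · exact squeeze_zero (fun n => (hf n).1.le) hpow
      (tendsto_pow_atTop_nhds_zero_of_lt_one (by norm_num) (by norm_num))
  · rcases hmn.lt_or_gt with hmn | hmn
    · exact (hfr' m n hmn).2.2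
    · exact (hfr' n m hmn).2.2.symm
  · refine h.isNullSeq_image_arc ha₀ hζ (fun n => (hf n).1) (fun n => (hf n).2.1) hlim
      (fun n => by positivity) ?_
    filter_upwards [eventually_ge_atTop 1] with n hn
    obtain ⟨m, rfl⟩ := Nat.exists_eq_add_of_le' hn
    exact (hfr' m (m + 1) m.lt_succ_self).2.1.trans (ENNReal.ofReal_le_ofReal (by simpa using hpow m))

end IsRiemannMap

theorem hasTwoComps_union {D₁ D₂ : Set X} (h₁ : IsOpen D₁) (h₂ : IsOpen D₂)
    (c₁ : IsConnected D₁) (c₂ : IsConnected D₂) (hd : Disjoint D₁ D₂) :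
    HasTwoComps (D₁ ∪ D₂) D₁ D₂ := by
  have key : ∀ {D₁ D₂ : Set X}, IsOpen D₁ → IsOpen D₂ → IsConnected D₁ → Disjoint D₁ D₂ →
      ∀ x ∈ D₁, connectedComponentIn (D₁ ∪ D₂) x = D₁ := by
    intro D₁ D₂ h₁ h₂ c₁ hd x hx
    refine Subset.antisymm ?_ (c₁.isPreconnected.subset_connectedComponentIn hx subset_union_left)
    exact isPreconnected_connectedComponentIn.subset_left_of_subset_union h₁ h₂ hd
      (connectedComponentIn_subset _ _) ⟨x, mem_connectedComponentIn (Or.inl hx), hx⟩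
  have key₂ : ∀ x ∈ D₂, connectedComponentIn (D₁ ∪ D₂) x = D₂ := by
    rw [union_comm]; exact key h₂ h₁ c₂ hd.symm
  obtain ⟨x₁, hx₁⟩ := c₁.nonempty
  obtain ⟨x₂, hx₂⟩ := c₂.nonempty
  refine ⟨⟨x₁, Or.inl hx₁, (key h₁ h₂ c₁ hd x₁ hx₁).symm⟩, ⟨x₂, Or.inr hx₂, (key₂ x₂ hx₂).symm⟩,
    fun e => disjoint_left.1 hd hx₁ (e ▸ hx₁), ?_⟩
  rintro x (hx | hx)
  exacts [Or.inl (key h₁ h₂ c₁ hd x hx), Or.inr (key₂ x hx)]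

theorem isConnected_ball_inter_ball {ζ : ℂ} (hζ : ‖ζ‖ = 1) {r : ℝ} (hr : 0 < r) (hr1 : r < 1) :
    IsConnected (Metric.ball (0 : ℂ) 1 ∩ Metric.ball ζ r) := by
  refine ⟨⟨arcPt ζ (r / 2) 0, ?_, ?_⟩, ((convex_ball _ _).inter (convex_ball _ _)).isPreconnected⟩
  · rw [arcPt_mem_ball_iff hζ (half_pos hr), Real.cos_zero]; linarith
  · rw [mem_ball_iff_norm, norm_arcPt_sub hζ (half_pos hr).le]; linarith

theorem norm_sub_le_norm_sub_of_toward {ζ w : ℂ} (hζ : ‖ζ‖ = 1) (hw : ‖w‖ < 1) {t : ℝ}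
    (ht : 0 ≤ t) : ‖w - ζ‖ ≤ ‖w - t * (w + ζ) - ζ‖ := by
  rw [← sq_le_sq₀ (norm_nonneg _) (norm_nonneg _), ← Complex.normSq_eq_norm_sq,
    ← Complex.normSq_eq_norm_sq, Complex.normSq_apply, Complex.normSq_apply]
  have h1 : ζ.re * ζ.re + ζ.im * ζ.im = 1 := by
    rw [← Complex.normSq_apply, Complex.normSq_eq_norm_sq, hζ, one_pow]
  have h2 : w.re * w.re + w.im * w.im ≤ 1 := by
    rw [← Complex.normSq_apply, Complex.normSq_eq_norm_sq]
    nlinarith [norm_nonneg w]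
  simp only [Complex.sub_re, Complex.sub_im, Complex.mul_re, Complex.mul_im, Complex.add_re,
    Complex.add_im, Complex.ofReal_re, Complex.ofReal_im, zero_mul, sub_zero, add_zero]
  nlinarith [mul_nonneg ht (sub_nonneg.2 h2), sq_nonneg (t * (w.re + ζ.re)),
    sq_nonneg (t * (w.im + ζ.im))]

theorem norm_sub_mul_add_lt_one {ζ w : ℂ} (hζ : ‖ζ‖ = 1) (hw : ‖w‖ < 1) {t : ℝ}
    (ht : t ∈ Ico (0 : ℝ) 1) : ‖w - t * (w + ζ)‖ < 1 := by
  calc ‖w - t * (w + ζ)‖ = ‖((1 - t : ℝ) : ℂ) * w - t * ζ‖ := by push_cast; ring_nf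
    _ ≤ ‖((1 - t : ℝ) : ℂ) * w‖ + ‖(t : ℂ) * ζ‖ := norm_sub_le _ _
    _ = (1 - t) * ‖w‖ + t := by
      rw [norm_mul, norm_mul, hζ, Complex.norm_real, Complex.norm_real,
        Real.norm_of_nonneg ht.1, Real.norm_of_nonneg (by linarith [ht.2]), mul_one]
    _ < 1 := by nlinarith [ht.2]

theorem isConnected_ball_diff_closedBall {ζ : ℂ} (hζ : ‖ζ‖ = 1) {r : ℝ} (hr1 : r < 1) :
    IsConnected (Metric.ball (0 : ℂ) 1 \ Metric.closedBall ζ r) := by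
  have hx₀ : ‖-(ζ / 2)‖ = 1 / 2 := by rw [norm_neg, norm_div, hζ]; norm_num
  have hB : Metric.ball (0 : ℂ) 1 ∩ Metric.ball (-ζ) 1 ⊆
      Metric.ball (0 : ℂ) 1 \ Metric.closedBall ζ r := by
    rintro x ⟨h1, h2⟩
    refine ⟨h1, fun h3 => ?_⟩
    rw [mem_ball_iff_norm] at h2
    rw [mem_closedBall_iff_norm] at h3
    have h4 : ‖(x - -ζ) - (x - ζ)‖ = 2 := by
      rw [show (x - -ζ) - (x - ζ) = 2 * ζ by ring, norm_mul, hζ]; norm_num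
    linarith [norm_sub_le (x - -ζ) (x - ζ)]
  have hx₀B : -(ζ / 2) ∈ Metric.ball (0 : ℂ) 1 ∩ Metric.ball (-ζ) 1 := by
    refine ⟨by rw [mem_ball_zero_iff, hx₀]; norm_num, ?_⟩
    rw [mem_ball_iff_norm, show -(ζ / 2) - -ζ = -(-(ζ / 2)) by ring, norm_neg, hx₀]
    norm_num
  refine ⟨⟨_, hB hx₀B⟩, isPreconnected_of_forall (-(ζ / 2)) fun w hw => ?_⟩
  have hw1 : ‖w‖ < 1 := mem_ball_zero_iff.1 hw.1
  have hcont : Continuous fun t : ℝ => w - t * (w + ζ) := by fun_prop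
  refine ⟨((fun t : ℝ => w - t * (w + ζ)) '' Ico 0 1) ∪
    (Metric.ball (0 : ℂ) 1 ∩ Metric.ball (-ζ) 1), union_subset ?_ hB, Or.inr hx₀B,
    Or.inl ⟨0, ⟨le_rfl, one_pos⟩, by simp⟩, ?_⟩
  · rintro _ ⟨t, ht, rfl⟩
    constructor
    · exact mem_ball_zero_iff.2 (norm_sub_mul_add_lt_one hζ hw1 ht)
    · intro h3
      refine hw.2 ?_
      rw [mem_closedBall_iff_norm] at h3 ⊢
      exact (norm_sub_le_norm_sub_of_toward hζ hw1 ht.1).trans h3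
  · have h1 : ∀ᶠ t : ℝ in 𝓝[<] 1, w - t * (w + ζ) ∈ Metric.ball (-ζ) 1 := by
      refine (hcont.continuousWithinAt (s := Iio 1) (x := 1)).eventually_mem
        (Metric.isOpen_ball.mem_nhds ?_)
      rw [mem_ball_iff_norm]
      simp
    obtain ⟨t, ht1, ht⟩ := (h1.and (Ico_mem_nhdsLT (zero_lt_one' ℝ))).exists
    refine IsPreconnected.union (w - t * (w + ζ)) ⟨t, ht, rfl⟩ ⟨?_, ht1⟩
      (isPreconnected_Ico.image _ hcont.continuousOn)
      ((convex_ball _ _).inter (convex_ball _ _)).isPreconnected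
    exact mem_ball_zero_iff.2 (norm_sub_mul_add_lt_one hζ hw1 ht)

theorem ball_diff_sphere_eq (ζ : ℂ) (r : ℝ) : Metric.ball (0 : ℂ) 1 \ Metric.sphere ζ r =
    (Metric.ball (0 : ℂ) 1 ∩ Metric.ball ζ r) ∪
      (Metric.ball (0 : ℂ) 1 \ Metric.closedBall ζ r) := by
  ext x
  simp only [Set.mem_sdiff, mem_union, mem_inter_iff, Metric.mem_sphere, Metric.mem_ball,
    Metric.mem_closedBall, not_le]
  constructor
  · rintro ⟨h1, h2⟩
    rcases lt_or_gt_of_ne h2 with h3 | h3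
    exacts [Or.inl ⟨h1, h3⟩, Or.inr ⟨h1, h3⟩]
  · rintro (⟨h1, h2⟩ | ⟨h1, h2⟩)
    exacts [⟨h1, h2.ne⟩, ⟨h1, h2.ne'⟩]

namespace IsRiemannMap

variable {V : Set ℂ} {φ ψ : ℂ → ℂ}

theorem isOpen_image (h : IsRiemannMap V φ ψ) {S : Set ℂ} (hS : IsOpen S)
    (hSb : S ⊆ Metric.ball 0 1) : IsOpen (φ '' S) := by
  have : φ '' S = V ∩ ψ ⁻¹' S := by
    ext v
    constructor
    · rintro ⟨w, hw, rfl⟩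
      refine ⟨h.mapsTo (hSb hw), ?_⟩
      rw [mem_preimage, h.left_inv w (hSb hw)]
      exact hw
    · rintro ⟨hv, hv'⟩
      exact ⟨ψ v, hv', h.right_inv v hv⟩
  rw [this]
  exact h.diff_inv.continuousOn.isOpen_inter_preimage h.isOpen hS

theorem isConnected_image (h : IsRiemannMap V φ ψ) {S : Set ℂ} (hS : IsConnected S)
    (hSb : S ⊆ Metric.ball 0 1) : IsConnected (φ '' S) :=
  hS.image _ (h.diff.continuousOn.mono hSb)

/-- The image under `φ` of the part of the disk cut off by a circle around `ζ`. -/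
theorem hasTwoComps_arc (h : IsRiemannMap V φ ψ) {ζ : ℂ} (hζ : ‖ζ‖ = 1) {r : ℝ} (hr : 0 < r)
    (hr1 : r < 1) : HasTwoComps (V \ φ '' (Metric.sphere ζ r ∩ Metric.ball 0 1))
      (φ '' (Metric.ball 0 1 ∩ Metric.ball ζ r))
      (φ '' (Metric.ball 0 1 \ Metric.closedBall ζ r)) := by
  have h1 : V \ φ '' (Metric.sphere ζ r ∩ Metric.ball 0 1) =
      φ '' (Metric.ball 0 1 ∩ Metric.ball ζ r) ∪
        φ '' (Metric.ball 0 1 \ Metric.closedBall ζ r) := by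
    rw [← image_union, ← ball_diff_sphere_eq, ← h.image_ball,
      ← h.injOn.image_sdiff_subset inter_subset_right]
    congr 1
    ext x
    simp only [Set.mem_sdiff, mem_inter_iff]
    tauto
  rw [h1]
  refine hasTwoComps_union (h.isOpen_image (Metric.isOpen_ball.inter Metric.isOpen_ball)
    inter_subset_left) (h.isOpen_image (Metric.isOpen_ball.sdiff Metric.isClosed_closedBall)
    sdiff_subset) (h.isConnected_image (isConnected_ball_inter_ball hζ hr hr1) inter_subset_left)
    (h.isConnected_image (isConnected_ball_diff_closedBall hζ hr1) sdiff_subset) ?_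
  rw [disjoint_left]
  rintro _ ⟨x, hx, rfl⟩ ⟨y, hy, hxy⟩
  rw [h.injOn hy.1 hx.1 hxy] at hy
  exact hy.2 (Metric.ball_subset_closedBall hx.2)

theorem bdIn_arc (h : IsRiemannMap V φ ψ) {ζ : ℂ} {r : ℝ} (hr : 0 < r) :
    bdIn V (φ '' (Metric.ball 0 1 ∩ Metric.ball ζ r)) =
      φ '' (Metric.sphere ζ r ∩ Metric.ball 0 1) := by
  ext v
  constructor
  · rintro ⟨⟨hcl, hnot⟩, hv⟩
    obtain ⟨w, hw, rfl⟩ : v ∈ φ '' Metric.ball 0 1 := by rwa [h.image_ball]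
    refine ⟨w, ⟨le_antisymm ?_ ?_, hw⟩, rfl⟩
    · by_contra! hlt
      have hop := h.isOpen_image (S := Metric.ball 0 1 \ Metric.closedBall ζ r)
        (Metric.isOpen_ball.sdiff Metric.isClosed_closedBall) sdiff_subset
      obtain ⟨_, ⟨y, hy, hxy⟩, x, hx, rfl⟩ := mem_closure_iff.1 hcl _ hop
        ⟨w, ⟨hw, fun h' => hlt.not_ge (Metric.mem_closedBall.1 h')⟩, rfl⟩
      rw [h.injOn hy.1 hx.1 hxy] at hy
      exact hy.2 (Metric.ball_subset_closedBall hx.2)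
    · by_contra! hlt
      exact hnot ⟨w, ⟨hw, hlt⟩, rfl⟩
  · rintro ⟨w, ⟨hw1, hw⟩, rfl⟩
    refine ⟨⟨?_, ?_⟩, h.mapsTo hw⟩
    · refine mem_closure_image
        (h.diff.continuousOn.continuousAt (Metric.isOpen_ball.mem_nhds hw)) ?_
      have h1 : w ∈ closure (Metric.ball ζ r) := by
        rw [closure_ball _ hr.ne']
        exact Metric.sphere_subset_closedBall hw1
      exact Metric.isOpen_ball.inter_closure ⟨hw, h1⟩
    · rintro ⟨w', hw', e⟩
      rw [h.injOn hw'.1 hw e] at hw'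
      exact hw'.2.ne hw1

end IsRiemannMap

theorem injOn_arcPt {ζ : ℂ} (hζ : ‖ζ‖ = 1) {r : ℝ} (hr : 0 < r) :
    InjOn (arcPt ζ r) (Ioo (-arcAngle r) (arcAngle r)) := by
  intro s hs t ht hst
  have hζ0 : ζ ≠ 0 := norm_ne_zero_iff.1 (by rw [hζ]; exact one_ne_zero)
  have h3 := mul_left_cancel₀ hζ0 hst
  have h4 := mul_left_cancel₀ (Complex.ofReal_ne_zero.2 hr.ne') (sub_right_injective h3)
  have hpi : arcAngle r < Real.pi := arcAngle_lt_pi hr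
  have h5 : ∀ t ∈ Ioo (-arcAngle r) (arcAngle r), Complex.arg (Complex.exp (t * Complex.I)) = t := by
    intro t ht
    rw [Complex.exp_mul_I]
    exact Complex.arg_cos_add_sin_mul_I ⟨by linarith [ht.1], by linarith [ht.2]⟩
  rw [← h5 s hs, ← h5 t ht, h4]

namespace IsCrosscutSeq

variable {V : Set ℂ} {φ ψ : ℂ → ℂ} {ζ : ℂ} {r : ℕ → ℝ} {p q : ℕ → ℂ}

theorem exists_param (hc : IsCrosscutSeq V φ ζ r p q) (h : IsRiemannMap V φ ψ) (hζ : ‖ζ‖ = 1)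
    (n : ℕ) : ∃ g : ℝ → ℂ, ContinuousOn g (Icc 0 1) ∧ InjOn g (Ioo 0 1) ∧ g 0 = p n ∧
      g 1 = q n ∧ g '' Ioo 0 1 = φ '' (Metric.sphere ζ (r n) ∩ Metric.ball 0 1) := by
  set α := arcAngle (r n)
  have hα : 0 < α := arcAngle_pos (hc.lt_one n)
  have hr := hc.pos n
  have hr1 := hc.lt_one n
  have hmaps : ∀ t ∈ Ioo (0 : ℝ) 1, α * (2 * t - 1) ∈ Ioo (-α) α := fun t ht =>
    ⟨by nlinarith [ht.1], by nlinarith [ht.2]⟩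
  set k : ℝ → ℂ := fun t => φ (arcPt ζ (r n) (α * (2 * t - 1)))
  have hkc : ContinuousOn k (Ioo 0 1) :=
    h.diff.continuousOn.comp ((continuous_arcPt ζ (r n)).comp (by fun_prop)).continuousOn
      fun t ht => arcPt_mem_ball hζ hr hr1 (hmaps t ht)
  have hkeq : ∀ t ∈ Ioo (0 : ℝ) 1, extendFrom (Ioo 0 1) k t = k t := fun t ht =>
    extendFrom_eq (subset_closure ht) (hkc t ht)
  have hl : Tendsto k (𝓝[>] 0) (𝓝 (p n)) := by
    refine (hc.tendsto_left n).comp (tendsto_nhdsWithin_iff.2 ⟨?_, ?_⟩)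
    · refine Tendsto.mono_left ?_ nhdsWithin_le_nhds
      have : Continuous fun t : ℝ => α * (2 * t - 1) := by fun_prop
      simpa using this.tendsto 0
    · filter_upwards [Ioo_mem_nhdsGT one_pos] with t ht using (hmaps t ht).1
  have hr' : Tendsto k (𝓝[<] 1) (𝓝 (q n)) := by
    refine (hc.tendsto_right n).comp (tendsto_nhdsWithin_iff.2 ⟨?_, ?_⟩)
    · refine Tendsto.mono_left ?_ nhdsWithin_le_nhds
      have : Continuous fun t : ℝ => α * (2 * t - 1) := by fun_prop
      have h1 := this.tendsto 1
      norm_num at h1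
      exact h1
    · filter_upwards [Ioo_mem_nhdsLT (zero_lt_one' ℝ)] with t ht using (hmaps t ht).2
  have him : k '' Ioo 0 1 = φ '' (Metric.sphere ζ (r n) ∩ Metric.ball 0 1) := by
    rw [← image_arcPt hζ hr hr1, image_image]
    ext v
    constructor
    · rintro ⟨t, ht, rfl⟩
      exact ⟨_, hmaps t ht, rfl⟩
    · rintro ⟨θ, hθ, rfl⟩
      have hθ' : θ ∈ Ioo (-α) α := hθ
      refine ⟨(θ / α + 1) / 2, ⟨?_, ?_⟩, ?_⟩
      · have : -1 < θ / α := by rw [lt_div_iff₀ hα]; linarith [hθ'.1]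
        linarith
      · have : θ / α < 1 := by rw [div_lt_iff₀ hα]; linarith [hθ'.2]
        linarith
      · simp only [k]
        congr 2
        field_simp
        ring
  refine ⟨extendFrom (Ioo 0 1) k, continuousOn_Icc_extendFrom_Ioo hkc hl hr', ?_,
    eq_lim_at_left_extendFrom_Ioo one_pos hl, eq_lim_at_right_extendFrom_Ioo one_pos hr', ?_⟩
  · intro s hs t ht hst
    rw [hkeq s hs, hkeq t ht] at hst
    have h1 := h.injOn (arcPt_mem_ball hζ hr hr1 (hmaps s hs))
      (arcPt_mem_ball hζ hr hr1 (hmaps t ht)) hst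
    have h2 := injOn_arcPt hζ hr (hmaps s hs) (hmaps t ht) h1
    have h6 := mul_left_cancel₀ hα.ne' h2
    linarith
  · rw [image_congr hkeq, him]

theorem Icc_eq_insert_insert_Ioo : Icc (0 : ℝ) 1 = insert 0 (insert 1 (Ioo 0 1)) := by
  rw [insert_comm, Ioo_insert_left one_pos, Ico_insert_right zero_le_one]

/-- The closed arc consisting of the `n`-th cross-cut and its end points. -/
def closedArc (φ : ℂ → ℂ) (ζ : ℂ) (r : ℕ → ℝ) (p q : ℕ → ℂ) (n : ℕ) : Set ℂ :=
  φ '' (Metric.sphere ζ (r n) ∩ Metric.ball 0 1) ∪ {p n, q n}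

theorem image_Icc_eq_closedArc {n : ℕ} {g : ℝ → ℂ} (h0 : g 0 = p n) (h1 : g 1 = q n)
    (hg : g '' Ioo 0 1 = φ '' (Metric.sphere ζ (r n) ∩ Metric.ball 0 1)) :
    g '' Icc 0 1 = closedArc φ ζ r p q n := by
  rw [Icc_eq_insert_insert_Ioo, image_insert_eq, image_insert_eq, h0, h1, hg, closedArc,
    union_comm, insert_union, singleton_union]

theorem isCompact_closedArc (hc : IsCrosscutSeq V φ ζ r p q) (h : IsRiemannMap V φ ψ)
    (hζ : ‖ζ‖ = 1) (n : ℕ) : IsCompact (closedArc φ ζ r p q n) := by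
  obtain ⟨g, hgc, -, h0, h1, hg⟩ := hc.exists_param h hζ n
  rw [← image_Icc_eq_closedArc h0 h1 hg]
  exact isCompact_Icc.image_of_continuousOn hgc

theorem disjoint_closedArc (hc : IsCrosscutSeq V φ ζ r p q) (h : IsRiemannMap V φ ψ)
    {m n : ℕ} (hmn : m ≠ n) : Disjoint (closedArc φ ζ r p q m) (closedArc φ ζ r p q n) := by
  have hV : ∀ x ∈ frontier V, x ∉ V := fun x hx => by
    rw [h.isOpen.frontier_eq] at hx; exact hx.2
  have key : ∀ m n, Disjoint (φ '' (Metric.sphere ζ (r m) ∩ Metric.ball 0 1)) {p n, q n} := by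
    intro m n
    rw [disjoint_left]
    rintro _ ⟨w, hw, rfl⟩ (e | e)
    · exact hV _ (hc.left_mem n) (e ▸ h.mapsTo hw.2)
    · exact hV _ (hc.right_mem n) (e ▸ h.mapsTo hw.2)
  unfold closedArc
  rw [disjoint_union_left, disjoint_union_right, disjoint_union_right]
  refine ⟨⟨?_, key m n⟩, (key n m).symm, hc.disjoint m n hmn⟩
  rw [disjoint_left]
  rintro _ ⟨w, hw, rfl⟩ ⟨w', hw', e⟩
  rw [h.injOn hw'.2 hw.2 e] at hw'
  have h1 : r m = r n := by rw [← Metric.mem_sphere.1 hw.1, Metric.mem_sphere.1 hw'.1]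
  rcases hmn.lt_or_gt with hlt | hlt
  · exact (hc.anti _ _ hlt).ne h1.symm
  · exact (hc.anti _ _ hlt).ne h1

theorem left_mem_closure (hc : IsCrosscutSeq V φ ζ r p q) (hζ : ‖ζ‖ = 1) {S : Set ℂ} (n : ℕ)
    (hS : Metric.sphere ζ (r n) ∩ Metric.ball 0 1 ⊆ S) : p n ∈ closure (φ '' S) := by
  refine mem_closure_of_tendsto (hc.tendsto_left n) ?_
  have hα := arcAngle_pos (hc.lt_one n)
  filter_upwards [Ioo_mem_nhdsGT (show -arcAngle (r n) < arcAngle (r n) by linarith)] with θ hθ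
  refine mem_image_of_mem φ (hS ?_)
  rw [← image_arcPt hζ (hc.pos n) (hc.lt_one n)]
  exact mem_image_of_mem _ hθ

theorem left_mem_frontier (hc : IsCrosscutSeq V φ ζ r p q) (h : IsRiemannMap V φ ψ) (hζ : ‖ζ‖ = 1)
    {S : Set ℂ} (hSo : IsOpen S) (hSb : S ⊆ Metric.ball 0 1) {m n : ℕ} (hmn : m ≠ n)
    (hS : Metric.sphere ζ (r n) ∩ Metric.ball 0 1 ⊆ S) :
    p n ∈ frontier (φ '' S) ∩ (frontier V \ closedArc φ ζ r p q m) := by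
  have hV : p n ∉ V := by
    have := hc.left_mem n
    rw [h.isOpen.frontier_eq] at this
    exact this.2
  refine ⟨?_, hc.left_mem n,
    disjoint_right.1 (hc.disjoint_closedArc h hmn) (Or.inr (Or.inl rfl))⟩
  rw [(h.isOpen_image hSo hSb).frontier_eq]
  exact ⟨hc.left_mem_closure hζ n hS, fun h' => hV ((h.mapsTo.mono_left hSb).image_subset h')⟩

theorem isCrossCut (hc : IsCrosscutSeq V φ ζ r p q) (h : IsRiemannMap V φ ψ) (hζ : ‖ζ‖ = 1)
    (n : ℕ) : IsCrossCut V (φ '' (Metric.sphere ζ (r (n + 1)) ∩ Metric.ball 0 1)) := by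
  obtain ⟨g, hgc, hgi, h0, h1, hg⟩ := hc.exists_param h hζ (n + 1)
  refine ⟨g, hgc, hgi, fun t ht => ?_, h0 ▸ hc.left_mem _, h1 ▸ hc.right_mem _, hg.symm, _, _,
    h.hasTwoComps_arc hζ (hc.pos _) (hc.lt_one _), ⟨p (n + 2), ?_⟩, ⟨p n, ?_⟩⟩
  · have h2 := mem_image_of_mem g ht
    rw [hg] at h2
    exact (h.mapsTo.mono_left inter_subset_right).image_subset h2
  · rw [image_Icc_eq_closedArc h0 h1 hg]
    refine hc.left_mem_frontier h hζ (Metric.isOpen_ball.inter Metric.isOpen_ball)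
      inter_subset_left (by omega) fun x hx => ⟨hx.2, ?_⟩
    rw [Metric.mem_ball, Metric.mem_sphere.1 hx.1]
    exact hc.anti _ _ (by omega)
  · rw [image_Icc_eq_closedArc h0 h1 hg]
    refine hc.left_mem_frontier h hζ (Metric.isOpen_ball.sdiff Metric.isClosed_closedBall)
      sdiff_subset (by omega) fun x hx => ⟨hx.2, ?_⟩
    rw [Metric.mem_closedBall, Metric.mem_sphere.1 hx.1, not_le]
    exact hc.anti _ _ (by omega)

/-- The cross-sections cut off by a null sequence of cross-cuts form a prime chain. -/
theorem isPrimeChain (hc : IsCrosscutSeq V φ ζ r p q) (h : IsRiemannMap V φ ψ) (hζ : ‖ζ‖ = 1) :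
    IsPrimeChain V fun n => φ '' (Metric.ball 0 1 ∩ Metric.ball ζ (r (n + 1))) := by
  have hanti : Antitone r := antitone_nat_of_succ_le fun n => (hc.anti _ _ n.lt_succ_self).le
  have hsub : ∀ n, closure (φ '' (Metric.sphere ζ (r n) ∩ Metric.ball 0 1)) ⊆
      closedArc φ ζ r p q n := fun n =>
    closure_minimal subset_union_left (hc.isCompact_closedArc h hζ n).isClosed
  have hchain : IsPEChain V fun n => φ '' (Metric.ball 0 1 ∩ Metric.ball ζ (r (n + 1))) := by
    refine ⟨fun n => ⟨_, hc.isCrossCut h hζ n,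
      (h.hasTwoComps_arc hζ (hc.pos _) (hc.lt_one _)).1⟩, fun i j hij => ?_, fun i j hij => ?_⟩
    · exact image_mono (inter_subset_inter_right _ (Metric.ball_subset_ball (hanti (by omega))))
    · simp only [h.bdIn_arc (hc.pos _)]
      rw [← disjoint_iff_inter_eq_empty]
      exact (hc.disjoint_closedArc h (by omega)).mono (hsub _) (hsub _)
  refine hchain.isPrimeChain_of_isNullSeq h.isOpen (fun n => ?_) ?_ fun x hx => ?_
  · simp only [h.bdIn_arc (hc.pos _)]
    rw [← image_arcPt hζ (hc.pos _) (hc.lt_one _)]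
    refine (isPreconnected_Ioo.image _ (continuous_arcPt ζ _).continuousOn).image _
      (h.diff.continuousOn.mono ?_)
    rw [image_arcPt hζ (hc.pos _) (hc.lt_one _)]
    exact inter_subset_right
  · simp only [h.bdIn_arc (hc.pos _)]
    exact fun A B hA hB hAB => (tendsto_add_atTop_nat 1).eventually (hc.null A B hA hB hAB)
  · obtain ⟨w, hw, rfl⟩ : x ∈ φ '' Metric.ball 0 1 := by rwa [h.image_ball]
    have hwζ : 0 < dist w ζ := by
      refine dist_pos.2 fun e => ?_
      rw [e, mem_ball_zero_iff, hζ] at hw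
      exact lt_irrefl _ hw
    obtain ⟨n, hn⟩ := ((hc.tendsto_zero.comp (tendsto_add_atTop_nat 1)).eventually_lt_const
      hwζ).exists
    refine ⟨n, ?_⟩
    rintro ⟨w', hw', e⟩
    rw [h.injOn hw'.1 hw e] at hw'
    exact lt_asymm hn hw'.2

end IsCrosscutSeq

theorem ContinuousOn.dist_const {Y : Type*} [TopologicalSpace Y] {S : Set Y} {f : Y → ℂ}
    (hf : ContinuousOn f S) (c : ℂ) : ContinuousOn (fun y => dist (f y) c) S :=
  continuous_dist.comp_continuousOn (hf.prodMk continuousOn_const)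

theorem IsPreconnected.exists_eq_of_le_of_le {Y : Type*} [TopologicalSpace Y] {S : Set Y}
    (hS : IsPreconnected S) {d : Y → ℝ} (hd : ContinuousOn d S) {x y : Y} (hx : x ∈ S) (hy : y ∈ S)
    {a : ℝ} (hxa : d x ≤ a) (hay : a ≤ d y) : ∃ s ∈ S, d s = a :=
  hS.intermediate_value hx hy hd ⟨hxa, hay⟩

theorem IsCrosscutSeq.mem_closedArc {φ : ℂ → ℂ} {ζ : ℂ} {r : ℕ → ℝ} {p q : ℕ → ℂ} {n : ℕ}
    {w : ℂ} (hw : w ∈ Metric.ball 0 1) (hwr : dist w ζ = r n) :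
    φ w ∈ closedArc φ ζ r p q n :=
  Or.inl ⟨w, ⟨hwr, hw⟩, rfl⟩

namespace IsRiemannMap

variable {V : Set ℂ} {φ ψ : ℂ → ℂ}

/-- The preimage under a Riemann map of a curve ending at a boundary point ends at a point of the
unit circle. -/
theorem exists_tendsto_comp_curve (h : IsRiemannMap V φ ψ) (hV : V ≠ univ) {c : ℝ → ℂ}
    (hc : ContinuousOn c (Ico 0 1)) (hcV : MapsTo c (Ico 0 1) V) {p : ℂ} (hp : p ∉ V)
    (hcp : Tendsto c (𝓝[<] 1) (𝓝 p)) :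
    ∃ ξ : ℂ, ‖ξ‖ = 1 ∧ Tendsto (fun t => ψ (c t)) (𝓝[<] 1) (𝓝 ξ) := by
  have hIco : ∀ᶠ t : ℝ in 𝓝[<] 1, t ∈ Ico (0 : ℝ) 1 := Ico_mem_nhdsLT one_pos
  have hw : ∀ t ∈ Ico (0 : ℝ) 1, ψ (c t) ∈ Metric.ball (0 : ℂ) 1 := fun t ht => h.mapsTo_inv (hcV ht)
  obtain ⟨ξ, hξ, hcl⟩ := (isCompact_closedBall (0 : ℂ) 1).exists_mapClusterPt_of_frequently
    (l := 𝓝[<] (1 : ℝ)) (f := fun t => ψ (c t))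
    (hIco.mono fun t ht => Metric.ball_subset_closedBall (hw t ht)).frequently
  have hξ1 : ‖ξ‖ = 1 := by
    refine le_antisymm (mem_closedBall_zero_iff.1 hξ) (not_lt.1 fun hlt => hp ?_)
    have hξb : ξ ∈ Metric.ball (0 : ℂ) 1 := mem_ball_zero_iff.2 hlt
    have h1 : MapClusterPt (φ ξ) (𝓝[<] (1 : ℝ)) fun t => φ (ψ (c t)) :=
      hcl.continuousAt_comp
        (h.diff.continuousOn.continuousAt (Metric.isOpen_ball.mem_nhds hξb))
    have h2 : Tendsto (fun t => φ (ψ (c t))) (𝓝[<] (1 : ℝ)) (𝓝 p) :=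
      hcp.congr' (hIco.mono fun t ht => (h.right_inv _ (hcV ht)).symm)
    have h3 : φ ξ = p := by
      have := h1.clusterPt.mono h2
      exact eq_of_nhds_neBot this
    exact h3 ▸ h.mapsTo hξb
  refine ⟨ξ, hξ1, ?_⟩
  obtain ⟨r, a, b, hcs⟩ := h.exists_isCrosscutSeq hV hξ1
  rw [Metric.tendsto_nhds]
  intro ε hε
  obtain ⟨n, hnε, hnp⟩ : ∃ n, r n < ε ∧ p ∉ IsCrosscutSeq.closedArc φ ξ r a b n := by
    obtain ⟨n, hn⟩ := (hcs.tendsto_zero.eventually_lt_const hε).exists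
    by_cases hpn : p ∈ IsCrosscutSeq.closedArc φ ξ r a b n
    · exact ⟨n + 1, (hcs.anti _ _ n.lt_succ_self).trans hn, fun hp' =>
        disjoint_left.1 (hcs.disjoint_closedArc h (by omega)) hpn hp'⟩
    · exact ⟨n, hn, hpn⟩
  have hev : ∀ᶠ t in 𝓝[<] (1 : ℝ), c t ∉ IsCrosscutSeq.closedArc φ ξ r a b n :=
    hcp.eventually ((hcs.isCompact_closedArc h hξ1 n).isClosed.isOpen_compl.mem_nhds hnp)
  obtain ⟨t₀, ht₀, hsub⟩ := mem_nhdsLT_iff_exists_Ioo_subset.1 (hev.and hIco)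
  have hconn : IsPreconnected (Ioo t₀ 1) := isPreconnected_Ioo
  have hcont : ContinuousOn (fun t => dist (ψ (c t)) ξ) (Ioo t₀ 1) :=
    ((h.diff_inv.continuousOn.comp hc hcV).mono fun t ht => (hsub ht).2).dist_const _
  have hIoo : ∀ᶠ t in 𝓝[<] (1 : ℝ), t ∈ Ioo t₀ 1 := Ioo_mem_nhdsLT ht₀
  obtain ⟨s, hs, hsr⟩ : ∃ s ∈ Ioo t₀ 1, dist (ψ (c s)) ξ < r n :=
    ((hcl.frequently (Metric.ball_mem_nhds ξ (hcs.pos n))).and_eventually hIoo).exists.imp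
      fun s hs => ⟨hs.2, hs.1⟩
  filter_upwards [hIoo] with t ht
  refine lt_trans (not_le.1 fun hle => ?_) hnε
  obtain ⟨x, hx, hxr⟩ := hconn.exists_eq_of_le_of_le hcont hs ht hsr.le hle
  apply (hsub hx).1
  rw [← h.right_inv _ (hcV (hsub hx).2)]
  exact IsCrosscutSeq.mem_closedArc (hw x (hsub hx).2) hxr

/-- Two curves in the disc with the same end point have the same limit under a Riemann map, if
the limits exist. -/
theorem tendsto_unique_of_curves (h : IsRiemannMap V φ ψ) (hV : V ≠ univ) {ζ : ℂ} (hζ : ‖ζ‖ = 1)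
    {w : Fin 2 → ℝ → ℂ} {p : Fin 2 → ℂ} (hw : ∀ i, ContinuousOn (w i) (Ico 0 1))
    (hwb : ∀ i, MapsTo (w i) (Ico 0 1) (Metric.ball 0 1))
    (hwζ : ∀ i, Tendsto (w i) (𝓝[<] 1) (𝓝 ζ))
    (hp : ∀ i, Tendsto (fun t => φ (w i t)) (𝓝[<] 1) (𝓝 (p i))) : p 0 = p 1 := by
  by_contra hne
  obtain ⟨r, a, b, hcs⟩ := h.exists_isCrosscutSeq hV hζ
  have hd : 0 < dist (p 0) (p 1) / 3 := by have := dist_pos.2 hne; linarith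
  set ε := dist (p 0) (p 1) / 3 with hε
  have hdis : Disjoint (Metric.closedBall (p 0) ε) (Metric.closedBall (p 1) ε) := by
    refine Metric.closedBall_disjoint_closedBall ?_
    linarith
  have key : ∀ i, ∀ᶠ n in atTop,
      ((φ '' (Metric.sphere ζ (r n) ∩ Metric.ball 0 1)) ∩ Metric.closedBall (p i) ε).Nonempty := by
    intro i
    have hIco : ∀ᶠ t : ℝ in 𝓝[<] 1, t ∈ Ico (0 : ℝ) 1 := Ico_mem_nhdsLT one_pos
    obtain ⟨t₀, ht₀, hsub⟩ := mem_nhdsLT_iff_exists_Ioo_subset.1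
      (((hp i).eventually (Metric.closedBall_mem_nhds _ hd)).and hIco)
    have ht₀' : t₀ < 1 := ht₀
    obtain ⟨t₁, ht₁⟩ : (Ioo t₀ 1).Nonempty := nonempty_Ioo.2 ht₀'
    have hpos : 0 < dist (w i t₁) ζ := by
      refine dist_pos.2 fun e => ?_
      have := hwb i (hsub ht₁).2
      rw [e, mem_ball_zero_iff, hζ] at this
      exact lt_irrefl _ this
    filter_upwards [hcs.tendsto_zero.eventually_lt_const hpos] with n hn
    obtain ⟨t₂, ht₂, ht₂r⟩ : ∃ t ∈ Ioo t₀ 1, dist (w i t) ζ < r n :=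
      (((hwζ i).eventually (Metric.ball_mem_nhds ζ (hcs.pos n))).and
        (Ioo_mem_nhdsLT ht₀ : ∀ᶠ t in 𝓝[<] (1 : ℝ), t ∈ Ioo t₀ 1)).exists.imp
          fun s hs => ⟨hs.2, hs.1⟩
    obtain ⟨x, hx, hxr⟩ := isPreconnected_Ioo.exists_eq_of_le_of_le
      (((hw i).mono fun t ht => (hsub ht).2).dist_const _) ht₂ ht₁ ht₂r.le hn.le
    exact ⟨φ (w i x), ⟨_, ⟨hxr, hwb i (hsub hx).2⟩, rfl⟩, (hsub hx).1⟩
  obtain ⟨n, hn, h0, h1⟩ := ((hcs.null _ _ (isCompact_closedBall _ _) (isCompact_closedBall _ _)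
    hdis).and ((key 0).and (key 1))).exists
  exact hn ⟨h0, h1⟩

/-- The self-map of the disc conjugate to `g`. -/
def _root_.discConj (φ ψ : ℂ → ℂ) (g : ℂ → ℂ) (w : ℂ) : ℂ := ψ (g (φ w))

variable {g : ℂ ≃ₜ ℂ}

theorem symm_image_eq (hg : g '' V = V) : g.symm '' V = V := by
  conv_lhs => rw [← hg, ← image_comp]
  simp

theorem discConj_mapsTo (h : IsRiemannMap V φ ψ) (hg : g '' V = V) :
    MapsTo (discConj φ ψ g) (Metric.ball 0 1) (Metric.ball 0 1) := fun _ hw =>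
  h.mapsTo_inv (hg ▸ mem_image_of_mem g (h.mapsTo hw))

theorem continuousOn_discConj (h : IsRiemannMap V φ ψ) (hg : g '' V = V) :
    ContinuousOn (discConj φ ψ g) (Metric.ball 0 1) :=
  h.diff_inv.continuousOn.comp (g.continuous.comp_continuousOn h.diff.continuousOn)
    fun _ hw => hg ▸ mem_image_of_mem g (h.mapsTo hw)

theorem map_discConj (h : IsRiemannMap V φ ψ) (hg : g '' V = V) {w : ℂ}
    (hw : w ∈ Metric.ball 0 1) : φ (discConj φ ψ g w) = g (φ w) :=
  h.right_inv _ (hg ▸ mem_image_of_mem g (h.mapsTo hw))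

theorem discConj_symm_discConj (h : IsRiemannMap V φ ψ) (hg : g '' V = V) {w : ℂ}
    (hw : w ∈ Metric.ball 0 1) : discConj φ ψ g.symm (discConj φ ψ g w) = w := by
  rw [discConj, h.map_discConj hg hw, g.symm_apply_apply, h.left_inv w hw]

theorem discConj_discConj_symm (h : IsRiemannMap V φ ψ) (hg : g '' V = V) {w : ℂ}
    (hw : w ∈ Metric.ball 0 1) : discConj φ ψ g (discConj φ ψ g.symm w) = w :=
  h.discConj_symm_discConj (g := g.symm) (symm_image_eq hg) hw

/-- The conjugate of a homeomorphism by a Riemann map has limits at all points of the circle. -/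
theorem exists_tendsto_discConj (h : IsRiemannMap V φ ψ) (hV : V ≠ univ) (hg : g '' V = V)
    {ζ : ℂ} (hζ : ‖ζ‖ = 1) :
    ∃ u : ℂ, ‖u‖ = 1 ∧ Tendsto (discConj φ ψ g) (𝓝[Metric.ball 0 1] ζ) (𝓝 u) := by
  obtain ⟨r, a, b, hcs⟩ := h.exists_isCrosscutSeq hV hζ
  set G := discConj φ ψ g
  set G' := discConj φ ψ g.symm
  have hg' := symm_image_eq hg
  have hGG' : ∀ w ∈ Metric.ball (0 : ℂ) 1, G (G' w) = w := fun w hw =>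
    h.discConj_discConj_symm hg hw
  have hG'G : ∀ w ∈ Metric.ball (0 : ℂ) 1, G' (G w) = w := fun w hw =>
    h.discConj_symm_discConj hg hw
  set C : ℕ → Set ℂ := fun n => Metric.sphere ζ (r n) ∩ Metric.ball 0 1
  have hm : ∀ n, arcPt ζ (r n) 0 ∈ C n := fun n => by
    have hα := arcAngle_pos (hcs.lt_one n)
    simp only [C]
    rw [← image_arcPt hζ (hcs.pos n) (hcs.lt_one n)]
    exact mem_image_of_mem _ ⟨by linarith, hα⟩
  have hCconn : ∀ n, IsPreconnected (C n) := fun n => by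
    simp only [C]
    rw [← image_arcPt hζ (hcs.pos n) (hcs.lt_one n)]
    exact isPreconnected_Ioo.image _ (continuous_arcPt ζ _).continuousOn
  have hmζ : Tendsto (fun n => arcPt ζ (r n) 0) atTop (𝓝 ζ) := by
    rw [tendsto_iff_dist_tendsto_zero]
    exact hcs.tendsto_zero.congr fun n => ((hm n).1 : dist _ _ = _).symm
  obtain ⟨u, hu, hcl⟩ := (isCompact_closedBall (0 : ℂ) 1).exists_mapClusterPt_of_frequently
    (l := atTop) (f := fun n => G (arcPt ζ (r n) 0)) (Eventually.frequently
      (.of_forall fun n => Metric.ball_subset_closedBall (h.discConj_mapsTo hg (hm n).2)))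
  have hu1 : ‖u‖ = 1 := by
    refine le_antisymm (mem_closedBall_zero_iff.1 hu) (not_lt.1 fun hlt => ?_)
    have hub : u ∈ Metric.ball (0 : ℂ) 1 := mem_ball_zero_iff.2 hlt
    have h1 : MapClusterPt (G' u) atTop fun n => G' (G (arcPt ζ (r n) 0)) :=
      hcl.continuousAt_comp
        ((h.continuousOn_discConj hg').continuousAt (Metric.isOpen_ball.mem_nhds hub))
    have h2 : Tendsto (fun n => G' (G (arcPt ζ (r n) 0))) atTop (𝓝 ζ) :=
      hmζ.congr fun n => (hG'G _ (hm n).2).symm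
    have h3 : G' u = ζ := eq_of_nhds_neBot (h1.clusterPt.mono h2)
    have h4 := h.discConj_mapsTo hg' hub
    rw [show discConj φ ψ g.symm u = ζ from h3, mem_ball_zero_iff, hζ] at h4
    exact lt_irrefl _ h4
  refine ⟨u, hu1, ?_⟩
  obtain ⟨s, a', b', hcu⟩ := h.exists_isCrosscutSeq hV hu1
  rw [Metric.tendsto_nhds]
  intro ε hε
  obtain ⟨k, hk⟩ := (hcu.tendsto_zero.eventually_lt_const hε).exists
  have hnull : IsNullSeq fun n => g '' (φ '' C n) := hcs.null.image g
  have hG0 : 0 < dist (G' 0) ζ := by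
    refine dist_pos.2 fun e => ?_
    have h4 := h.discConj_mapsTo hg' (Metric.mem_ball_self one_pos)
    rw [show discConj φ ψ g.symm 0 = ζ from e, mem_ball_zero_iff, hζ] at h4
    exact lt_irrefl _ h4
  obtain ⟨n, ⟨hnm, hnn⟩, hn0⟩ := ((hcl.frequently (Metric.ball_mem_nhds u
    (hcu.pos (k + 1)))).and_eventually (hnull _ _ (hcu.isCompact_closedArc h hu1 (k + 1))
      (hcu.isCompact_closedArc h hu1 k) (hcu.disjoint_closedArc h (by omega)))).and_eventually
      (hcs.tendsto_zero.eventually_lt_const hG0) |>.exists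
  have hsk : s (k + 1) < s k := hcu.anti _ _ k.lt_succ_self
  have hGC : ∀ w ∈ C n, dist (G w) u < s k := by
    intro w hw
    by_contra! hle
    have hcont : ContinuousOn (fun w => dist (G w) u) (C n) :=
      ((h.continuousOn_discConj hg).mono inter_subset_right).dist_const _
    have hnm' : dist (G (arcPt ζ (r n) 0)) u < s (k + 1) := hnm
    obtain ⟨x, hx, hxs⟩ := (hCconn n).exists_eq_of_le_of_le hcont (hm n) hw hnm'.le
      (hsk.le.trans hle)
    obtain ⟨y, hy, hys⟩ := (hCconn n).exists_eq_of_le_of_le hcont (hm n) hw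
      (hnm'.le.trans hsk.le) hle
    refine hnn ⟨⟨φ (G x), ?_, IsCrosscutSeq.mem_closedArc (h.discConj_mapsTo hg hx.2) hxs⟩,
      ⟨φ (G y), ?_, IsCrosscutSeq.mem_closedArc (h.discConj_mapsTo hg hy.2) hys⟩⟩
    · exact ⟨φ x, mem_image_of_mem _ hx, (h.map_discConj hg hx.2).symm⟩
    · exact ⟨φ y, mem_image_of_mem _ hy, (h.map_discConj hg hy.2).symm⟩
  have hE := (isConnected_ball_diff_closedBall hu1 (hcu.lt_one k)).isPreconnected
  have h0E : (0 : ℂ) ∈ Metric.ball (0 : ℂ) 1 \ Metric.closedBall u (s k) := by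
    refine ⟨Metric.mem_ball_self one_pos, ?_⟩
    rw [Metric.mem_closedBall, dist_zero_left, hu1, not_le]
    exact hcu.lt_one k
  filter_upwards [self_mem_nhdsWithin, mem_nhdsWithin_of_mem_nhds
    (Metric.ball_mem_nhds ζ (hcs.pos n))] with w hw hwr
  refine lt_of_le_of_lt (not_lt.1 fun hlt => ?_) hk
  have hGw : G w ∈ Metric.ball (0 : ℂ) 1 \ Metric.closedBall u (s k) :=
    ⟨h.discConj_mapsTo hg hw, fun hmem => not_lt.2 (Metric.mem_closedBall.1 hmem) hlt⟩
  have hcont : ContinuousOn (fun w => dist (G' w) ζ)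
      (Metric.ball (0 : ℂ) 1 \ Metric.closedBall u (s k)) :=
    ((h.continuousOn_discConj hg').mono sdiff_subset).dist_const _
  obtain ⟨x, hx, hxr⟩ := hE.exists_eq_of_le_of_le hcont hGw h0E
    (show dist (G' (G w)) ζ ≤ r n by rw [hG'G w hw]; exact (Metric.mem_ball.1 hwr).le) hn0.le
  have h5 := hGC (G' x) ⟨hxr, h.discConj_mapsTo hg' hx.1⟩
  rw [hGG' x hx.1] at h5
  exact hx.2 h5.le

/-- The conjugate of a homeomorphism by a Riemann map extends continuously to the closed disc. -/
theorem exists_discConj_extension (h : IsRiemannMap V φ ψ) (hV : V ≠ univ) (hg : g '' V = V) :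
    ∃ Γ : ℂ → ℂ, ContinuousOn Γ (Metric.closedBall 0 1) ∧ EqOn Γ (discConj φ ψ g) (Metric.ball 0 1) ∧
      (∀ ζ, ‖ζ‖ = 1 → ‖Γ ζ‖ = 1) ∧ MapsTo Γ (Metric.closedBall 0 1) (Metric.closedBall 0 1) := by
  have hcl : closure (Metric.ball (0 : ℂ) 1) = Metric.closedBall 0 1 :=
    closure_ball _ one_ne_zero
  have hin : ∀ w ∈ Metric.ball (0 : ℂ) 1, Tendsto (discConj φ ψ g) (𝓝[Metric.ball 0 1] w)
      (𝓝 (discConj φ ψ g w)) := h.continuousOn_discConj hg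
  have heq : EqOn (extendFrom (Metric.ball 0 1) (discConj φ ψ g)) (discConj φ ψ g)
      (Metric.ball 0 1) := fun w hw => extendFrom_eq (subset_closure hw) (hin w hw)
  have hbd : ∀ ζ : ℂ, ‖ζ‖ = 1 → ‖extendFrom (Metric.ball 0 1) (discConj φ ψ g) ζ‖ = 1 := by
    intro ζ hζ
    obtain ⟨u, hu, hlim⟩ := h.exists_tendsto_discConj hV hg hζ
    rw [extendFrom_eq (hcl ▸ mem_closedBall_zero_iff.2 hζ.le) hlim, hu]
  refine ⟨extendFrom (Metric.ball 0 1) (discConj φ ψ g), ?_, heq, hbd, fun w hw => ?_⟩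
  · refine continuousOn_extendFrom hcl.ge fun w hw => ?_
    rcases (mem_closedBall_zero_iff.1 hw).lt_or_eq with hlt | he
    · exact ⟨_, hin w (mem_ball_zero_iff.2 hlt)⟩
    · exact (h.exists_tendsto_discConj hV hg he).imp fun u hu => hu.2
  · rcases (mem_closedBall_zero_iff.1 hw).lt_or_eq with hlt | he
    · rw [heq (mem_ball_zero_iff.2 hlt)]
      exact Metric.ball_subset_closedBall (h.discConj_mapsTo hg (mem_ball_zero_iff.2 hlt))
    · exact mem_closedBall_zero_iff.2 (hbd w he).le

theorem injOn_of_eqOn_discConj (h : IsRiemannMap V φ ψ) (hV : V ≠ univ) (hg : g '' V = V)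
    {Γ : ℂ → ℂ} (hΓ : ContinuousOn Γ (Metric.closedBall 0 1))
    (hmaps : MapsTo Γ (Metric.closedBall 0 1) (Metric.closedBall 0 1))
    (heq : EqOn Γ (discConj φ ψ g) (Metric.ball 0 1)) : InjOn Γ (Metric.closedBall 0 1) := by
  obtain ⟨Γ', hΓ', heq', -, -⟩ := h.exists_discConj_extension hV (symm_image_eq hg)
  have hcl : closure (Metric.ball (0 : ℂ) 1) = Metric.closedBall 0 1 :=
    closure_ball _ one_ne_zero
  have key : EqOn (Γ' ∘ Γ) id (Metric.closedBall 0 1) := by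
    refine EqOn.of_subset_closure (s := Metric.ball 0 1) (fun w hw => ?_) (hΓ'.comp hΓ hmaps)
      continuousOn_id Metric.ball_subset_closedBall hcl.ge
    rw [Function.comp_apply, heq hw, heq' (h.discConj_mapsTo hg hw)]
    exact h.discConj_symm_discConj hg hw
  exact (LeftInvOn.injOn (f₁' := Γ') key)

/-- A fixed point on the circle of the extension yields an invariant prime chain. -/
theorem exists_isPrimeChain_chainDivides (h : IsRiemannMap V φ ψ) (hV : V ≠ univ) (hg : g '' V = V)
    {Γ : ℂ → ℂ} (hΓ : ContinuousOn Γ (Metric.closedBall 0 1))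
    (heq : EqOn Γ (discConj φ ψ g) (Metric.ball 0 1)) {ζ : ℂ} (hζ : ‖ζ‖ = 1) (hfix : Γ ζ = ζ) :
    ∃ C, IsPrimeChain V C ∧ ChainDivides (fun n => g '' C n) C := by
  obtain ⟨r, a, b, hcs⟩ := h.exists_isCrosscutSeq hV hζ
  refine ⟨_, hcs.isPrimeChain h hζ, fun n => ?_⟩
  have h1 : Tendsto Γ (𝓝[Metric.ball 0 1] ζ) (𝓝 ζ) := by
    have h2 : Tendsto Γ _ _ := hΓ ζ (mem_closedBall_zero_iff.2 hζ.le)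
    rw [hfix] at h2
    exact h2.mono_left (nhdsWithin_mono _ Metric.ball_subset_closedBall)
  have h2 := h1.eventually (Metric.ball_mem_nhds ζ (hcs.pos (n + 1)))
  rw [eventually_nhdsWithin_iff, Metric.eventually_nhds_iff] at h2
  obtain ⟨δ, hδ, h3⟩ := h2
  obtain ⟨m, hm⟩ := ((hcs.tendsto_zero.comp (tendsto_add_atTop_nat 1)).eventually_lt_const
    hδ).exists
  refine ⟨m, ?_⟩
  rintro _ ⟨_, ⟨w, hw, rfl⟩, rfl⟩
  refine ⟨discConj φ ψ g w, ⟨h.discConj_mapsTo hg hw.1, ?_⟩, h.map_discConj hg hw.1⟩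
  rw [← heq hw.1]
  exact h3 (lt_trans (Metric.mem_ball.1 hw.2) hm) hw.1

end IsRiemannMap

section ContinuousLog

variable {Y : Type*} [TopologicalSpace Y]

/-- Two continuous logarithms of functions with constant ratio differ by a constant. -/
theorem IsPreconnected.sub_eq_sub_of_exp_eq {S : Set Y} (hS : IsPreconnected S) {f g : Y → ℂ}
    (hf : ContinuousOn f S) (hg : ContinuousOn g S) {k : ℂ}
    (hfg : ∀ y ∈ S, Complex.exp (f y) = k * Complex.exp (g y)) {x y : Y} (hx : x ∈ S)
    (hy : y ∈ S) : f y - g y = f x - g x := by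
  have hk : ∀ y ∈ S, Complex.exp (f y - g y) = k := fun y hy => by
    rw [Complex.exp_sub, hfg y hy, mul_div_cancel_right₀ _ (Complex.exp_ne_zero _)]
  have := Complex.isCoveringMap_exp.eqOn_of_comp_eqOn hS (g₁ := fun y => f y - g y)
    (g₂ := fun _ => f x - g x) (hf.sub hg) continuousOn_const
    (fun y hy => Subtype.ext (by simp only [Function.comp_apply]; rw [hk y hy, hk x hx])) hx rfl
  exact this hy

theorem exists_continuous_exp_eq {E : Type*} [NormedAddCommGroup E] [NormedSpace ℝ E]
    {k : E → ℂ} (hk : Continuous k) (h0 : ∀ x, k x ≠ 0) :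
    ∃ l : E → ℂ, Continuous l ∧ ∀ x, Complex.exp (l x) = k x := by
  have hsc : IsSimplyConnected (univ : Set E) := by
    have : ContractibleSpace (univ : Set E) := convex_univ.contractibleSpace univ_nonempty
    exact (inferInstance : SimplyConnectedSpace (univ : Set E))
  obtain ⟨l, hl, hexp⟩ := Complex.exists_continuousOn_eqOn_exp_comp hsc isOpen_univ hk.continuousOn
    (by rintro ⟨x, -, hx⟩; exact h0 x hx)
  exact ⟨l, continuousOn_univ.1 hl, fun x => hexp (mem_univ x)⟩

theorem exists_continuousOn_ball_exp_eq {k : ℂ → ℂ} (hk : ContinuousOn k (Metric.ball 0 1))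
    (h0 : ∀ x ∈ Metric.ball (0 : ℂ) 1, k x ≠ 0) :
    ∃ l : ℂ → ℂ, ContinuousOn l (Metric.ball 0 1) ∧
      ∀ x ∈ Metric.ball (0 : ℂ) 1, Complex.exp (l x) = k x := by
  have hsc : IsSimplyConnected (Metric.ball (0 : ℂ) 1) := by
    have : ContractibleSpace (Metric.ball (0 : ℂ) 1) :=
      (convex_ball _ _).contractibleSpace ⟨0, Metric.mem_ball_self one_pos⟩
    exact (inferInstance : SimplyConnectedSpace (Metric.ball (0 : ℂ) 1))
  obtain ⟨l, hl, hexp⟩ := Complex.exists_continuousOn_eqOn_exp_comp hsc Metric.isOpen_ball hk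
    (by rintro ⟨x, hx, hx0⟩; exact h0 x hx hx0)
  exact ⟨l, hl, fun x hx => hexp hx⟩

/-- A continuous logarithm of a function with a nonzero limit has a limit. -/
theorem exists_tendsto_of_tendsto_exp {μ : ℝ → ℂ} (hμ : ContinuousOn μ (Iio 1)) {k : ℂ}
    (hk : k ≠ 0) (hlim : Tendsto (fun s => Complex.exp (μ s)) (𝓝[<] 1) (𝓝 k)) :
    ∃ y, Tendsto μ (𝓝[<] 1) (𝓝 y) ∧ Complex.exp y = k := by
  have hq : Tendsto (fun s => Complex.exp (μ s) / k) (𝓝[<] 1) (𝓝 1) := by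
    simpa [div_self hk] using hlim.div_const k
  obtain ⟨s₀, hs₀, hsub⟩ := mem_nhdsLT_iff_exists_Ioo_subset.1
    (hq.eventually (Complex.isOpen_slitPlane.mem_nhds Complex.one_mem_slitPlane))
  have hs₀' : s₀ < 1 := hs₀
  obtain ⟨x, hx⟩ := nonempty_Ioo.2 hs₀'
  have hμ' : ContinuousOn μ (Ioo s₀ 1) := hμ.mono Ioo_subset_Iio_self
  have hlog : ContinuousOn (fun s => Complex.log (Complex.exp (μ s) / k)) (Ioo s₀ 1) :=
    ((Complex.continuous_exp.comp_continuousOn hμ').div_const k).clog fun s hs => hsub hs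
  have hexp : ∀ s, Complex.exp (Complex.log (Complex.exp (μ s) / k)) = Complex.exp (μ s) / k :=
    fun s => Complex.exp_log (div_ne_zero (Complex.exp_ne_zero _) hk)
  have hconst : ∀ s ∈ Ioo s₀ 1, μ s = Complex.log (Complex.exp (μ s) / k) +
      (μ x - Complex.log (Complex.exp (μ x) / k)) := fun s hs => by
    have := isPreconnected_Ioo.sub_eq_sub_of_exp_eq hμ' hlog (k := k)
      (fun s _ => by rw [hexp]; field_simp) hx hs
    rw [← this]
    ring
  have hlim' : Tendsto μ (𝓝[<] 1) (𝓝 (μ x - Complex.log (Complex.exp (μ x) / k))) := by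
    have h1 : Tendsto (fun s => Complex.log (Complex.exp (μ s) / k)) (𝓝[<] 1) (𝓝 0) := by
      simpa using hq.clog Complex.one_mem_slitPlane
    have h2 := h1.add_const (μ x - Complex.log (Complex.exp (μ x) / k))
    rw [zero_add] at h2
    exact h2.congr' (by filter_upwards [Ioo_mem_nhdsLT hs₀] with s hs using (hconst s hs).symm)
  exact ⟨_, hlim', tendsto_nhds_unique ((Complex.continuous_exp.tendsto _).comp hlim') hlim⟩

/-- The curves `va` and `vb`, parametrised by `[0, 1]` and with the same end points, have the same
variation of the argument around `p`. -/
def SameWinding (va vb : ℝ → ℂ) (p : ℂ) : Prop :=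
  ∃ la lb : ℝ → ℂ, Continuous la ∧ Continuous lb ∧ (∀ s, Complex.exp (la s) = va s - p) ∧
    (∀ s, Complex.exp (lb s) = vb s - p) ∧ la 0 = lb 0 ∧ la 1 = lb 1

variable {va vb : ℝ → ℂ} {p p' : ℂ}

theorem SameWinding.of_norm_sub_lt (h : SameWinding va vb p) (ha : Continuous va)
    (hb : Continuous vb) (h0 : va 0 = vb 0) (h1 : va 1 = vb 1)
    (hpa : ∀ s, ‖p' - p‖ < ‖va s - p‖) (hpb : ∀ s, ‖p' - p‖ < ‖vb s - p‖) :
    SameWinding va vb p' := by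
  obtain ⟨la, lb, hla, hlb, hea, heb, e0, e1⟩ := h
  have key : ∀ v : ℝ → ℂ, Continuous v → (∀ s, ‖p' - p‖ < ‖v s - p‖) →
      (∀ s, v s - p ≠ 0) ∧ ∀ s, 1 - (p' - p) / (v s - p) ∈ Complex.slitPlane := by
    intro v hv hlt
    have hne : ∀ s, v s - p ≠ 0 := fun s => norm_pos_iff.1 ((norm_nonneg _).trans_lt (hlt s))
    refine ⟨hne, fun s => Complex.mem_slitPlane_of_norm_lt_one (z := -((p' - p) / (v s - p))) ?_⟩
    rw [norm_neg, norm_div, div_lt_one (norm_pos_iff.2 (hne s))]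
    exact hlt s
  obtain ⟨ha0, hsa⟩ := key va ha hpa
  obtain ⟨hb0, hsb⟩ := key vb hb hpb
  refine ⟨fun s => la s + Complex.log (1 - (p' - p) / (va s - p)),
    fun s => lb s + Complex.log (1 - (p' - p) / (vb s - p)), ?_, ?_, fun s => ?_, fun s => ?_, ?_, ?_⟩
  · exact hla.add ((continuous_const.sub
      (continuous_const.div (ha.sub continuous_const) ha0)).clog hsa)
  · exact hlb.add ((continuous_const.sub
      (continuous_const.div (hb.sub continuous_const) hb0)).clog hsb)
  · rw [Complex.exp_add, hea, Complex.exp_log (Complex.slitPlane_ne_zero (hsa s))]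
    field_simp [ha0 s]
    ring
  · rw [Complex.exp_add, heb, Complex.exp_log (Complex.slitPlane_ne_zero (hsb s))]
    field_simp [hb0 s]
    ring
  · simp only [e0, h0]
  · simp only [e1, h1]

theorem SameWinding.of_norm_lt (ha : Continuous va)
    (hb : Continuous vb) (h0 : va 0 = vb 0) (h1 : va 1 = vb 1)
    (hpa : ∀ s, ‖va s‖ < ‖p‖) (hpb : ∀ s, ‖vb s‖ < ‖p‖) :
    SameWinding va vb p := by
  have hp : p ≠ 0 := norm_pos_iff.1 ((norm_nonneg _).trans_lt (hpa 0))
  have key : ∀ v : ℝ → ℂ, Continuous v → (∀ s, ‖v s‖ < ‖p‖) →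
      ∀ s, 1 - v s / p ∈ Complex.slitPlane := by
    intro v hv hlt s
    refine Complex.mem_slitPlane_of_norm_lt_one (z := -(v s / p)) ?_
    rw [norm_neg, norm_div, div_lt_one (norm_pos_iff.2 hp)]
    exact hlt s
  refine ⟨fun s => Complex.log (-p) + Complex.log (1 - va s / p),
    fun s => Complex.log (-p) + Complex.log (1 - vb s / p), ?_, ?_, fun s => ?_, fun s => ?_, ?_, ?_⟩
  · exact continuous_const.add ((continuous_const.sub (ha.div_const p)).clog (key va ha hpa))
  · exact continuous_const.add ((continuous_const.sub (hb.div_const p)).clog (key vb hb hpb))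
  · rw [Complex.exp_add, Complex.exp_log (neg_ne_zero.2 hp),
      Complex.exp_log (Complex.slitPlane_ne_zero (key va ha hpa s))]
    field_simp
    ring
  · rw [Complex.exp_add, Complex.exp_log (neg_ne_zero.2 hp),
      Complex.exp_log (Complex.slitPlane_ne_zero (key vb hb hpb s))]
    field_simp
    ring
  · simp only [h0]
  · simp only [h1]

/-- Isotopies of the plane preserve `SameWinding`. -/
theorem SameWinding.isotopy (h : SameWinding va vb p) (ha : Continuous va) (hb : Continuous vb)
    (h0 : va 0 = vb 0) (h1 : va 1 = vb 1) (hpa : ∀ s, va s ≠ p) (hpb : ∀ s, vb s ≠ p)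
    {H : unitInterval × ℂ → ℂ} (hH : Continuous H) (hid : ∀ x, H (0, x) = x)
    (hinj : ∀ t, Function.Injective fun x => H (t, x)) :
    SameWinding (fun s => H (1, va s)) (fun s => H (1, vb s)) (H (1, p)) := by
  obtain ⟨la, lb, hla, hlb, hea, heb, e0, e1⟩ := h
  let τ : ℝ → unitInterval := projIcc 0 1 zero_le_one
  have hτ : Continuous τ := continuous_projIcc
  have hτ0 : τ 0 = 0 := projIcc_left _
  have hτ1 : τ 1 = 1 := projIcc_right _
  have key : ∀ v l : ℝ → ℂ, Continuous v → (∀ s, v s ≠ p) → Continuous l →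
      (∀ s, Complex.exp (l s) = v s - p) → ∃ A : ℝ × ℝ → ℂ, Continuous A ∧
        (∀ x, Complex.exp (A x) = H (τ x.2, v x.1) - H (τ x.2, p)) ∧ ∀ s, A (s, 0) = l s := by
    intro v l hv hvp hl hel
    obtain ⟨A, hA, heA⟩ := exists_continuous_exp_eq (E := ℝ × ℝ)
      (k := fun x => H (τ x.2, v x.1) - H (τ x.2, p)) (by fun_prop)
      (fun x => sub_ne_zero.2 fun e => hvp x.1 (hinj _ e))
    have hc := fun s => isPreconnected_univ.sub_eq_sub_of_exp_eq (f := fun s => A (s, 0)) (g := l)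
      (by fun_prop) hl.continuousOn (k := 1)
      (fun s _ => by rw [heA, hel, one_mul, hτ0, hid, hid]) (mem_univ (0 : ℝ)) (mem_univ s)
    have hexp1 : Complex.exp (A (0, 0) - l 0) = 1 := by
      rw [Complex.exp_sub, heA, hel, hτ0, hid, hid, div_self (sub_ne_zero.2 (hvp 0))]
    refine ⟨fun x => A x - (A (0, 0) - l 0), by fun_prop, fun x => ?_, fun s => ?_⟩
    · rw [Complex.exp_sub, hexp1, div_one, heA]
    · have := hc s
      rw [← this]
      ring
  obtain ⟨A, hA, heA, hA0⟩ := key va la ha hpa hla hea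
  obtain ⟨B, hB, heB, hB0⟩ := key vb lb hb hpb hlb heb
  have hAB : ∀ s : ℝ, va s = vb s → la s = lb s → A (s, 1) = B (s, 1) := by
    intro s hs hl
    have := isPreconnected_univ.sub_eq_sub_of_exp_eq (f := fun t : ℝ => A (s, t))
      (g := fun t : ℝ => B (s, t)) (by fun_prop) (by fun_prop) (k := 1)
      (fun t _ => by rw [heA, heB, one_mul, hs]) (mem_univ (0 : ℝ)) (mem_univ 1)
    simp only [hA0, hB0, hl, sub_self] at this
    exact sub_eq_zero.1 this
  refine ⟨fun s => A (s, 1), fun s => B (s, 1), by fun_prop, by fun_prop, fun s => ?_, fun s => ?_,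
    hAB 0 h0 e0, hAB 1 h1 e1⟩
  · rw [heA, hτ1]
  · rw [heB, hτ1]

end ContinuousLog

theorem continuous_ite_lt_one {f : ℝ → ℂ} (hf : ContinuousOn f (Iio 1)) {q : ℂ}
    (hq : Tendsto f (𝓝[<] 1) (𝓝 q)) : Continuous fun s : ℝ => if s < 1 then f s else q := by
  have heq : ∀ s₀ < (1 : ℝ), (fun s : ℝ => if s < 1 then f s else q) =ᶠ[𝓝 s₀] f := fun s₀ h => by
    filter_upwards [Iio_mem_nhds h] with s hs
    exact if_pos hs
  refine continuous_iff_continuousAt.2 fun s => ?_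
  rcases lt_trichotomy s 1 with h | rfl | h
  · exact (hf.continuousAt (Iio_mem_nhds h)).congr (heq s h).symm
  · rw [continuousAt_iff_continuous_left'_right']
    constructor
    · rw [ContinuousWithinAt, if_neg (lt_irrefl _)]
      refine hq.congr' ?_
      filter_upwards [self_mem_nhdsWithin] with s hs
      exact (if_pos hs).symm
    · rw [ContinuousWithinAt, if_neg (lt_irrefl _)]
      refine tendsto_const_nhds.congr' ?_
      filter_upwards [self_mem_nhdsWithin] with s hs
      exact (if_neg (not_lt.2 (le_of_lt hs))).symm
  · refine (continuousAt_const (y := q)).congr ?_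
    filter_upwards [Ioi_mem_nhds h] with s hs
    exact (if_neg (not_lt.2 (le_of_lt hs))).symm

/-- `w` is a path in the disc which ends, at time `1`, at a point of the unit circle, and `v` is its
image under `φ`, ending outside of `V`. -/
structure IsEndPath (V : Set ℂ) (φ : ℂ → ℂ) (w v : ℝ → ℂ) : Prop where
  cont : Continuous w
  cont_image : Continuous v
  mem : ∀ s < 1, w s ∈ Metric.ball 0 1
  image_eq : ∀ s < 1, v s = φ (w s)
  const_left : ∀ s ≤ 0, w s = w 0
  const_right : ∀ s, 1 ≤ s → w s = w 1
  image_const_right : ∀ s, 1 ≤ s → v s = v 1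
  norm_right : ‖w 1‖ = 1
  image_right : v 1 ∉ V

/-- Clamping to the unit interval. -/
def clampUnit (x : ℝ) : ℝ := max 0 (min 1 x)

theorem continuous_clampUnit : Continuous clampUnit := by unfold clampUnit; fun_prop

theorem clampUnit_of_nonpos {x : ℝ} (hx : x ≤ 0) : clampUnit x = 0 :=
  max_eq_left ((min_le_right _ _).trans hx)

theorem clampUnit_of_mem {x : ℝ} (h0 : 0 ≤ x) (h1 : x ≤ 1) : clampUnit x = x := by
  rw [clampUnit, min_eq_right h1, max_eq_right h0]

theorem clampUnit_of_one_le {x : ℝ} (h1 : 1 ≤ x) : clampUnit x = 1 := by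
  rw [clampUnit, min_eq_left h1, max_eq_right zero_le_one]

theorem clampUnit_nonneg (x : ℝ) : 0 ≤ clampUnit x := le_max_left _ _

theorem clampUnit_le_one (x : ℝ) : clampUnit x ≤ 1 := max_le zero_le_one (min_le_left _ _)

theorem clampUnit_lt_one {x : ℝ} (h1 : x < 1) : clampUnit x < 1 :=
  max_lt one_pos ((min_le_right _ _).trans_lt h1)

/-- Every curve in the disc with limits can be replaced by an end path starting at `0`. -/
theorem exists_isEndPath {V : Set ℂ} {φ : ℂ → ℂ} (hφ : ContinuousOn φ (Metric.ball 0 1))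
    {c : ℝ → ℂ} (hc : ContinuousOn c (Ico 0 1)) (hcb : MapsTo c (Ico 0 1) (Metric.ball 0 1))
    {a q : ℂ} (ha : ‖a‖ = 1) (hca : Tendsto c (𝓝[<] 1) (𝓝 a))
    (hcq : Tendsto (fun s => φ (c s)) (𝓝[<] 1) (𝓝 q)) (hq : q ∉ V) :
    ∃ w v, IsEndPath V φ w v ∧ w 0 = 0 ∧ w 1 = a ∧ v 1 = q ∧
      ∀ s ∈ Ico (1 / 2 : ℝ) 1, w s = c (2 * s - 1) := by
  set f : ℝ → ℂ := fun s => clampUnit (2 * s) • c (clampUnit (2 * s - 1)) with hf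
  have hmem : ∀ s < (1 : ℝ), clampUnit (2 * s - 1) ∈ Ico (0 : ℝ) 1 := fun s hs =>
    ⟨clampUnit_nonneg _, clampUnit_lt_one (by linarith)⟩
  have hfc : ContinuousOn f (Iio 1) :=
    ((continuous_clampUnit.comp (by fun_prop : Continuous fun s : ℝ => 2 * s)).continuousOn).smul
      (hc.comp (continuous_clampUnit.comp
        (by fun_prop : Continuous fun s : ℝ => 2 * s - 1)).continuousOn hmem)
  have hfb : ∀ s < 1, f s ∈ Metric.ball (0 : ℂ) 1 := fun s hs => by
    have h1 := hcb (hmem s hs)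
    rw [mem_ball_zero_iff] at h1 ⊢
    simp only [f]
    rw [norm_smul, Real.norm_of_nonneg (clampUnit_nonneg _)]
    exact lt_of_le_of_lt (mul_le_of_le_one_left (norm_nonneg _) (clampUnit_le_one _)) h1
  have hfeq : ∀ s ∈ Ico (1 / 2 : ℝ) 1, f s = c (2 * s - 1) := fun s hs => by
    simp only [f]
    rw [clampUnit_of_one_le (by linarith [hs.1]),
      clampUnit_of_mem (by linarith [hs.1]) (by linarith [hs.2]), one_smul]
  have hev : ∀ᶠ s : ℝ in 𝓝[<] 1, s ∈ Ico (1 / 2 : ℝ) 1 := Ico_mem_nhdsLT (by norm_num)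
  have haff : Tendsto (fun s : ℝ => 2 * s - 1) (𝓝[<] 1) (𝓝[<] 1) := by
    refine tendsto_nhdsWithin_iff.2 ⟨Tendsto.mono_left ?_ nhdsWithin_le_nhds, ?_⟩
    · have := (by fun_prop : Continuous fun s : ℝ => 2 * s - 1).tendsto 1
      norm_num at this
      exact this
    · filter_upwards [self_mem_nhdsWithin] with s hs
      have : s < 1 := hs
      simp only [mem_Iio]
      linarith
  have hfa : Tendsto f (𝓝[<] 1) (𝓝 a) :=
    (hca.comp haff).congr' (hev.mono fun s hs => (hfeq s hs).symm)
  have hfq : Tendsto (fun s => φ (f s)) (𝓝[<] 1) (𝓝 q) :=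
    (hcq.comp haff).congr' (hev.mono fun s hs => by simp only [Function.comp_apply, hfeq s hs])
  have hf0 : ∀ s ≤ 0, f s = 0 := fun s hs => by
    simp only [f]
    rw [clampUnit_of_nonpos (by linarith), zero_smul]
  refine ⟨fun s => if s < 1 then f s else a, fun s => if s < 1 then φ (f s) else q,
    ⟨continuous_ite_lt_one hfc hfa, continuous_ite_lt_one (hφ.comp hfc hfb) hfq, ?_, ?_, ?_, ?_, ?_,
      ?_, ?_⟩, ?_, ?_, ?_, ?_⟩
  · intro s hs
    simp only [if_pos hs]
    exact hfb s hs
  · intro s hs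
    simp only [if_pos hs]
  · intro s hs
    simp only [if_pos (show s < 1 by linarith), if_pos (zero_lt_one' ℝ), hf0 s hs, hf0 0 le_rfl]
  · intro s hs
    simp only [if_neg (not_lt.2 hs), lt_irrefl, if_false]
  · intro s hs
    simp only [if_neg (not_lt.2 hs), lt_irrefl, if_false]
  · simpa using ha
  · simpa using hq
  · simp only [if_pos (zero_lt_one' ℝ), hf0 0 le_rfl]
  · simp
  · simp
  · intro s hs
    simp only [if_pos hs.2, hfeq s hs]

/-- The divided difference of `φ`, equal to the derivative on the diagonal. -/
def divDiff (φ : ℂ → ℂ) (x y : ℂ) : ℂ := if x = y then deriv φ x else (φ x - φ y) / (x - y)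

theorem continuousAt_divDiff {φ : ℂ → ℂ} (hφ : DifferentiableOn ℂ φ (Metric.ball 0 1)) {x : ℂ}
    (hx : x ∈ Metric.ball (0 : ℂ) 1) :
    ContinuousAt (fun z : ℂ × ℂ => divDiff φ z.1 z.2) (x, x) := by
  have han := hφ.analyticOnNhd Metric.isOpen_ball x hx
  have hs := han.hasStrictDerivAt
  have hd : ContinuousAt (deriv φ) x := han.deriv.continuousAt
  have hval : divDiff φ x x = deriv φ x := if_pos rfl
  rw [ContinuousAt, hval, Metric.tendsto_nhds]
  intro ε hε
  have h1 := hs.isLittleO.def (half_pos hε)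
  have h2 : ∀ᶠ z : ℂ × ℂ in 𝓝 (x, x), dist (deriv φ z.1) (deriv φ x) < ε :=
    (hd.tendsto.comp (continuous_fst.tendsto (x, x))).eventually (Metric.ball_mem_nhds _ hε)
  filter_upwards [h1, h2] with z hz hz'
  by_cases he : z.1 = z.2
  · rw [divDiff, if_pos he]
    exact hz'
  · have hne : z.1 - z.2 ≠ 0 := sub_ne_zero.2 he
    rw [divDiff, if_neg he, dist_eq_norm]
    have : (φ z.1 - φ z.2) / (z.1 - z.2) - deriv φ x =
        (φ z.1 - φ z.2 - (z.1 - z.2) • deriv φ x) / (z.1 - z.2) := by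
      rw [smul_eq_mul]
      field_simp
    rw [this, norm_div, div_lt_iff₀ (norm_pos_iff.2 hne)]
    refine lt_of_le_of_lt hz ?_
    exact mul_lt_mul_of_pos_right (half_lt_self hε) (norm_pos_iff.2 hne)

namespace IsRiemannMap

variable {V : Set ℂ} {φ ψ : ℂ → ℂ}

theorem deriv_ne_zero (h : IsRiemannMap V φ ψ) {x : ℂ} (hx : x ∈ Metric.ball (0 : ℂ) 1) :
    deriv φ x ≠ 0 := by
  intro h0
  have h1 : HasDerivAt φ (deriv φ x) x := h.hasDerivAt hx
  have h2 : HasDerivAt ψ (deriv ψ (φ x)) (φ x) :=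
    (h.diff_inv.differentiableAt (h.isOpen.mem_nhds (h.mapsTo hx))).hasDerivAt
  have h3 := h2.comp x h1
  rw [h0, mul_zero] at h3
  have h4 : HasDerivAt (ψ ∘ φ) 1 x := (hasDerivAt_id x).congr_of_eventuallyEq (by
    filter_upwards [Metric.isOpen_ball.mem_nhds hx] with w hw using h.left_inv w hw)
  exact one_ne_zero (h4.unique h3)

/-- The divided difference along two end paths with distinct end points has a continuous
logarithm. -/
theorem exists_log_divDiff (h : IsRiemannMap V φ ψ) {w v w' v' : ℝ → ℂ} (hw : IsEndPath V φ w v)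
    (hw' : IsEndPath V φ w' v') (hne : w 1 ≠ w' 1) (hne' : v 1 ≠ v' 1) :
    ∃ N : ℝ × ℝ → ℂ, Continuous N ∧ ∀ s t, Complex.exp (N (s, t)) =
      if w s = w' t then deriv φ (w s) else (v s - v' t) / (w s - w' t) := by
  have hlt : ∀ {s t}, w s = w' t → s < 1 ∧ t < 1 := by
    intro s t e
    by_contra! hcon
    rcases lt_or_ge s 1 with hs | hs
    · have h1 := hw.mem s hs
      rw [e, hw'.const_right t (hcon hs), mem_ball_zero_iff, hw'.norm_right] at h1
      exact lt_irrefl _ h1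
    · rcases lt_or_ge t 1 with ht | ht
      · have h1 := hw'.mem t ht
        rw [← e, hw.const_right s hs, mem_ball_zero_iff, hw.norm_right] at h1
        exact lt_irrefl _ h1
      · rw [hw.const_right s hs, hw'.const_right t ht] at e
        exact hne e
  suffices hk : (Continuous fun x : ℝ × ℝ =>
      if w x.1 = w' x.2 then deriv φ (w x.1) else (v x.1 - v' x.2) / (w x.1 - w' x.2)) ∧
      ∀ x : ℝ × ℝ, (if w x.1 = w' x.2 then deriv φ (w x.1) else
        (v x.1 - v' x.2) / (w x.1 - w' x.2)) ≠ 0 by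
    obtain ⟨N, hN, hexp⟩ := exists_continuous_exp_eq hk.1 hk.2
    exact ⟨N, hN, fun s t => hexp (s, t)⟩
  constructor
  · have c1 := hw.cont
    have c2 := hw.cont_image
    have c3 := hw'.cont
    have c4 := hw'.cont_image
    refine continuous_iff_continuousAt.2 fun ⟨s, t⟩ => ?_
    by_cases e : w s = w' t
    · obtain ⟨hs, ht⟩ := hlt e
      have h1 := continuousAt_divDiff h.diff (hw.mem s hs)
      have h2 : ContinuousAt (fun x : ℝ × ℝ => (w x.1, w' x.2)) (s, t) := by fun_prop
      have h3 : ContinuousAt (fun x : ℝ × ℝ => divDiff φ (w x.1) (w' x.2)) (s, t) :=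
        ContinuousAt.comp (g := fun z : ℂ × ℂ => divDiff φ z.1 z.2)
          (f := fun x : ℝ × ℝ => (w x.1, w' x.2)) (by simpa only [← e] using h1) h2
      refine h3.congr ?_
      filter_upwards [(isOpen_Iio.prod isOpen_Iio).mem_nhds (show (s, t) ∈ Iio 1 ×ˢ Iio 1 from
        ⟨hs, ht⟩)] with x hx
      rw [divDiff, hw.image_eq _ hx.1, hw'.image_eq _ hx.2]
    · have h3 : ContinuousAt (fun x : ℝ × ℝ => (v x.1 - v' x.2) / (w x.1 - w' x.2)) (s, t) :=
        ContinuousAt.div (by fun_prop) (by fun_prop) (sub_ne_zero.2 e)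
      refine h3.congr ?_
      have h4 : ∀ᶠ x : ℝ × ℝ in 𝓝 (s, t), w x.1 - w' x.2 ≠ 0 :=
        (by fun_prop : ContinuousAt (fun x : ℝ × ℝ => w x.1 - w' x.2) (s, t)).eventually_ne
          (sub_ne_zero.2 e)
      filter_upwards [h4] with x hx
      rw [if_neg (sub_ne_zero.1 hx)]
  · rintro ⟨s, t⟩
    simp only
    split_ifs with e
    · exact h.deriv_ne_zero (hw.mem s (hlt e).1)
    · refine div_ne_zero (sub_ne_zero.2 fun e' => e ?_) (sub_ne_zero.2 e)
      rcases lt_or_ge s 1 with hs | hs <;> rcases lt_or_ge t 1 with ht | ht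
      · rw [hw.image_eq s hs, hw'.image_eq t ht] at e'
        exact h.injOn (hw.mem s hs) (hw'.mem t ht) e'
      · rw [hw.image_eq s hs, hw'.image_const_right t ht] at e'
        exact absurd (e' ▸ h.mapsTo (hw.mem s hs)) hw'.image_right
      · rw [hw'.image_eq t ht, hw.image_const_right s hs] at e'
        exact absurd (e' ▸ h.mapsTo (hw'.mem t ht)) hw.image_right
      · rw [hw.image_const_right s hs, hw'.image_const_right t ht] at e'
        exact absurd e' hne'

/-- A continuous logarithm on the disc of the divided difference with base point `0`. -/
theorem exists_log_divDiff_zero (h : IsRiemannMap V φ ψ) :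
    ∃ m : ℂ → ℂ, ContinuousOn m (Metric.ball 0 1) ∧
      ∀ w ∈ Metric.ball (0 : ℂ) 1, Complex.exp (m w) = divDiff φ w 0 := by
  have h0 : (0 : ℂ) ∈ Metric.ball (0 : ℂ) 1 := Metric.mem_ball_self one_pos
  refine exists_continuousOn_ball_exp_eq (fun w hw => ContinuousAt.continuousWithinAt ?_)
    fun w hw => ?_
  · by_cases e : w = 0
    · rw [e]
      exact ContinuousAt.comp (g := fun z : ℂ × ℂ => divDiff φ z.1 z.2)
        (f := fun w : ℂ => (w, (0 : ℂ))) (continuousAt_divDiff h.diff h0) (by fun_prop)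
    · have h3 : ContinuousAt (fun w => (φ w - φ 0) / (w - 0)) w :=
        ContinuousAt.div ((h.diff.continuousOn.continuousAt
          (Metric.isOpen_ball.mem_nhds hw)).sub continuousAt_const) (by fun_prop)
          (by simpa using e)
      refine h3.congr ?_
      filter_upwards [isOpen_ne.mem_nhds e] with x hx
      rw [divDiff, if_neg hx]
  · rw [divDiff]
    split_ifs with e
    · exact h.deriv_ne_zero hw
    · exact div_ne_zero (sub_ne_zero.2 fun e' => e (h.injOn hw h0 e')) (sub_ne_zero.2 e)

end IsRiemannMap

theorem one_sub_div_mem_slitPlane {x a : ℂ} (hx : ‖x‖ ≤ 1) (ha : ‖a‖ = 1) (hne : x ≠ a) :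
    1 - x / a ∈ Complex.slitPlane ∧ 0 < (1 - x / a).re := by
  have ha0 : a ≠ 0 := norm_ne_zero_iff.1 (by rw [ha]; exact one_ne_zero)
  suffices h : 0 < (1 - x / a).re from ⟨Or.inl h, h⟩
  set y := x / a with hy
  have hy1 : ‖y‖ ≤ 1 := by rw [hy, norm_div, ha, div_one]; exact hx
  have hyne : y ≠ 1 := fun e => hne (by rw [hy, div_eq_one_iff_eq ha0] at e; exact e)
  have h1 : y.re ≤ ‖y‖ := Complex.re_le_norm y
  rw [Complex.sub_re, Complex.one_re, sub_pos]
  refine lt_of_le_of_ne (h1.trans hy1) fun e => hyne ?_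
  have h2 : y.re * y.re + y.im * y.im ≤ 1 := by
    rw [← Complex.normSq_apply, Complex.normSq_eq_norm_sq]
    nlinarith [norm_nonneg y]
  rw [e] at h2
  have h3 : y.im = 0 := by nlinarith [mul_self_nonneg y.im]
  exact Complex.ext e h3

theorem arg_one_sub_div_swap {a b : ℂ} (ha : ‖a‖ = 1) (hb : ‖b‖ = 1) (hne : a ≠ b) :
    Complex.arg (1 - a / b) = -Complex.arg (1 - b / a) := by
  have hconj : 1 - a / b = (starRingEnd ℂ) (1 - b / a) := by
    have h1 : ∀ c : ℂ, ‖c‖ = 1 → (starRingEnd ℂ) c = c⁻¹ := fun c hc => by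
      rw [Complex.inv_def, Complex.normSq_eq_norm_sq, hc]; simp
    rw [map_sub, map_one, map_div₀, h1 a ha, h1 b hb, inv_div_inv]
  rw [hconj, Complex.arg_conj, if_neg]
  intro e
  have := (Complex.mem_slitPlane_iff_arg.1
    (one_sub_div_mem_slitPlane hb.le ha hne.symm).1).1
  exact this e

namespace IsEndPath

variable {V : Set ℂ} {φ ψ : ℂ → ℂ} {w v wa va wb vb we ve : ℝ → ℂ}

theorem norm_le (hw : IsEndPath V φ w v) (s : ℝ) : ‖w s‖ ≤ 1 := by
  rcases lt_or_ge s 1 with hs | hs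
  · exact (mem_ball_zero_iff.1 (hw.mem s hs)).le
  · rw [hw.const_right s hs, hw.norm_right]

theorem tendsto (hw : IsEndPath V φ w v) : Tendsto w (𝓝[<] 1) (𝓝 (w 1)) :=
  (hw.cont.tendsto 1).mono_left nhdsWithin_le_nhds

theorem tendsto_image (hw : IsEndPath V φ w v) :
    Tendsto (fun s => φ (w s)) (𝓝[<] 1) (𝓝 (v 1)) :=
  ((hw.cont_image.tendsto 1).mono_left nhdsWithin_le_nhds).congr' (by
    filter_upwards [self_mem_nhdsWithin] with s hs using hw.image_eq s hs)

theorem mapsTo (hw : IsEndPath V φ w v) : MapsTo w (Ico 0 1) (Metric.ball 0 1) :=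
  fun s hs => hw.mem s hs.2

theorem end_ne (hw : IsEndPath V φ w v) (he : IsEndPath V φ we ve) (h : IsRiemannMap V φ ψ)
    (hV : V ≠ univ) (hne : v 1 ≠ ve 1) : w 1 ≠ we 1 := by
  intro e
  refine hne (h.tendsto_unique_of_curves hV hw.norm_right (w := ![w, we]) (p := ![v 1, ve 1])
    (fun i => ?_) (fun i => ?_) (fun i => ?_) (fun i => ?_))
  · fin_cases i
    exacts [hw.cont.continuousOn, he.cont.continuousOn]
  · fin_cases i
    exacts [hw.mapsTo, he.mapsTo]
  · fin_cases i
    exacts [hw.tendsto, e ▸ he.tendsto]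
  · fin_cases i
    exacts [hw.tendsto_image, he.tendsto_image]

theorem exists_tendsto_log (hw : IsEndPath V φ w v) {m : ℂ → ℂ}
    (hm : ContinuousOn m (Metric.ball 0 1))
    (hexp : ∀ w ∈ Metric.ball (0 : ℂ) 1, Complex.exp (m w) = divDiff φ w 0)
    (hv : v 1 ≠ φ 0) :
    ∃ y, Tendsto (fun s => m (w s)) (𝓝[<] 1) (𝓝 y) ∧ Complex.exp y = (v 1 - φ 0) / w 1 := by
  have h0 : w 1 ≠ 0 := norm_ne_zero_iff.1 (by rw [hw.norm_right]; exact one_ne_zero)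
  refine exists_tendsto_of_tendsto_exp (hm.comp hw.cont.continuousOn fun s hs => hw.mem s hs)
    (div_ne_zero (sub_ne_zero.2 hv) h0) ?_
  refine ((hw.tendsto_image.sub_const (φ 0)).div hw.tendsto h0).congr' ?_
  filter_upwards [self_mem_nhdsWithin, hw.tendsto.eventually_ne h0] with s hs hs0
  simp only [Pi.div_apply, Function.comp_apply]
  rw [hexp _ (hw.mem s hs), divDiff, if_neg hs0, sub_zero]

/-- The edge of the square on which the second path is at its starting point `0`. -/
theorem sub_eq_of_log (hw : IsEndPath V φ w v) (he : IsEndPath V φ we ve) (he0 : we 0 = 0)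
    {m : ℂ → ℂ} (hm : ContinuousOn m (Metric.ball 0 1))
    (hexp : ∀ w ∈ Metric.ball (0 : ℂ) 1, Complex.exp (m w) = divDiff φ w 0)
    {N : ℝ × ℝ → ℂ} (hN : Continuous N) (hNexp : ∀ s t, Complex.exp (N (s, t)) =
      if w s = we t then deriv φ (w s) else (v s - ve t) / (w s - we t))
    {y : ℂ} (hy : Tendsto (fun s => m (w s)) (𝓝[<] 1) (𝓝 y)) :
    N (1, 0) - y = N (0, 0) - m (w 0) := by
  have hconst : ∀ s < 1, N (s, 0) - m (w s) = N (0, 0) - m (w 0) := fun s hs =>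
    isPreconnected_Iio.sub_eq_sub_of_exp_eq (f := fun s => N (s, 0)) (g := fun s => m (w s))
      (by fun_prop) (hm.comp hw.cont.continuousOn fun s hs => hw.mem s hs) (k := 1)
      (fun s hs => by
        rw [hNexp, hexp _ (hw.mem s hs), divDiff, he0, one_mul, he.image_eq 0 one_pos, he0,
          hw.image_eq s hs, sub_zero]) (mem_Iio.2 one_pos) (mem_Iio.2 hs)
  have h1 : Tendsto (fun s : ℝ => N (s, 0)) (𝓝[<] 1) (𝓝 (N (1, 0))) :=
    ((by fun_prop : Continuous fun s : ℝ => N (s, 0)).tendsto 1).mono_left nhdsWithin_le_nhds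
  refine tendsto_nhds_unique (h1.sub hy) (tendsto_const_nhds.congr' ?_)
  filter_upwards [self_mem_nhdsWithin] with s hs using (hconst s hs).symm

/-- The edge of the square on which the second path is at its end point. -/
theorem sub_eq_of_log_right (hw : IsEndPath V φ w v) (he : IsEndPath V φ we ve)
    (hne : w 1 ≠ we 1)
    {N : ℝ × ℝ → ℂ} (hN : Continuous N) (hNexp : ∀ s t, Complex.exp (N (s, t)) =
      if w s = we t then deriv φ (w s) else (v s - ve t) / (w s - we t))
    {l : ℝ → ℂ} (hl : Continuous l) (hlexp : ∀ s, Complex.exp (l s) = v s - ve 1) :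
    N (1, 1) - N (0, 1) = l 1 - l 0 - Complex.log (1 - w 1 / we 1) +
      Complex.log (1 - w 0 / we 1) := by
  have hne' : ∀ s, w s ≠ we 1 := fun s e => by
    rcases lt_or_ge s 1 with hs | hs
    · have := hw.mem s hs
      rw [e, mem_ball_zero_iff, he.norm_right] at this
      exact lt_irrefl _ this
    · exact hne (by rw [← e, hw.const_right s hs])
  have h0 : we 1 ≠ 0 := norm_ne_zero_iff.1 (by rw [he.norm_right]; exact one_ne_zero)
  have hsl := fun s => (one_sub_div_mem_slitPlane (hw.norm_le s) he.norm_right (hne' s)).1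
  have hc := hw.cont
  have := isPreconnected_univ.sub_eq_sub_of_exp_eq (f := fun s : ℝ => N (s, 1))
    (g := fun s => l s - Complex.log (1 - w s / we 1)) (by fun_prop)
    (hl.sub ((by fun_prop : Continuous fun s => 1 - w s / we 1).clog hsl)).continuousOn
    (k := -(we 1)⁻¹) (fun s _ => by
      rw [hNexp, if_neg (hne' s), Complex.exp_sub, hlexp, Complex.exp_log
        (Complex.slitPlane_ne_zero (hsl s))]
      have h1 := sub_ne_zero.2 (hne' s)
      have h2 : we 1 - w s ≠ 0 := sub_ne_zero.2 (hne' s).symm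
      have h3 : 1 - w s / we 1 = (we 1 - w s) / we 1 := by field_simp
      rw [h3, div_eq_iff h1]
      field_simp
      ring) (mem_univ (0 : ℝ)) (mem_univ 1)
  linear_combination this

/-- The variation of the argument of the divided differences with base point `0`, between the ends
of two paths, in terms of the end point of a path ending at a point not separated by them. -/
theorem im_sub_eq_of_zero (ha : IsEndPath V φ wa va) (hb : IsEndPath V φ wb vb)
    (he : IsEndPath V φ we ve) (h : IsRiemannMap V φ ψ) (hV : V ≠ univ) (h0 : wa 0 = wb 0)
    (h1 : va 1 = vb 1) (hne : va 1 ≠ ve 1) (hS : SameWinding va vb (ve 1)) (he0 : we 0 = 0)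
    {m : ℂ → ℂ} (hm : ContinuousOn m (Metric.ball 0 1))
    (hexp : ∀ w ∈ Metric.ball (0 : ℂ) 1, Complex.exp (m w) = divDiff φ w 0)
    {ya yb : ℂ} (hya : Tendsto (fun s => m (wa s)) (𝓝[<] 1) (𝓝 ya))
    (hyb : Tendsto (fun s => m (wb s)) (𝓝[<] 1) (𝓝 yb)) :
    (yb - ya).im = 2 * Complex.arg (1 - wa 1 / we 1) - 2 * Complex.arg (1 - wb 1 / we 1) := by
  have hae := ha.end_ne he h hV hne
  have hbe := hb.end_ne he h hV (h1 ▸ hne)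
  obtain ⟨A, hA, hAe⟩ := h.exists_log_divDiff ha he hae hne
  obtain ⟨B', hB', hBe'⟩ := h.exists_log_divDiff hb he hbe (h1 ▸ hne)
  have hv0 : va 0 = vb 0 := by rw [ha.image_eq 0 one_pos, hb.image_eq 0 one_pos, h0]
  let B : ℝ × ℝ → ℂ := fun x => B' x - (B' (0, 0) - A (0, 0))
  have hB : Continuous B := by fun_prop
  have hBe : ∀ s t, Complex.exp (B (s, t)) =
      if wb s = we t then deriv φ (wb s) else (vb s - ve t) / (wb s - we t) := fun s t => by
    have : Complex.exp (B' (0, 0) - A (0, 0)) = 1 := by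
      rw [Complex.exp_sub, div_eq_one_iff_eq (Complex.exp_ne_zero _), hBe', hAe, h0, hv0]
    simp only [B]
    rw [Complex.exp_sub, this, div_one, hBe']
  have hB0 : B (0, 0) = A (0, 0) := by simp [B]
  clear_value B
  have hleft : B (0, 1) = A (0, 1) := by
    have := isPreconnected_univ.sub_eq_sub_of_exp_eq (f := fun t : ℝ => B (0, t))
      (g := fun t : ℝ => A (0, t)) (by fun_prop) (by fun_prop) (k := 1)
      (fun t _ => by rw [hBe, hAe, one_mul, h0, hv0]) (mem_univ (0 : ℝ)) (mem_univ 1)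
    simp only [hB0, sub_self] at this
    exact sub_eq_zero.1 this
  have hbot : B (1, 0) - A (1, 0) = yb - ya := by
    have e1 := ha.sub_eq_of_log he he0 hm hexp hA hAe hya
    have e2 := hb.sub_eq_of_log he he0 hm hexp hB hBe hyb
    rw [hB0, ← h0] at e2
    linear_combination e2 - e1
  obtain ⟨la, lb, hla, hlb, hlae, hlbe, e0, e1⟩ := hS
  have hta := ha.sub_eq_of_log_right he hae hA hAe hla hlae
  have htb := hb.sub_eq_of_log_right he hbe hB hBe hlb hlbe
  have hne'' : ∀ {w v : ℝ → ℂ}, IsEndPath V φ w v → w 1 ≠ we 1 → ∀ t, we t ≠ w 1 := by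
    intro w v hw hne t e
    rcases lt_or_ge t 1 with ht | ht
    · have := he.mem t ht
      rw [e, mem_ball_zero_iff, hw.norm_right] at this
      exact lt_irrefl _ this
    · exact hne (by rw [← e, he.const_right t ht])
  have ha0 : wa 1 ≠ 0 := norm_ne_zero_iff.1 (by rw [ha.norm_right]; exact one_ne_zero)
  have hb0 : wb 1 ≠ 0 := norm_ne_zero_iff.1 (by rw [hb.norm_right]; exact one_ne_zero)
  have hvne : ∀ t, va 1 - ve t ≠ 0 := fun t => sub_ne_zero.2 fun e => by
    rcases lt_or_ge t 1 with ht | ht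
    · rw [he.image_eq t ht] at e
      exact ha.image_right (e ▸ h.mapsTo (he.mem t ht))
    · exact hne (by rw [e, he.image_const_right t ht])
  have hsla := fun t => (one_sub_div_mem_slitPlane (he.norm_le t) ha.norm_right
    (hne'' ha hae t)).1
  have hslb := fun t => (one_sub_div_mem_slitPlane (he.norm_le t) hb.norm_right
    (hne'' hb hbe t)).1
  have hc := he.cont
  have hright := isPreconnected_univ.sub_eq_sub_of_exp_eq (f := fun t : ℝ => B (1, t) - A (1, t))
    (g := fun t => Complex.log (1 - we t / wa 1) - Complex.log (1 - we t / wb 1)) (by fun_prop)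
    (((by fun_prop : Continuous fun t => 1 - we t / wa 1).clog hsla).sub
      ((by fun_prop : Continuous fun t => 1 - we t / wb 1).clog hslb)).continuousOn
    (k := wa 1 / wb 1) (fun t _ => by
      have i1 := sub_ne_zero.2 (hne'' ha hae t).symm
      have i2 := sub_ne_zero.2 (hne'' hb hbe t).symm
      have i3 := hvne t
      have i4 : 1 - we t / wa 1 = (wa 1 - we t) / wa 1 := by field_simp
      have i5 : 1 - we t / wb 1 = (wb 1 - we t) / wb 1 := by field_simp
      rw [Complex.exp_sub (B _), Complex.exp_sub (Complex.log _),
        Complex.exp_log (Complex.slitPlane_ne_zero (hsla t)),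
        Complex.exp_log (Complex.slitPlane_ne_zero (hslb t)), hBe, hAe,
        if_neg (hne'' ha hae t).symm, if_neg (hne'' hb hbe t).symm, ← h1, i4, i5]
      field_simp) (mem_univ (0 : ℝ)) (mem_univ 1)
  simp only [he0, zero_div, sub_zero, Complex.log_one, hbot] at hright
  have hfin : yb - ya = Complex.log (1 - wa 1 / we 1) - Complex.log (1 - wb 1 / we 1) -
      Complex.log (1 - we 1 / wa 1) + Complex.log (1 - we 1 / wb 1) := by
    rw [← h0] at htb
    linear_combination htb - hta - hright + hleft + e0 - e1
  rw [hfin]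
  simp only [Complex.add_im, Complex.sub_im, Complex.log_im]
  rw [arg_one_sub_div_swap he.norm_right ha.norm_right hae.symm,
    arg_one_sub_div_swap he.norm_right hb.norm_right hbe.symm]
  ring

/-- Replace an end path by one starting at `0` with the same end. -/
theorem exists_start_zero (hw : IsEndPath V φ w v) (hφ : ContinuousOn φ (Metric.ball 0 1)) :
    ∃ w' v', IsEndPath V φ w' v' ∧ w' 0 = 0 ∧ w' 1 = w 1 ∧ v' 1 = v 1 ∧
      ∀ s ∈ Ico (1 / 2 : ℝ) 1, w' s = w (2 * s - 1) :=
  exists_isEndPath hφ hw.cont.continuousOn hw.mapsTo hw.norm_right hw.tendsto hw.tendsto_image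
    hw.image_right

theorem im_sub_eq (ha : IsEndPath V φ wa va) (hb : IsEndPath V φ wb vb)
    (he : IsEndPath V φ we ve) (h : IsRiemannMap V φ ψ) (hV : V ≠ univ) (h0 : wa 0 = wb 0)
    (h1 : va 1 = vb 1) (hne : va 1 ≠ ve 1) (hS : SameWinding va vb (ve 1))
    {m : ℂ → ℂ} (hm : ContinuousOn m (Metric.ball 0 1))
    (hexp : ∀ w ∈ Metric.ball (0 : ℂ) 1, Complex.exp (m w) = divDiff φ w 0)
    {ya yb : ℂ} (hya : Tendsto (fun s => m (wa s)) (𝓝[<] 1) (𝓝 ya))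
    (hyb : Tendsto (fun s => m (wb s)) (𝓝[<] 1) (𝓝 yb)) :
    (yb - ya).im = 2 * Complex.arg (1 - wa 1 / we 1) - 2 * Complex.arg (1 - wb 1 / we 1) := by
  obtain ⟨w', v', hw', hw0, hw1, hv1, -⟩ := he.exists_start_zero h.diff.continuousOn
  rw [← hw1]
  exact ha.im_sub_eq_of_zero hb hw' h hV h0 h1 (hv1 ▸ hne) (hv1 ▸ hS) hw0 hm hexp hya hyb

end IsEndPath

/-- The complement of a simply connected plane domain has no bounded hole. -/
theorem IsSimplyConnected.exists_notMem_norm_gt {V : Set ℂ} (hVc : IsSimplyConnected V)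
    (hVo : IsOpen V) {z : ℂ} (hz : z ∉ V) (R : ℝ) : ∃ p, p ∉ V ∧ R < ‖p‖ := by
  by_contra! hcon
  obtain ⟨l, hl, hle⟩ := Complex.exists_continuousOn_eqOn_exp_comp (g := fun x => x - z) hVc hVo
    (by fun_prop) (by rintro ⟨x, hx, h0⟩; exact hz (sub_eq_zero.1 h0 ▸ hx))
  set ρ : ℝ := |R| + ‖z‖ + 1 with hρ
  have hρ0 : 0 < ρ := by positivity
  set c : ℝ → ℂ := fun θ => z + ρ * Complex.exp (θ * Complex.I) with hc
  have hcc : Continuous c := by simp only [c]; fun_prop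
  have hcV : ∀ θ, c θ ∈ V := fun θ => by
    by_contra hn
    have h1 := hcon _ hn
    have h2 : ‖c θ - z‖ = ρ := by
      simp only [c, add_sub_cancel_left, norm_mul, Complex.norm_exp_ofReal_mul_I, mul_one,
        Complex.norm_real, Real.norm_of_nonneg hρ0.le]
    have h3 := norm_sub_le (c θ) z
    linarith [le_abs_self R]
  have key := isPreconnected_univ.sub_eq_sub_of_exp_eq (f := fun θ : ℝ => l (c θ))
    (g := fun θ : ℝ => (θ : ℂ) * Complex.I) (hl.comp hcc.continuousOn fun θ _ => hcV θ)
    (by fun_prop) (k := ρ) (fun θ _ => by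
      have := hle (hcV θ)
      simp only [Function.comp_apply] at this
      rw [this]
      simp only [c, add_sub_cancel_left]) (mem_univ 0) (mem_univ (2 * Real.pi))
  have hper : c (2 * Real.pi) = c 0 := by
    simp only [c]
    push_cast
    rw [Complex.exp_two_pi_mul_I, zero_mul, Complex.exp_zero]
  simp only [hper] at key
  have := congrArg Complex.im key
  simp at this

namespace IsEndPath

variable {V : Set ℂ} {φ ψ : ℂ → ℂ} {w v wa va wb vb : ℝ → ℂ}

theorem isCompact_range (hw : IsEndPath V φ w v) : IsCompact (range v) := by
  have : range v = v '' Icc 0 1 := by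
    refine (image_subset_range _ _).antisymm' ?_
    rintro _ ⟨s, rfl⟩
    rcases le_total s 0 with h | h
    · exact ⟨0, by simp, by rw [hw.image_eq 0 one_pos, hw.image_eq s (by linarith), hw.const_left s h]⟩
    · rcases le_total s 1 with h' | h'
      · exact ⟨s, ⟨h, h'⟩, rfl⟩
      · exact ⟨1, by simp, (hw.image_const_right s h').symm⟩
  rw [this]
  exact isCompact_Icc.image hw.cont_image

theorem image_mem (hw : IsEndPath V φ w v) (hφ : MapsTo φ (Metric.ball 0 1) V) (s : ℝ) :
    v s ∈ V ∨ v s = v 1 := by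
  rcases lt_or_ge s 1 with h | h
  · exact Or.inl (hw.image_eq s h ▸ hφ (hw.mem s h))
  · exact Or.inr (hw.image_const_right s h)

theorem exists_norm_lt (hw : IsEndPath V φ w v) : ∃ R, ∀ s, ‖v s‖ < R := by
  obtain ⟨R, hR⟩ := hw.isCompact_range.isBounded.exists_norm_le
  exact ⟨R + 1, fun s => (hR _ (mem_range_self s)).trans_lt (lt_add_one R)⟩

theorem exists_pos_le_norm_sub (hw : IsEndPath V φ w v) (hφ : MapsTo φ (Metric.ball 0 1) V)
    {p : ℂ} (hp : p ∉ V) (hne : p ≠ v 1) : ∃ r > 0, ∀ s, r ≤ ‖v s - p‖ := by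
  have hmem : p ∈ (range v)ᶜ := by
    rintro ⟨s, hs⟩
    rcases hw.image_mem hφ s with h | h
    · exact hp (hs ▸ h)
    · exact hne (hs ▸ h)
  obtain ⟨r, hr, hb⟩ := Metric.isOpen_iff.1 hw.isCompact_range.isClosed.isOpen_compl p hmem
  refine ⟨r, hr, fun s => ?_⟩
  by_contra! hlt
  exact hb (by rwa [Metric.mem_ball, dist_eq_norm]) (mem_range_self s)

/-- Near a point outside of `V`, all points outside of the image curves see the same winding. -/
theorem exists_sameWinding_iff (ha : IsEndPath V φ wa va) (hb : IsEndPath V φ wb vb)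
    (hφ : MapsTo φ (Metric.ball 0 1) V) (h0 : wa 0 = wb 0) (h1 : va 1 = vb 1) {p : ℂ}
    (hp : p ∉ V) (hne : p ≠ va 1) :
    ∃ r > 0, ∀ q ∈ Metric.ball p r, q ≠ va 1 ∧ (SameWinding va vb q ↔ SameWinding va vb p) := by
  obtain ⟨r, hr, har⟩ := ha.exists_pos_le_norm_sub hφ hp hne
  obtain ⟨r', hr', hbr⟩ := hb.exists_pos_le_norm_sub hφ hp (h1 ▸ hne)
  have hv0 : va 0 = vb 0 := by rw [ha.image_eq 0 one_pos, hb.image_eq 0 one_pos, h0]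
  refine ⟨min r r' / 2, by positivity, fun q hq => ?_⟩
  rw [Metric.mem_ball, dist_eq_norm] at hq
  have hm := min_le_left r r'
  have hm' := min_le_right r r'
  have hmp : 0 < min r r' := lt_min hr hr'
  have htri : ∀ x : ℂ, ‖x - p‖ ≤ ‖x - q‖ + ‖q - p‖ := fun x => norm_sub_le_norm_sub_add_norm_sub x q p
  refine ⟨?_, fun h => ?_, fun h => ?_⟩
  · rintro rfl
    linarith [har 1]
  · refine h.of_norm_sub_lt ha.cont_image hb.cont_image hv0 h1 (fun s => ?_) fun s => ?_
    · rw [norm_sub_rev]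
      linarith [har s, htri (va s)]
    · rw [norm_sub_rev]
      linarith [hbr s, htri (vb s)]
  · refine h.of_norm_sub_lt ha.cont_image hb.cont_image hv0 h1 (fun s => ?_) fun s => ?_
    · linarith [har s]
    · linarith [hbr s]

/-- Two end paths with common endpoints have the same winding around some point of the frontier. -/
theorem exists_mem_frontier_sameWinding (ha : IsEndPath V φ wa va) (hb : IsEndPath V φ wb vb)
    (h : IsRiemannMap V φ ψ) (hVc : IsSimplyConnected V) (h0 : wa 0 = wb 0) (h1 : va 1 = vb 1) :
    ∃ p ∈ frontier V, p ≠ va 1 ∧ SameWinding va vb p := by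
  by_contra! hcon
  have hv0 : va 0 = vb 0 := by rw [ha.image_eq 0 one_pos, hb.image_eq 0 one_pos, h0]
  let K : Set ℂ := {p | p ∉ V ∧ p ≠ va 1 ∧ SameWinding va vb p}
  have hKo : IsOpen K := by
    refine Metric.isOpen_iff.2 fun p ⟨hp, hpz, hps⟩ => ?_
    obtain ⟨r, hr, hball⟩ := ha.exists_sameWinding_iff hb h.mapsTo h0 h1 hp hpz
    have hpc : p ∉ closure V := fun hc => hcon p (h.isOpen.frontier_eq ▸ ⟨hc, hp⟩) hpz hps
    obtain ⟨r', hr', hball'⟩ := Metric.isOpen_iff.1 isClosed_closure.isOpen_compl p hpc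
    refine ⟨min r r', lt_min hr hr', fun q hq => ?_⟩
    obtain ⟨hq1, hq2⟩ := hball q (Metric.ball_subset_ball (min_le_left _ _) hq)
    exact ⟨fun hqV => hball' (Metric.ball_subset_ball (min_le_right _ _) hq) (subset_closure hqV),
      hq1, hq2.2 hps⟩
  let L : Set ℂ := {p | p ∈ V ∨ p ∉ V ∧ p ≠ va 1 ∧ ¬ SameWinding va vb p}
  have hLo : IsOpen L := by
    refine isOpen_iff_mem_nhds.2 fun p hp => ?_
    rcases hp with hpV | ⟨hpV, hpz, hps⟩
    · exact mem_of_superset (h.isOpen.mem_nhds hpV) fun q hq => Or.inl hq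
    · obtain ⟨r, hr, hball⟩ := ha.exists_sameWinding_iff hb h.mapsTo h0 h1 hpV hpz
      refine mem_of_superset (Metric.ball_mem_nhds p hr) fun q hq => ?_
      by_cases hqV : q ∈ V
      · exact Or.inl hqV
      · exact Or.inr ⟨hqV, (hball q hq).1, fun e => hps ((hball q hq).2.1 e)⟩
  have hconn : IsPreconnected ({va 1}ᶜ : Set ℂ) :=
    (isConnected_compl_singleton_of_one_lt_rank (by simp [Complex.rank_real_complex]) _).isPreconnected
  obtain ⟨R, hR⟩ := ha.exists_norm_lt
  obtain ⟨R', hR'⟩ := hb.exists_norm_lt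
  obtain ⟨p, hpV, hp⟩ := hVc.exists_notMem_norm_gt h.isOpen ha.image_right (max R R')
  have hpR := (le_max_left R R').trans_lt hp
  have hpR' := (le_max_right R R').trans_lt hp
  have hpz : p ≠ va 1 := by
    rintro rfl
    exact lt_irrefl _ (hpR.trans (hR 1))
  have hpK : p ∈ K := ⟨hpV, hpz, .of_norm_lt ha.cont_image hb.cont_image hv0 h1
    (fun s => (hR s).trans hpR) fun s => (hR' s).trans hpR'⟩
  have hxV : φ 0 ∈ V := h.mapsTo (by simp)
  have hcover : ({va 1}ᶜ : Set ℂ) ⊆ K ∪ L := fun q hqz => by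
    by_cases hqV : q ∈ V
    · exact Or.inr (Or.inl hqV)
    · by_cases hqs : SameWinding va vb q
      · exact Or.inl ⟨hqV, hqz, hqs⟩
      · exact Or.inr (Or.inr ⟨hqV, hqz, hqs⟩)
  obtain ⟨q, -, ⟨hq1, -, hq2⟩, hqV | ⟨-, -, hq3⟩⟩ := hconn K L hKo hLo hcover ⟨p, hpz, hpK⟩
    ⟨φ 0, fun e => ha.image_right (e ▸ hxV), Or.inl hxV⟩
  · exact hq1 hqV
  · exact hq3 hq2

/-- Two end paths with common endpoints have the same winding around the endpoint of a third. -/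
theorem exists_isEndPath_sameWinding (ha : IsEndPath V φ wa va) (hb : IsEndPath V φ wb vb)
    (h : IsRiemannMap V φ ψ) (hV : V ≠ univ) (hVc : IsSimplyConnected V) (h0 : wa 0 = wb 0)
    (h1 : va 1 = vb 1) :
    ∃ we ve, IsEndPath V φ we ve ∧ va 1 ≠ ve 1 ∧ SameWinding va vb (ve 1) := by
  obtain ⟨p, hpf, hpz, hps⟩ := ha.exists_mem_frontier_sameWinding hb h hVc h0 h1
  rw [h.isOpen.frontier_eq] at hpf
  obtain ⟨r, hr, hball⟩ := ha.exists_sameWinding_iff hb h.mapsTo h0 h1 hpf.2 hpz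
  obtain ⟨x, hxV, hx⟩ := Metric.mem_closure_iff.1 hpf.1 (r / 2) (by positivity)
  obtain ⟨q, hqV, hq⟩ := h.isOpen.isClosed_compl.exists_infDist_eq_dist ⟨p, hpf.2⟩ x
  have hle : dist x q ≤ dist x p := hq ▸ Metric.infDist_le_dist_of_mem hpf.2
  have hqp : q ∈ Metric.ball p r := by
    rw [Metric.mem_ball]
    have := dist_triangle_left q p x
    rw [dist_comm] at hx
    linarith
  obtain ⟨hqz, hqs⟩ := hball q hqp
  have hxq : 0 < dist x q := dist_pos.2 fun e => hqV (e ▸ hxV)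
  set c : ℝ → ℂ := fun t => x + t * (q - x) with hc
  have hcc : Continuous c := by simp only [c]; fun_prop
  have hcV : MapsTo c (Ico 0 1) V := fun t ht => by
    by_contra hn
    have h1 : dist x q ≤ dist x (c t) := hq ▸ Metric.infDist_le_dist_of_mem hn
    have h2 : dist x (c t) = t * dist x q := by
      simp only [c]
      rw [dist_comm, dist_eq_norm, add_sub_cancel_left, norm_mul, Complex.norm_real,
        Real.norm_of_nonneg ht.1, dist_comm, dist_eq_norm]
    nlinarith [ht.2]
  have hcq : Tendsto c (𝓝[<] 1) (𝓝 q) := by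
    have := hcc.tendsto 1
    simp only [c, Complex.ofReal_one, one_mul, add_sub_cancel] at this
    exact this.mono_left nhdsWithin_le_nhds
  obtain ⟨ξ, hξ, hlim⟩ := h.exists_tendsto_comp_curve hV hcc.continuousOn hcV hqV hcq
  obtain ⟨we, ve, he, -, -, hve, -⟩ := exists_isEndPath h.diff.continuousOn
    (h.diff_inv.continuousOn.comp hcc.continuousOn hcV) (h.mapsTo_inv.comp hcV) hξ hlim
    (hcq.congr' (by
      filter_upwards [Ico_mem_nhdsLT (zero_lt_one' ℝ)] with s hs
      exact (h.right_inv _ (hcV hs)).symm)) hqV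
  exact ⟨we, ve, he, hve ▸ hqz.symm, hve ▸ hqs.2 hps⟩

end IsEndPath

theorem exp_two_mul_arg_one_sub {u : ℂ} (hu : ‖u‖ = 1) (hne : u ≠ 1) :
    Complex.exp ((2 * Complex.arg (1 - u) : ℝ) * Complex.I) = -u := by
  have hx : 1 - u ≠ 0 := sub_ne_zero.2 hne.symm
  have hu0 : u ≠ 0 := norm_ne_zero_iff.1 (by rw [hu]; exact one_ne_zero)
  have hn : (‖1 - u‖ : ℂ) ≠ 0 := by exact_mod_cast norm_ne_zero_iff.2 hx
  have h1 := Complex.norm_mul_exp_arg_mul_I (1 - u)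
  have h2 : (‖1 - u‖ : ℂ) ^ 2 = (1 - u) * (1 - u⁻¹) := by
    have hc : (starRingEnd ℂ) u = u⁻¹ := by
      rw [Complex.inv_def, Complex.normSq_eq_norm_sq, hu]
      simp
    rw [← hc, ← map_one (starRingEnd ℂ), ← map_sub, map_one, Complex.mul_conj']
  have h3 : Complex.exp ((2 * Complex.arg (1 - u) : ℝ) * Complex.I) =
      Complex.exp (Complex.arg (1 - u) * Complex.I) ^ 2 := by
    rw [← Complex.exp_nat_mul]
    push_cast
    ring_nf
  rw [h3]
  have h4 : (‖1 - u‖ : ℂ) ^ 2 * Complex.exp (Complex.arg (1 - u) * Complex.I) ^ 2 =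
      (‖1 - u‖ : ℂ) ^ 2 * -u := by
    rw [← mul_pow, h1, h2]
    field_simp
    ring
  exact mul_left_cancel₀ (pow_ne_zero 2 hn) h4

theorem exp_arg_mul_I {u : ℂ} (hu : ‖u‖ = 1) : Complex.exp (Complex.arg u * Complex.I) = u := by
  simpa [hu] using Complex.norm_mul_exp_arg_mul_I u

theorem mem_slitPlane_neg {u : ℂ} (hu : ‖u‖ = 1) (hne : u ≠ 1) : -u ∈ Complex.slitPlane := by
  rw [Complex.mem_slitPlane_iff_arg]
  refine ⟨fun e => hne ?_, neg_ne_zero.2 (norm_ne_zero_iff.1 (by rw [hu]; exact one_ne_zero))⟩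
  have := exp_arg_mul_I (u := -u) (by rwa [norm_neg])
  rw [e, Complex.exp_pi_mul_I] at this
  exact (neg_inj.1 this).symm

theorem isPreconnected_unitCircle_compl {ξ : ℂ} (hξ : ‖ξ‖ = 1) :
    IsPreconnected {c : ℂ | ‖c‖ = 1 ∧ c ≠ ξ} := by
  have hξ0 : ξ ≠ 0 := norm_ne_zero_iff.1 (by rw [hξ]; exact one_ne_zero)
  have : {c : ℂ | ‖c‖ = 1 ∧ c ≠ ξ} =
      (fun τ : ℝ => -ξ * Complex.exp (τ * Complex.I)) '' Ioo (-Real.pi) Real.pi := by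
    ext c
    constructor
    · rintro ⟨hc, hne⟩
      have hn : ‖c / ξ‖ = 1 := by rw [norm_div, hc, hξ, div_one]
      have hs := mem_slitPlane_neg hn fun e => hne ((div_eq_one_iff_eq hξ0).1 e)
      refine ⟨Complex.arg (-(c / ξ)), ⟨Complex.neg_pi_lt_arg _, (Complex.arg_le_pi _).lt_of_ne
        (Complex.mem_slitPlane_iff_arg.1 hs).1⟩, ?_⟩
      simp only
      rw [exp_arg_mul_I (by rwa [norm_neg])]
      field_simp
    · rintro ⟨τ, hτ, rfl⟩
      refine ⟨by simp only [norm_mul, norm_neg, hξ, Complex.norm_exp_ofReal_mul_I, mul_one],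
        fun e => ?_⟩
      have h1 : Complex.exp (τ * Complex.I) = -1 := by
        have : -ξ * Complex.exp (τ * Complex.I) = -ξ * -1 := by simpa using e
        exact mul_left_cancel₀ (neg_ne_zero.2 hξ0) this
      have h2 := Complex.arg_exp_mul_I τ
      rw [h1, Complex.arg_neg_one, (toIocMod_eq_self Real.two_pi_pos).2
        ⟨hτ.1, by linarith [hτ.2]⟩] at h2
      exact hτ.2.ne h2.symm
  rw [this]
  exact isPreconnected_Ioo.image _ (by fun_prop)

/-- The angular displacement of an injective circle map without fixed points, seen from a point
of the circle. -/
theorem arg_one_sub_div_sub_eq {Γ : ℂ → ℂ} (hΓ : ContinuousOn Γ (Metric.closedBall 0 1))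
    (hinj : InjOn Γ (Metric.closedBall 0 1)) (hbd : ∀ ζ, ‖ζ‖ = 1 → ‖Γ ζ‖ = 1)
    (hfix : ∀ ζ, ‖ζ‖ = 1 → Γ ζ ≠ ζ) {ξ a b : ℂ} (hξ : ‖ξ‖ = 1) (ha : ‖a‖ = 1) (hb : ‖b‖ = 1)
    (haξ : a ≠ ξ) (hbξ : b ≠ ξ) :
    2 * Complex.arg (1 - Γ a / Γ ξ) - 2 * Complex.arg (1 - a / ξ) - Complex.arg (-(Γ a / a)) =
      2 * Complex.arg (1 - Γ b / Γ ξ) - 2 * Complex.arg (1 - b / ξ) - Complex.arg (-(Γ b / b)) := by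
  have hne0 : ∀ c : ℂ, ‖c‖ = 1 → c ≠ 0 := fun c hc =>
    norm_ne_zero_iff.1 (by rw [hc]; exact one_ne_zero)
  have hcb : ∀ c : ℂ, ‖c‖ = 1 → c ∈ Metric.closedBall (0 : ℂ) 1 := fun c hc =>
    mem_closedBall_zero_iff.2 hc.le
  set S : Set ℂ := {c : ℂ | ‖c‖ = 1 ∧ c ≠ ξ}
  have hΓS : ContinuousOn Γ S := hΓ.mono fun c hc => hcb c hc.1
  have hΓne : ∀ c ∈ S, Γ c ≠ Γ ξ := fun c hc e => hc.2 (hinj (hcb c hc.1) (hcb ξ hξ) e)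
  have hdiv : ∀ c d : ℂ, ‖c‖ = 1 → ‖d‖ = 1 → ‖c / d‖ = 1 := fun c d hc hd => by
    rw [norm_div, hc, hd, div_one]
  have h1 : ContinuousOn (fun c => Complex.arg (1 - Γ c / Γ ξ)) S := fun c hc =>
    (Complex.continuousAt_arg (one_sub_div_mem_slitPlane (hbd c hc.1).le (hbd ξ hξ)
      (hΓne c hc)).1).comp_continuousWithinAt (f := fun c => 1 - Γ c / Γ ξ)
        (continuousWithinAt_const.sub ((hΓS c hc).div_const _))
  have h2 : ContinuousOn (fun c => Complex.arg (1 - c / ξ)) S := fun c hc =>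
    (Complex.continuousAt_arg (one_sub_div_mem_slitPlane hc.1.le hξ
      hc.2).1).comp_continuousWithinAt (f := fun c => 1 - c / ξ)
        (continuousWithinAt_const.sub (continuousWithinAt_id.div_const _))
  have hs : ∀ c : ℂ, ‖c‖ = 1 → -(Γ c / c) ∈ Complex.slitPlane := fun c hc =>
    mem_slitPlane_neg (hdiv _ _ (hbd c hc) hc) fun e =>
      hfix c hc ((div_eq_one_iff_eq (hne0 c hc)).1 e)
  have h3 : ContinuousOn (fun c => Complex.arg (-(Γ c / c))) S := fun c hc =>
    (Complex.continuousAt_arg (hs c hc.1)).comp_continuousWithinAt (f := fun c => -(Γ c / c))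
      ((hΓS c hc).div continuousWithinAt_id (hne0 c hc.1)).neg
  have key := (isPreconnected_unitCircle_compl hξ).sub_eq_sub_of_exp_eq
    (f := fun c => ((2 * Complex.arg (1 - Γ c / Γ ξ) - 2 * Complex.arg (1 - c / ξ) -
      Complex.arg (-(Γ c / c)) : ℝ) : ℂ) * Complex.I) (g := fun _ => 0)
    ((Complex.continuous_ofReal.comp_continuousOn
      (((continuousOn_const.mul h1).sub (continuousOn_const.mul h2)).sub h3)).mul
        continuousOn_const) continuousOn_const (k := -(ξ / Γ ξ)) (fun c hc => by
      have hc0 := hne0 c hc.1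
      have hξ0 := hne0 ξ hξ
      have hΓc0 := hne0 _ (hbd c hc.1)
      have hΓξ0 := hne0 _ (hbd ξ hξ)
      have e1 := exp_two_mul_arg_one_sub (hdiv _ _ (hbd c hc.1) (hbd ξ hξ))
        fun e => hΓne c hc ((div_eq_one_iff_eq hΓξ0).1 e)
      have e2 := exp_two_mul_arg_one_sub (hdiv _ _ hc.1 hξ)
        fun e => hc.2 ((div_eq_one_iff_eq hξ0).1 e)
      have e3 := exp_arg_mul_I (u := -(Γ c / c)) (by rw [norm_neg, hdiv _ _ (hbd c hc.1) hc.1])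
      rw [Complex.ofReal_sub, Complex.ofReal_sub, sub_mul, sub_mul, Complex.exp_sub,
        Complex.exp_sub, e1, e2, e3, Complex.exp_zero, mul_one]
      field_simp) (x := b) (y := a) ⟨hb, hbξ⟩ ⟨ha, haξ⟩
  simp only [sub_zero] at key
  exact_mod_cast mul_right_cancel₀ Complex.I_ne_zero key

namespace IsEndPath

variable {V : Set ℂ} {φ ψ : ℂ → ℂ} {g : ℂ ≃ₜ ℂ} {w v wa va wb vb we ve : ℝ → ℂ} {Γ : ℂ → ℂ}

theorem comp_homeomorph (hw : IsEndPath V φ w v) (h : IsRiemannMap V φ ψ) (hg : g '' V = V)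
    (hΓ : ContinuousOn Γ (Metric.closedBall 0 1)) (heq : EqOn Γ (discConj φ ψ g) (Metric.ball 0 1))
    (hbd : ∀ ζ, ‖ζ‖ = 1 → ‖Γ ζ‖ = 1) :
    IsEndPath V φ (fun s => Γ (w s)) fun s => g (v s) where
  cont := hΓ.comp_continuous hw.cont fun s => mem_closedBall_zero_iff.2 (hw.norm_le s)
  cont_image := g.continuous.comp hw.cont_image
  mem s hs := heq (hw.mem s hs) ▸ h.discConj_mapsTo hg (hw.mem s hs)
  image_eq s hs := by rw [heq (hw.mem s hs), h.map_discConj hg (hw.mem s hs), hw.image_eq s hs]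
  const_left s hs := by rw [hw.const_left s hs]
  const_right s hs := by rw [hw.const_right s hs]
  image_const_right s hs := by rw [hw.image_const_right s hs]
  norm_right := hbd _ hw.norm_right
  image_right hm := by
    rw [← hg] at hm
    obtain ⟨x, hx, e⟩ := hm
    exact hw.image_right (g.injective e ▸ hx)

/-- The change of the logarithm along an end path under the dynamics, corrected by the angular
displacement of its end on the circle, depends only on the endpoint of the image. -/
theorem im_sub_add_arg_eq (ha : IsEndPath V φ wa va) (hb : IsEndPath V φ wb vb)
    (h : IsRiemannMap V φ ψ) (hV : V ≠ univ) (hVc : IsSimplyConnected V) (hg : g '' V = V)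
    (hΓ : ContinuousOn Γ (Metric.closedBall 0 1)) (heq : EqOn Γ (discConj φ ψ g) (Metric.ball 0 1))
    (hbd : ∀ ζ, ‖ζ‖ = 1 → ‖Γ ζ‖ = 1) (hΓi : InjOn Γ (Metric.closedBall 0 1))
    (hfix : ∀ ζ, ‖ζ‖ = 1 → Γ ζ ≠ ζ)
    {H : unitInterval × ℂ → ℂ} (hH : Continuous H) (hid : ∀ x, H (0, x) = x)
    (hH1 : ∀ x, H (1, x) = g x) (hinj : ∀ t, Function.Injective fun x => H (t, x))
    (h0 : wa 0 = wb 0) (h1 : va 1 = vb 1)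
    {m : ℂ → ℂ} (hm : ContinuousOn m (Metric.ball 0 1))
    (hexp : ∀ w ∈ Metric.ball (0 : ℂ) 1, Complex.exp (m w) = divDiff φ w 0)
    {ya yb ya' yb' : ℂ} (hya : Tendsto (fun s => m (wa s)) (𝓝[<] 1) (𝓝 ya))
    (hyb : Tendsto (fun s => m (wb s)) (𝓝[<] 1) (𝓝 yb))
    (hya' : Tendsto (fun s => m (Γ (wa s))) (𝓝[<] 1) (𝓝 ya'))
    (hyb' : Tendsto (fun s => m (Γ (wb s))) (𝓝[<] 1) (𝓝 yb')) :
    (ya' - ya).im + Complex.arg (-(Γ (wa 1) / wa 1)) =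
      (yb' - yb).im + Complex.arg (-(Γ (wb 1) / wb 1)) := by
  obtain ⟨we, ve, he, hne, hS⟩ := ha.exists_isEndPath_sameWinding hb h hV hVc h0 h1
  have hv0 : va 0 = vb 0 := by rw [ha.image_eq 0 one_pos, hb.image_eq 0 one_pos, h0]
  have e1 := ha.im_sub_eq hb he h hV h0 h1 hne hS hm hexp hya hyb
  have havoid : ∀ {w v : ℝ → ℂ}, IsEndPath V φ w v → ve 1 ≠ v 1 → ∀ s, v s ≠ ve 1 := by
    intro w v hw hwe s e
    rcases hw.image_mem h.mapsTo s with hs | hs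
    · exact he.image_right (e ▸ hs)
    · exact hwe (e ▸ hs)
  have hS' := hS.isotopy ha.cont_image hb.cont_image hv0 h1 (havoid ha hne.symm)
    (havoid hb (h1 ▸ hne.symm)) hH hid hinj
  simp only [hH1] at hS'
  have e2 := (ha.comp_homeomorph h hg hΓ heq hbd).im_sub_eq (hb.comp_homeomorph h hg hΓ heq hbd)
    (he.comp_homeomorph h hg hΓ heq hbd) h hV (by rw [h0]) (by rw [h1])
    (g.injective.ne hne) hS' hm hexp hya' hyb'
  have e3 := arg_one_sub_div_sub_eq hΓ hΓi hbd hfix he.norm_right ha.norm_right hb.norm_right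
    (ha.end_ne he h hV hne) (hb.end_ne he h hV (h1 ▸ hne))
  simp only [Complex.sub_im] at e1 e2 ⊢
  linarith

/-- Logarithms at two end paths with common endpoints differ by less than a full turn. -/
theorem abs_im_sub_lt (ha : IsEndPath V φ wa va) (hb : IsEndPath V φ wb vb)
    (h : IsRiemannMap V φ ψ) (hV : V ≠ univ) (hVc : IsSimplyConnected V)
    (h0 : wa 0 = wb 0) (h1 : va 1 = vb 1)
    {m : ℂ → ℂ} (hm : ContinuousOn m (Metric.ball 0 1))
    (hexp : ∀ w ∈ Metric.ball (0 : ℂ) 1, Complex.exp (m w) = divDiff φ w 0)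
    {ya yb : ℂ} (hya : Tendsto (fun s => m (wa s)) (𝓝[<] 1) (𝓝 ya))
    (hyb : Tendsto (fun s => m (wb s)) (𝓝[<] 1) (𝓝 yb)) : |(yb - ya).im| < 2 * Real.pi := by
  obtain ⟨we, ve, he, hne, hS⟩ := ha.exists_isEndPath_sameWinding hb h hV hVc h0 h1
  rw [ha.im_sub_eq hb he h hV h0 h1 hne hS hm hexp hya hyb]
  have key : ∀ {w v : ℝ → ℂ}, IsEndPath V φ w v → v 1 ≠ ve 1 →
      |Complex.arg (1 - w 1 / we 1)| < Real.pi / 2 := fun hw hwe =>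
    Complex.abs_arg_lt_pi_div_two_iff.2 (Or.inl
      (one_sub_div_mem_slitPlane hw.norm_right.le he.norm_right (hw.end_ne he h hV hwe)).2)
  have k1 := abs_lt.1 (key ha hne)
  have k2 := abs_lt.1 (key hb (h1 ▸ hne))
  rw [abs_lt]
  constructor <;> linarith [k1.1, k1.2, k2.1, k2.2]

end IsEndPath

theorem exists_abs_arg_neg_div_le {Γ : ℂ → ℂ} (hΓ : ContinuousOn Γ (Metric.closedBall 0 1))
    (hbd : ∀ ζ, ‖ζ‖ = 1 → ‖Γ ζ‖ = 1) (hfix : ∀ ζ, ‖ζ‖ = 1 → Γ ζ ≠ ζ) :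
    ∃ ε > 0, ∀ ζ, ‖ζ‖ = 1 → |Complex.arg (-(Γ ζ / ζ))| ≤ Real.pi - ε := by
  have hne0 : ∀ c : ℂ, ‖c‖ = 1 → c ≠ 0 := fun c hc =>
    norm_ne_zero_iff.1 (by rw [hc]; exact one_ne_zero)
  have hs : ∀ c : ℂ, ‖c‖ = 1 → -(Γ c / c) ∈ Complex.slitPlane := fun c hc =>
    mem_slitPlane_neg (by rw [norm_div, hbd c hc, hc, div_one]) fun e =>
      hfix c hc ((div_eq_one_iff_eq (hne0 c hc)).1 e)
  have hcont : ContinuousOn (fun c => |Complex.arg (-(Γ c / c))|) (Metric.sphere 0 1) := by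
    intro c hc
    have hc' : ‖c‖ = 1 := mem_sphere_zero_iff_norm.1 hc
    exact ((Complex.continuousAt_arg (hs c hc')).comp_continuousWithinAt
      (f := fun c => -(Γ c / c)) (((hΓ.mono Metric.sphere_subset_closedBall) c hc).div
        continuousWithinAt_id (hne0 c hc')).neg).abs
  obtain ⟨c, hc, hmax⟩ := (isCompact_sphere (0 : ℂ) 1).exists_isMaxOn ⟨1, by simp⟩ hcont
  have hlt : |Complex.arg (-(Γ c / c))| < Real.pi := by
    refine (Complex.abs_arg_le_pi _).lt_of_ne fun e => ?_
    have := (Complex.mem_slitPlane_iff_arg.1 (hs c (mem_sphere_zero_iff_norm.1 hc))).1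
    rcases abs_eq Real.pi_pos.le |>.1 e with e | e
    · exact this e
    · linarith [Complex.neg_pi_lt_arg (-(Γ c / c))]
  exact ⟨Real.pi - |Complex.arg (-(Γ c / c))|, by linarith, fun ζ hζ => by
    have : |Complex.arg (-(Γ ζ / ζ))| ≤ _ := hmax (mem_sphere_zero_iff_norm.2 hζ)
    linarith⟩

theorem pi_le_abs_of_exp_eq_neg_one {κ : ℝ} (hκ : Complex.exp (κ * Complex.I) = -1) :
    κ ≤ -Real.pi ∨ Real.pi ≤ κ := by
  by_contra! hlt
  have := Complex.arg_exp_mul_I κ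
  rw [hκ, Complex.arg_neg_one, (toIocMod_eq_self Real.two_pi_pos).2
    ⟨hlt.1, by linarith [hlt.2]⟩] at this
  exact hlt.2.ne this.symm

theorem exp_im_mul_I_of_exp_eq {x u : ℂ} (hx : Complex.exp x = u) (hu : ‖u‖ = 1) :
    Complex.exp (x.im * Complex.I) = u := by
  have hre : x.re = 0 := by
    rw [← hx, Complex.norm_exp] at hu
    exact Real.exp_eq_one_iff _ |>.1 hu
  rw [← hx]
  congr 1
  apply Complex.ext <;> simp [hre]

/-- If a homeomorphism of the plane isotopic to the identity preserves `V` and fixes the endpoint of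
a path in `V`, then it has a fixed point on the circle of prime ends. -/
theorem IsEndPath.exists_fixed {V : Set ℂ} {φ ψ : ℂ → ℂ} {g : ℂ ≃ₜ ℂ} {w v : ℝ → ℂ} {Γ : ℂ → ℂ}
    (hw : IsEndPath V φ w v) (h : IsRiemannMap V φ ψ) (hV : V ≠ univ) (hVc : IsSimplyConnected V)
    (hg : g '' V = V) (hΓ : ContinuousOn Γ (Metric.closedBall 0 1))
    (heq : EqOn Γ (discConj φ ψ g) (Metric.ball 0 1))
    (hbd : ∀ ζ, ‖ζ‖ = 1 → ‖Γ ζ‖ = 1) (hΓi : InjOn Γ (Metric.closedBall 0 1))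
    {H : unitInterval × ℂ → ℂ} (hH : Continuous H) (hid : ∀ x, H (0, x) = x)
    (hH1 : ∀ x, H (1, x) = g x) (hinj : ∀ t, Function.Injective fun x => H (t, x))
    (hgv : g (v 1) = v 1) : ∃ ζ, ‖ζ‖ = 1 ∧ Γ ζ = ζ := by
  by_contra! hfix
  obtain ⟨m, hm, hexp⟩ := h.exists_log_divDiff_zero
  have hne0 : ∀ c : ℂ, ‖c‖ = 1 → c ≠ 0 := fun c hc =>
    norm_ne_zero_iff.1 (by rw [hc]; exact one_ne_zero)
  let T := {p : (ℝ → ℂ) × (ℝ → ℂ) // IsEndPath V φ p.1 p.2 ∧ p.1 0 = 0 ∧ p.2 1 = v 1}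
  have hvφ : v 1 ≠ φ 0 := fun e => hw.image_right (e ▸ h.mapsTo (by simp))
  have hY : ∀ p : T, ∃ y, Tendsto (fun s => m (p.1.1 s)) (𝓝[<] 1) (𝓝 y) ∧
      Complex.exp y = (v 1 - φ 0) / p.1.1 1 := fun p => by
    have := p.2.1.exists_tendsto_log hm hexp (by rw [p.2.2.2]; exact hvφ)
    rwa [p.2.2.2] at this
  choose Y hYlim hYexp using hY
  have hnext : ∀ p : T, ∃ q : T, q.1.1 1 = Γ (p.1.1 1) ∧
      Tendsto (fun s => m (Γ (p.1.1 s))) (𝓝[<] 1) (𝓝 (Y q)) := fun p => by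
    have hp := p.2.1.comp_homeomorph h hg hΓ heq hbd
    obtain ⟨w', v', hw', hw0, hw1, hv1, hgerm⟩ := hp.exists_start_zero h.diff.continuousOn
    refine ⟨⟨(w', v'), hw', hw0, by simp only [hv1, p.2.2.2, hgv]⟩, hw1, ?_⟩
    have hvp : g (p.1.2 1) ≠ φ 0 := by rwa [p.2.2.2, hgv]
    obtain ⟨y, hy, -⟩ := hp.exists_tendsto_log hm hexp hvp
    have haff : Tendsto (fun s : ℝ => 2 * s - 1) (𝓝[<] 1) (𝓝[<] 1) := by
      refine tendsto_nhdsWithin_iff.2 ⟨Tendsto.mono_left ?_ nhdsWithin_le_nhds, ?_⟩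
      · have := (by fun_prop : Continuous fun s : ℝ => 2 * s - 1).tendsto 1
        norm_num at this
        exact this
      · filter_upwards [self_mem_nhdsWithin] with s hs
        have : s < 1 := hs
        simp only [mem_Iio]
        linarith
    have hlim := hYlim ⟨(w', v'), hw', hw0, by simp only [hv1, p.2.2.2, hgv]⟩
    have hlim' := (hy.comp haff).congr' (f₂ := fun s => m (w' s)) (by
      filter_upwards [Ico_mem_nhdsLT (show (1 / 2 : ℝ) < 1 by norm_num)] with s hs
      simp only [Function.comp_apply, hgerm s hs])
    exact tendsto_nhds_unique hlim hlim' ▸ hy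
  choose N hN1 hNlim using hnext
  obtain ⟨ε, hε, hδ⟩ := exists_abs_arg_neg_div_le hΓ hbd hfix
  obtain ⟨w₀, v₀, hw₀, hw₀0, -, hv₀1, -⟩ := hw.exists_start_zero h.diff.continuousOn
  set p₀ : T := ⟨(w₀, v₀), hw₀, hw₀0, hv₀1⟩
  set κ : ℝ := (Y (N p₀) - Y p₀).im + Complex.arg (-(Γ (p₀.1.1 1) / p₀.1.1 1)) with hκ
  have hstep : ∀ p : T, (Y (N p) - Y p).im + Complex.arg (-(Γ (p.1.1 1) / p.1.1 1)) = κ := fun p =>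
    p.2.1.im_sub_add_arg_eq p₀.2.1 h hV hVc hg hΓ heq hbd hΓi hfix hH hid hH1 hinj
      (p.2.2.1.trans p₀.2.2.1.symm) (p.2.2.2.trans p₀.2.2.2.symm) hm hexp (hYlim p) (hYlim p₀)
      (hNlim p) (hNlim p₀)
  have hκ1 : Complex.exp (κ * Complex.I) = -1 := by
    have hn : ‖p₀.1.1 1‖ = 1 := p₀.2.1.norm_right
    have hz0 : v 1 - φ 0 ≠ 0 := sub_ne_zero.2 hvφ
    have hn0 := hne0 _ hn
    have hn0' := hne0 _ (hbd _ hn)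
    have e1 : Complex.exp (Y (N p₀) - Y p₀) = p₀.1.1 1 / Γ (p₀.1.1 1) := by
      rw [Complex.exp_sub, hYexp, hYexp, hN1]
      field_simp
    rw [hκ, Complex.ofReal_add, add_mul, Complex.exp_add,
      exp_im_mul_I_of_exp_eq e1 (by rw [norm_div, hn, hbd _ hn, div_one]),
      exp_arg_mul_I (by rw [norm_neg, norm_div, hn, hbd _ hn, div_one])]
    field_simp
  have hbound : ∀ n : ℕ, |(Y (N^[n] p₀) - Y p₀).im| < 2 * Real.pi := fun n =>
    p₀.2.1.abs_im_sub_lt (N^[n] p₀).2.1 h hV hVc (p₀.2.2.1.trans (N^[n] p₀).2.2.1.symm)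
      (p₀.2.2.2.trans (N^[n] p₀).2.2.2.symm) hm hexp (hYlim _) (hYlim _)
  obtain ⟨n, hn⟩ := exists_nat_gt (2 * Real.pi / ε)
  rw [div_lt_iff₀ hε] at hn
  have hsucc : ∀ n, (Y (N^[n + 1] p₀) - Y p₀).im = (Y (N^[n] p₀) - Y p₀).im + κ -
      Complex.arg (-(Γ ((N^[n] p₀).1.1 1) / (N^[n] p₀).1.1 1)) := fun n => by
    have := hstep (N^[n] p₀)
    rw [Function.iterate_succ_apply']
    simp only [Complex.sub_im] at this ⊢
    linarith
  have hδ' := fun n => abs_le.1 (hδ _ (N^[n] p₀).2.1.norm_right)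
  rcases pi_le_abs_of_exp_eq_neg_one hκ1 with hk | hk
  · have : ∀ n : ℕ, (Y (N^[n] p₀) - Y p₀).im ≤ -(n * ε) := fun n => by
      induction n with
      | zero => simp
      | succ n ih =>
        rw [hsucc]
        push_cast
        linarith [(hδ' n).1]
    linarith [(abs_lt.1 (hbound n)).1, this n]
  · have : ∀ n : ℕ, n * ε ≤ (Y (N^[n] p₀) - Y p₀).im := fun n => by
      induction n with
      | zero => simp
      | succ n ih =>
        rw [hsucc]
        push_cast
        linarith [(hδ' n).2]
    linarith [(abs_lt.1 (hbound n)).2, this n]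

/-- An accessible fixed point yields an invariant prime chain. -/
theorem exists_isPrimeChain_chainDivides_of_accessible {V : Set ℂ} (hVo : IsOpen V)
    (hVc : IsSimplyConnected V) {g : ℂ ≃ₜ ℂ} (hg : g '' V = V)
    {H : unitInterval × ℂ → ℂ} (hH : Continuous H) (hid : ∀ x, H (0, x) = x)
    (hH1 : ∀ x, H (1, x) = g x) (hinj : ∀ t, Function.Injective fun x => H (t, x))
    {c : ℝ → ℂ} (hc : ContinuousOn c (Ico 0 1)) (hcV : MapsTo c (Ico 0 1) V) {p : ℂ} (hp : p ∉ V)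
    (hcp : Tendsto c (𝓝[<] 1) (𝓝 p)) (hgp : g p = p) :
    ∃ C, IsPrimeChain V C ∧ ChainDivides (fun n => g '' C n) C := by
  have hV : V ≠ univ := fun e => hp (e ▸ mem_univ p)
  obtain ⟨φ, ψ, hφ, hψ, hφm, hψm, hψφ, hφψ⟩ := exists_riemann_map hVo hVc hV
  have h : IsRiemannMap V φ ψ := ⟨hVo, hφ, hψ, hφm, hψm, hψφ, hφψ⟩
  obtain ⟨Γ, hΓ, heq, hbd, hmaps⟩ := h.exists_discConj_extension hV hg
  obtain ⟨ξ, hξ, hlim⟩ := h.exists_tendsto_comp_curve hV hc hcV hp hcp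
  obtain ⟨w, v, hw, -, -, hv, -⟩ := exists_isEndPath hφ.continuousOn
    (hψ.continuousOn.comp hc hcV) (hψm.comp hcV) hξ hlim
    (hcp.congr' (by
      filter_upwards [Ico_mem_nhdsLT (zero_lt_one' ℝ)] with s hs
      exact (hφψ _ (hcV hs)).symm)) hp
  obtain ⟨ζ, hζ, hζf⟩ := hw.exists_fixed h hV hVc hg hΓ heq hbd
    (h.injOn_of_eqOn_discConj hV hg hΓ hmaps heq) hH hid hH1 hinj (by rw [hv, hgp])
  exact h.exists_isPrimeChain_chainDivides hV hg hΓ heq hζ hζf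

/-- If the boundary of an invariant open simply connected proper subset `U`
of the plane contains an accessible fixed point, then `ρ(f,U) = 0`: every extension of
`f|_U` to the prime ends compactification has a fixed prime end. -/
theorem accessible_fixed_point_gives_rotation_zero
    (f : (ℝ × ℝ) ≃ₜ (ℝ × ℝ)) (hor : IsOrientationPreserving f)
    (U : Set (ℝ × ℝ)) (hUopen : IsOpen U) (hUinv : ⇑f '' U = U)
    (hUsc : SimplyConnectedSpace ↥U) (hUproper : U ≠ Set.univ)
    (hUcompl : Set.Nontrivial Uᶜ)
    (z : ℝ × ℝ) (hz : z ∈ frontier U) (hzfix : f z = z) (hzacc : IsAccessiblePoint U z) :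
    ∀ F : PrimeEndComp U ≃ₜ PrimeEndComp U, IsPEExtension f U F →
      ∃ p : PrimeEnd U, F (peEnd U p) = peEnd U p := by
  intro F hF
  let e : ℂ ≃ₜ ℝ × ℝ := Complex.equivRealProdCLM.toHomeomorph
  obtain ⟨H, hH, hH0, hH1, hHh⟩ := hor
  obtain ⟨γ, ⟨hγc, -, hγU, -⟩, hγz⟩ := hzacc
  have hU : e '' (e ⁻¹' U) = U := e.image_preimage U
  have hVc : IsSimplyConnected (e ⁻¹' U) := e.isSimplyConnected_preimage.2 hUsc
  obtain ⟨C, hC, hdiv⟩ := exists_isPrimeChain_chainDivides_of_accessible (V := e ⁻¹' U)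
    (hUopen.preimage e.continuous) hVc (g := (e.trans f).trans e.symm)
    (by
      ext x
      constructor
      · rintro ⟨y, hy, rfl⟩
        have : f (e y) ∈ U := hUinv ▸ mem_image_of_mem f hy
        simpa using this
      · intro hx
        have hx' : e x ∈ ⇑f '' U := by rw [hUinv]; exact hx
        obtain ⟨y, hy, hyx⟩ := hx'
        exact ⟨e.symm y, by simpa using hy, by simp [hyx]⟩)
    (H := fun x => e.symm (H (x.1, e x.2)))
    (e.symm.continuous.comp (hH.comp (by fun_prop)))
    (fun x => by simp [hH0]) (fun x => by simp [hH1])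
    (fun t => e.symm.injective.comp ((hHh t).injective.comp e.injective))
    (c := fun s => e.symm (γ s)) (e.symm.continuous.comp_continuousOn hγc)
    (fun s hs => by simpa using hγU s hs) (p := e.symm z)
    (by
      rw [hUopen.frontier_eq] at hz
      simpa using hz.2)
    ((e.symm.continuous.tendsto z).comp hγz) (by simp [hzfix])
  have hC' := hC.image e
  rw [hU] at hC'
  refine exists_fixed_primeEnd_of_chainDivides f hUinv hC' (fun n => ?_) F hF
  obtain ⟨k, hk⟩ := hdiv n
  refine ⟨k, ?_⟩
  rintro _ ⟨_, ⟨x, hx, rfl⟩, rfl⟩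
  exact ⟨_, hk (mem_image_of_mem _ hx), by simp⟩

end
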